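/- There exists a polynomial P such that for every integer N ≥ 1, pg(N) ≤ P(N) · 187.53^N; that is, pg(N) = O*(187.53^N). -/

import Mathlib

open scoped Classical

noncomputable section

/-- A point in the plane. -/
abbrev Pt : Type := ℝ × ℝ

/-- `S` is in general position: no three distinct points of `S` are collinear. -/
def GenPos (S : Finset Pt) : Prop :=
  ∀ p ∈ S, ∀ q ∈ S, ∀ r ∈ S, p ≠ q → p ≠ r → q ≠ r →
    ¬ Collinear ℝ ({p, q, r} : Set Pt)

/-- Two straight edges cross if their relative interiors (open segments) meet. -/
def EdgesCross (e f : Sym2 Pt) : Prop :=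
  ∃ a b c d : Pt, e = s(a, b) ∧ f = s(c, d) ∧
    (openSegment ℝ a b ∩ openSegment ℝ c d).Nonempty

/-- `G` is a crossing-free straight-edge (plane) graph on the point set `S`:
its edges are nondegenerate straight segments between points of `S`,
and no two distinct edges cross. -/
def IsPlaneGraph (S : Finset Pt) (G : Finset (Sym2 Pt)) : Prop :=
  (∀ e ∈ G, ¬ e.IsDiag ∧ ∀ p ∈ e, p ∈ S) ∧
    ∀ e ∈ G, ∀ f ∈ G, e ≠ f → ¬ EdgesCross e f

/-- The (finite) collection of all plane graphs on `S`. -/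
def planeGraphs (S : Finset Pt) : Finset (Finset (Sym2 Pt)) :=
  S.sym2.powerset.filter (IsPlaneGraph S)

/-- The degree of the point `p` in the graph `G`. -/
def vingDeg (G : Finset (Sym2 Pt)) (p : Pt) : ℕ :=
  (G.filter fun e => p ∈ e).card

/-- The ving `(p, G)` is an x-ving: no straight edge from `p` to another point
of `S` can be added to `G` while keeping the graph plane. -/
def IsXVing (S : Finset Pt) (G : Finset (Sym2 Pt)) (p : Pt) : Prop :=
  ∀ q ∈ S, q ≠ p → s(p, q) ∉ G → ¬ IsPlaneGraph S (insert s(p, q) G)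

/-- `v_x(G)`: the number of x-vings of `G`. -/
def vx (S : Finset Pt) (G : Finset (Sym2 Pt)) : ℕ :=
  (S.filter (IsXVing S G)).card

/-- `v_i(G)`: the number of vertices of degree exactly `i` in `G`. -/
def vdeg (S : Finset Pt) (G : Finset (Sym2 Pt)) (i : ℕ) : ℕ :=
  (S.filter fun p => vingDeg G p = i).card

/-- `ĥv_x(S)`: the average of `v_x(G)` over a uniformly random plane graph on `S`. -/
def hvx (S : Finset Pt) : ℝ :=
  (∑ G ∈ planeGraphs S, (vx S G : ℝ)) / (planeGraphs S).card

/-- `ĥv_i(S)`: the average of `v_i(G)` over a uniformly random plane graph on `S`. -/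
def hvdeg (S : Finset Pt) (i : ℕ) : ℝ :=
  (∑ G ∈ planeGraphs S, (vdeg S G i : ℝ)) / (planeGraphs S).card

/-- `pg(N)`: the maximum number of plane graphs over all sets of `N` points in
general position. -/
def pgMax (N : ℕ) : ℕ :=
  sSup {n : ℕ | ∃ S : Finset Pt, S.card = N ∧ GenPos S ∧ (planeGraphs S).card = n}

/-- The plane graphs on `S` with at most `m` edges. -/
def planeGraphsLE (S : Finset Pt) (m : ℝ) : Finset (Finset (Sym2 Pt)) :=
  (planeGraphs S).filter fun G => (G.card : ℝ) ≤ m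

/-- `ĥv_{x,m}(S)`: the average of `v_x(G)` over a uniformly random plane graph
on `S` with at most `m` edges. -/
def hvxLE (S : Finset Pt) (m : ℝ) : ℝ :=
  (∑ G ∈ planeGraphsLE S m, (vx S G : ℝ)) / (planeGraphsLE S m).card

/-- `G` has no vertex (point of `S`) of degree smaller than `i`. -/
def MinDegGe (S : Finset Pt) (G : Finset (Sym2 Pt)) (i : ℕ) : Prop :=
  ∀ p ∈ S, i ≤ vingDeg G p

/-- The plane graphs on `S` with no vertex of degree smaller than `i`. -/
def planeGraphsDeg (S : Finset Pt) (i : ℕ) : Finset (Finset (Sym2 Pt)) :=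
  (planeGraphs S).filter fun G => MinDegGe S G i

/-- The plane graphs on `S` with at most `m` edges and no vertex of degree
smaller than `i`. -/
def planeGraphsLEDeg (S : Finset Pt) (m : ℝ) (i : ℕ) : Finset (Finset (Sym2 Pt)) :=
  (planeGraphs S).filter fun G => (G.card : ℝ) ≤ m ∧ MinDegGe S G i

/-- `ĥv_{x,m}(S,i)`: the average of `v_x(G)` over a uniformly random plane graph
on `S` with at most `m` edges and no vertex of degree smaller than `i`. -/
def hvxLEDeg (S : Finset Pt) (m : ℝ) (i : ℕ) : ℝ :=
  (∑ G ∈ planeGraphsLEDeg S m i, (vx S G : ℝ)) / (planeGraphsLEDeg S m i).card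

/-- `pg(N, i)`: the maximum, over sets `S` of `N` points in general position, of
the number of plane graphs on `S` with no vertex of degree smaller than `i`. -/
def pgMaxDeg (N i : ℕ) : ℕ :=
  sSup {n : ℕ | ∃ S : Finset Pt, S.card = N ∧ GenPos S ∧ (planeGraphsDeg S i).card = n}

/-- The underlying abstract graph of `G` on the vertex set `S`. -/
def abstractGraph (S : Finset Pt) (G : Finset (Sym2 Pt)) :
    SimpleGraph (S : Set Pt) :=
  SimpleGraph.induce (S : Set Pt) (SimpleGraph.fromEdgeSet (G : Set (Sym2 Pt)))

/-- The connected plane graphs on `S`. -/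
def connPlaneGraphs (S : Finset Pt) : Finset (Finset (Sym2 Pt)) :=
  (planeGraphs S).filter fun G => (abstractGraph S G).Connected

/-- The underlying abstract graph of `G` is bi-connected (2-vertex-connected):
it is connected and remains connected after deletion of any single vertex. -/
def Biconnected (S : Finset Pt) (G : Finset (Sym2 Pt)) : Prop :=
  (abstractGraph S G).Connected ∧
    ∀ v ∈ S, (SimpleGraph.induce ((S : Set Pt) \ {v})
      (SimpleGraph.fromEdgeSet (G : Set (Sym2 Pt)))).Connected

/-- The bi-connected plane graphs on `S`. -/
def biconnPlaneGraphs (S : Finset Pt) : Finset (Finset (Sym2 Pt)) :=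
  (planeGraphs S).filter (Biconnected S)

/-- `G` is a `k`-quasi-plane graph on `S`: a straight-edge graph on `S`
(crossings allowed) with no `k` pairwise crossing edges. -/
def IsQuasiPlane (k : ℕ) (S : Finset Pt) (G : Finset (Sym2 Pt)) : Prop :=
  (∀ e ∈ G, ¬ e.IsDiag ∧ ∀ p ∈ e, p ∈ S) ∧
    ¬ ∃ T ⊆ G, T.card = k ∧ ∀ e ∈ T, ∀ f ∈ T, e ≠ f → EdgesCross e f

/-- The (finite) collection of all `k`-quasi-plane graphs on `S`. -/
def qpGraphs (k : ℕ) (S : Finset Pt) : Finset (Finset (Sym2 Pt)) :=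
  S.sym2.powerset.filter (IsQuasiPlane k S)

/-- The ving `(p, G)` is an x-ving of the `k`-quasi-plane graph `G`: no straight
edge from `p` to another point of `S` can be added to `G` without violating
`k`-quasi-planarity. -/
def IsXVingQP (k : ℕ) (S : Finset Pt) (G : Finset (Sym2 Pt)) (p : Pt) : Prop :=
  ∀ q ∈ S, q ≠ p → s(p, q) ∉ G → ¬ IsQuasiPlane k S (insert s(p, q) G)

/-- `v_x(G)` for a `k`-quasi-plane graph `G`. -/
def vxQP (k : ℕ) (S : Finset Pt) (G : Finset (Sym2 Pt)) : ℕ :=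
  (S.filter (IsXVingQP k S G)).card

/-- `ĥv_x^k(S)`: the average of `v_x(G)` over a uniformly random `k`-quasi-plane
graph on `S`. -/
def hvxQP (k : ℕ) (S : Finset Pt) : ℝ :=
  (∑ G ∈ qpGraphs k S, (vxQP k S G : ℝ)) / (qpGraphs k S).card

/-- `qp_k(N)`: the maximum number of `k`-quasi-plane graphs over all sets of `N`
points in general position. -/
def qpMax (k N : ℕ) : ℕ :=
  sSup {n : ℕ | ∃ S : Finset Pt, S.card = N ∧ GenPos S ∧ (qpGraphs k S).card = n}

/-- Knuth's properties for a counterclockwise orientation predicate. -/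
class CC (V : Type*) where
  L : V → V → V → Prop
  rot : ∀ {a b c}, L a b c → L b c a
  asymm : ∀ {a b c}, L a b c → ¬ L b a c
  total : ∀ {a b c}, a ≠ b → b ≠ c → a ≠ c → L a b c ∨ L b a c
  inter : ∀ {p q r t}, L t q r → L p t r → L p q t → L p q r
  trans : ∀ {t s p q r}, L t s p → L t s q → L t s r → L t p q → L t q r → L t p r
  trans' : ∀ {t s p q r}, L s t p → L s t q → L s t r → L t p q → L t q r → L t p r

namespace CC

variable {V : Type*} [CC V]

@[simp] theorem L_self_left (a b : V) : ¬ L a a b := fun h => asymm h h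
@[simp] theorem L_self_right (a b : V) : ¬ L a b b := fun h => L_self_left b a (rot h)
@[simp] theorem L_self_mid (a b : V) : ¬ L a b a := fun h => L_self_right b a (rot h)

/-- `c` and `d` lie strictly on opposite sides of the line `ab`. -/
def Opp (a b c d : V) : Prop := (L a b c ∧ L b a d) ∨ (L b a c ∧ L a b d)

/-- The segments `ab` and `cd` cross. -/
def Cr (a b c d : V) : Prop := Opp a b c d ∧ Opp c d a b

/-- `x` lies inside the counterclockwise triangle `abc`. -/
def In (x a b c : V) : Prop := L a b x ∧ L b c x ∧ L c a x

theorem tri {a b c : V} (hab : a ≠ b) (hbc : b ≠ c) (hac : a ≠ c) :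
    (L b c a ↔ L a b c) ∧ (L c a b ↔ L a b c) ∧ (L b a c ↔ ¬ L a b c) ∧
      (L a c b ↔ ¬ L a b c) ∧ (L c b a ↔ ¬ L a b c) := by
  have := total hab hbc hac
  have h1 := @rot V _
  have h2 := @asymm V _
  grind

theorem L_ne {a b c : V} (h : L a b c) : a ≠ b ∧ b ≠ c ∧ a ≠ c := by
  refine ⟨?_, ?_, ?_⟩ <;> rintro rfl <;> simp at h

theorem Cr.ne {a b c d : V} (h : Cr a b c d) :
    a ≠ b ∧ c ≠ d ∧ a ≠ c ∧ a ≠ d ∧ b ≠ c ∧ b ≠ d := by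
  refine ⟨?_, ?_, ?_, ?_, ?_, ?_⟩ <;> rintro rfl <;> simp [Cr, Opp] at h

theorem In.ne {x a b c : V} (h : In x a b c) :
    x ≠ a ∧ x ≠ b ∧ x ≠ c ∧ a ≠ b ∧ b ≠ c ∧ a ≠ c := by
  obtain ⟨h1, h2, h3⟩ := h
  exact ⟨(L_ne h1).2.2.symm, (L_ne h1).2.1.symm, (L_ne h2).2.1.symm, (L_ne h1).1, (L_ne h2).1,
    (L_ne h3).1.symm⟩

theorem Cr.symm {a b c d : V} (h : Cr a b c d) : Cr c d a b := ⟨h.2, h.1⟩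
theorem Cr.swap_right {a b c d : V} (h : Cr a b c d) : Cr a b d c := by
  simp only [Cr, Opp] at *; tauto
theorem Cr.swap_left {a b c d : V} (h : Cr a b c d) : Cr b a c d := h.symm.swap_right.symm

/-- Reversing all orientations. -/
abbrev mirror (V : Type*) [CC V] : CC V where
  L a b c := L b a c
  rot h := rot (rot h)
  asymm h := asymm h
  total hab hbc hac := (total hab hbc hac).symm
  inter h1 h2 h3 := inter h2 h1 h3
  trans h1 h2 h3 h4 h5 := rot (rot (trans' h3 h2 h1 (rot h5) (rot h4)))
  trans' h1 h2 h3 h4 h5 := rot (rot (trans h3 h2 h1 (rot h5) (rot h4)))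

theorem mirror_L {a b c : V} : @L V (mirror V) a b c ↔ L b a c := Iff.rfl
theorem mirror_Opp {a b c d : V} : @Opp V (mirror V) a b c d ↔ Opp a b c d := by
  simp only [Opp]; tauto
theorem mirror_Cr {a b c d : V} : @Cr V (mirror V) a b c d ↔ Cr a b c d := by
  simp only [Cr, mirror_Opp]
theorem mirror_In {x a b c : V} : @In V (mirror V) x a b c ↔ In x b a c := by
  simp only [In]; tauto

theorem cross_of_cross_last {a u w v y z : V} (h1 : L a u w) (h2 : Cr a u v w) (h3 : Cr a w y z)
    (h4 : L a w z) (h5 : ¬ Cr v w y z) (h6 : ¬ (In y a u w ∧ L v w y)) :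
    Cr a u y z := by
  obtain rfl | n_u_y := eq_or_ne u y
  · obtain rfl | n_v_z := eq_or_ne v z
    · obtain ⟨n_a_u, n_u_w, n_a_w⟩ := L_ne h1
      obtain ⟨_, n_v_w, n_a_v, _, n_u_v, _⟩ := h2.ne
      simp only [Cr, Opp, In] at *
      have := tri n_a_u n_u_w n_a_w; have := tri n_a_u n_u_v n_a_v
      have := tri n_a_w n_v_w.symm n_a_v; have := tri n_u_w n_v_w.symm n_u_v
      have := @inter V _ u w v a
      grind (splits := 40) only
    · obtain ⟨n_a_u, n_u_w, n_a_w⟩ := L_ne h1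
      obtain ⟨_, n_v_w, n_a_v, _, n_u_v, _⟩ := h2.ne
      obtain ⟨_, n_u_z, _, n_a_z, _, n_w_z⟩ := h3.ne
      simp only [Cr, Opp, In] at *
      have := tri n_a_u n_u_w n_a_w; have := tri n_a_u n_u_v n_a_v
      have := tri n_a_u n_u_z n_a_z; have := tri n_a_w n_v_w.symm n_a_v
      have := tri n_a_w n_w_z n_a_z; have := tri n_u_w n_v_w.symm n_u_v
      have := tri n_u_w n_w_z n_u_z; have := tri n_u_v n_v_z n_u_z
      have := tri n_v_w.symm n_v_z n_w_z; have := @trans V _ u w z a v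
      have := @trans' V _ w u z a v; have := @inter V _ u w z a; have := @inter V _ u w v a
      by_cases q6 : L a u z
      · by_cases q8 : L a w v
        · grind (splits := 40) only
        · grind (splits := 40) only
      · grind (splits := 40) only
  · obtain rfl | n_v_y := eq_or_ne v y
    · obtain ⟨n_a_u, n_u_w, n_a_w⟩ := L_ne h1
      obtain ⟨_, n_v_w, n_a_v, _⟩ := h2.ne
      obtain ⟨_, n_v_z, _, n_a_z, _, n_w_z⟩ := h3.ne
      have n_u_z : u ≠ z := by
        rintro rfl
        grind [Cr, Opp, In, asymm, rot, L_self_left, L_self_right]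
      simp only [Cr, Opp, In] at *
      have := tri n_a_u n_u_w n_a_w; have := tri n_a_u n_u_y n_a_v
      have := tri n_a_u n_u_z n_a_z; have := tri n_a_w n_v_w.symm n_a_v
      have := tri n_a_w n_w_z n_a_z; have := tri n_a_v n_v_z n_a_z
      have := tri n_u_w n_v_w.symm n_u_y; have := tri n_u_w n_w_z n_u_z
      have := tri n_u_y n_v_z n_u_z; have := tri n_v_w.symm n_v_z n_w_z
      have := @trans V _ u w a v z; have := @trans V _ a v z u w; have := @inter V _ a w v z
      have := @inter V _ u w z v
      by_cases q6 : L a v z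
      · grind (splits := 40) only
      · grind (splits := 40) only
    · obtain rfl | n_v_z := eq_or_ne v z
      · obtain ⟨n_a_u, n_u_w, n_a_w⟩ := L_ne h1
        obtain ⟨_, n_v_w, n_a_v, _, n_u_v, _⟩ := h2.ne
        obtain ⟨_, _, n_a_y, _, n_w_y, _⟩ := h3.ne
        simp only [Cr, Opp, In] at *
        have := tri n_a_u n_u_w n_a_w; have := tri n_a_u n_u_v n_a_v
        have := tri n_a_u n_u_y n_a_y; have := tri n_a_w n_v_w.symm n_a_v
        have := tri n_a_w n_w_y n_a_y; have := tri n_a_v n_v_y n_a_y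
        have := tri n_u_w n_v_w.symm n_u_v; have := tri n_u_w n_w_y n_u_y
        have := tri n_u_v n_v_y n_u_y; have := tri n_v_w.symm n_v_y n_w_y
        have := @inter V _ a w u v
        grind (splits := 40) only
      · obtain ⟨n_a_u, n_u_w, n_a_w⟩ := L_ne h1
        obtain ⟨_, n_v_w, n_a_v, _, n_u_v, _⟩ := h2.ne
        obtain ⟨_, n_y_z, n_a_y, n_a_z, n_w_y, n_w_z⟩ := h3.ne
        have n_u_z : u ≠ z := by
          rintro rfl
          grind [Cr, Opp, In, asymm, rot, L_self_left, L_self_right]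
        simp only [Cr, Opp, In] at *
        have := tri n_a_u n_u_w n_a_w; have := tri n_a_u n_u_v n_a_v
        have := tri n_a_u n_u_y n_a_y; have := tri n_a_u n_u_z n_a_z
        have := tri n_a_w n_v_w.symm n_a_v; have := tri n_a_w n_w_y n_a_y
        have := tri n_a_w n_w_z n_a_z; have := tri n_a_v n_v_y n_a_y
        have := tri n_a_v n_v_z n_a_z; have := tri n_a_y n_y_z n_a_z
        have := tri n_u_w n_v_w.symm n_u_v; have := tri n_u_w n_w_y n_u_y
        have := tri n_u_w n_w_z n_u_z; have := tri n_u_v n_v_y n_u_y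
        have := tri n_u_v n_v_z n_u_z; have := tri n_u_y n_y_z n_u_z
        have := tri n_v_w.symm n_v_y n_w_y; have := tri n_v_w.symm n_v_z n_w_z
        have := tri n_w_y n_y_z n_w_z; have := tri n_v_y n_y_z n_v_z
        have := @trans V _ u w v y a; have := @trans V _ u w z a v; have := @trans V _ v u y w z
        have := @trans' V _ u a z y w; have := @trans' V _ a w u y v
        have := @trans V _ a v u y z; have := @trans V _ w a v u y
        have := @trans' V _ y a w z u; have := @trans' V _ w y a v z
        have := @trans V _ u z w v y; have := @trans V _ a y z u w; have := @inter V _ u z y v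
        have := @inter V _ a v w u; have := @inter V _ a y z w; have := @inter V _ a y v z
        have := @inter V _ u w z v
        by_cases q8 : L a y z
        · by_cases q10 : L a w v
          · grind (splits := 40) only
          · by_cases q12 : L w v y
            · by_cases q14 : L u v z
              · grind (splits := 40) only
              · by_cases q16 : L a u y
                · grind (splits := 40) only
                · grind (splits := 40) only
            · grind (splits := 40) only
        · grind (splits := 40) only

theorem cross_of_cross_first {a u w v x y z : V} (h1 : L a u w) (h2 : Cr a u v w)
    (h3 : In x a u w) (h4 : L v w x) (h5 : Cr a x y z) (h6 : L a x z) (h7 : ¬ Cr v w y z)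
    (h8 : ¬ (In y a u w ∧ L v w y ∧ L a y x)) :
    Cr a u y z := by
  obtain rfl | n_u_y := eq_or_ne u y
  · obtain rfl | n_v_z := eq_or_ne v z
    · obtain ⟨n_a_u, n_u_w, n_a_w⟩ := L_ne h1
      obtain ⟨_, n_v_w, n_a_v, _, n_u_v, _⟩ := h2.ne
      obtain ⟨n_x_a, n_x_u, n_x_w, _⟩ := h3.ne
      obtain ⟨_, _, n_v_x⟩ := L_ne h4
      simp only [Cr, Opp, In] at *
      have := tri n_a_u n_u_w n_a_w; have := tri n_a_u n_u_v n_a_v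
      have := tri n_a_u n_x_u.symm n_x_a.symm; have := tri n_a_w n_v_w.symm n_a_v
      have := tri n_a_w n_x_w.symm n_x_a.symm; have := tri n_a_v n_v_x n_x_a.symm
      have := tri n_u_w n_v_w.symm n_u_v; have := tri n_u_w n_x_w.symm n_x_u.symm
      have := tri n_u_v n_v_x n_x_u.symm; have := tri n_v_w.symm n_v_x n_x_w.symm
      have := @inter V _ a u v x
      grind (splits := 40) only
    · obtain ⟨n_a_u, n_u_w, n_a_w⟩ := L_ne h1
      obtain ⟨_, n_v_w, n_a_v, _, n_u_v, _⟩ := h2.ne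
      obtain ⟨n_x_a, n_x_u, n_x_w, _⟩ := h3.ne
      obtain ⟨_, _, n_v_x⟩ := L_ne h4
      obtain ⟨_, n_u_z, _, n_a_z, _, n_x_z⟩ := h5.ne
      have n_w_z : w ≠ z := by
        rintro rfl
        grind [Cr, Opp, In, asymm, rot, L_self_left, L_self_right]
      simp only [Cr, Opp, In] at *
      have := tri n_a_u n_u_w n_a_w; have := tri n_a_u n_u_v n_a_v
      have := tri n_a_u n_x_u.symm n_x_a.symm; have := tri n_a_u n_u_z n_a_z
      have := tri n_a_w n_v_w.symm n_a_v; have := tri n_a_w n_x_w.symm n_x_a.symm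
      have := tri n_a_w n_w_z n_a_z; have := tri n_a_v n_v_z n_a_z
      have := tri n_x_a.symm n_x_z n_a_z; have := tri n_u_w n_v_w.symm n_u_v
      have := tri n_u_w n_x_w.symm n_x_u.symm; have := tri n_u_w n_w_z n_u_z
      have := tri n_u_v n_v_z n_u_z; have := tri n_x_u.symm n_x_z n_u_z
      have := tri n_v_w.symm n_v_x n_x_w.symm; have := tri n_v_w.symm n_v_z n_w_z
      have := tri n_x_w.symm n_x_z n_w_z; have := tri n_v_x n_x_z n_v_z
      have := @trans V _ u w v z a; have := @trans V _ x z u w a; have := @trans V _ z a u x v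
      have := @trans' V _ a w z v u; have := @inter V _ w x z v; have := @inter V _ w x z u
      have := @inter V _ a v z w; have := @inter V _ a u v w; have := @inter V _ a u z x
      by_cases q6 : L a u z
      · by_cases q8 : L a w v
        · grind (splits := 40) only
        · grind (splits := 40) only
      · grind (splits := 40) only
  · obtain rfl | n_v_y := eq_or_ne v y
    · obtain rfl | n_w_z := eq_or_ne w z
      · obtain ⟨n_a_u, n_u_w, n_a_w⟩ := L_ne h1
        obtain ⟨_, n_v_w, n_a_v, _⟩ := h2.ne
        obtain ⟨n_x_a, n_x_u, n_x_w, _⟩ := h3.ne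
        obtain ⟨_, _, n_v_x⟩ := L_ne h4
        simp only [Cr, Opp, In] at *
        have := tri n_a_u n_u_w n_a_w; have := tri n_a_u n_u_y n_a_v
        have := tri n_a_u n_x_u.symm n_x_a.symm; have := tri n_a_w n_v_w.symm n_a_v
        have := tri n_a_w n_x_w.symm n_x_a.symm; have := tri n_a_v n_v_x n_x_a.symm
        have := tri n_u_w n_v_w.symm n_u_y; have := tri n_u_w n_x_w.symm n_x_u.symm
        have := tri n_v_w.symm n_v_x n_x_w.symm
        grind (splits := 40) only
      · obtain ⟨n_a_u, n_u_w, n_a_w⟩ := L_ne h1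
        obtain ⟨_, n_v_w, n_a_v, _⟩ := h2.ne
        obtain ⟨n_x_a, n_x_u, n_x_w, _⟩ := h3.ne
        obtain ⟨_, _, n_v_x⟩ := L_ne h4
        obtain ⟨_, n_v_z, _, n_a_z, _, n_x_z⟩ := h5.ne
        have n_u_z : u ≠ z := by
          rintro rfl
          grind [Cr, Opp, In, asymm, rot, L_self_left, L_self_right]
        simp only [Cr, Opp, In] at *
        have := tri n_a_u n_u_w n_a_w; have := tri n_a_u n_u_y n_a_v
        have := tri n_a_u n_x_u.symm n_x_a.symm; have := tri n_a_u n_u_z n_a_z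
        have := tri n_a_w n_v_w.symm n_a_v; have := tri n_a_w n_x_w.symm n_x_a.symm
        have := tri n_a_v n_v_x n_x_a.symm; have := tri n_a_v n_v_z n_a_z
        have := tri n_x_a.symm n_x_z n_a_z; have := tri n_u_w n_v_w.symm n_u_y
        have := tri n_u_w n_x_w.symm n_x_u.symm; have := tri n_u_y n_v_x n_x_u.symm
        have := tri n_u_y n_v_z n_u_z; have := tri n_x_u.symm n_x_z n_u_z
        have := tri n_v_w.symm n_v_x n_x_w.symm; have := tri n_v_w.symm n_v_z n_w_z
        have := tri n_v_x n_x_z n_v_z; have := @trans' V _ v a x z u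
        have := @trans' V _ z x a v u; have := @trans V _ u w a v x; have := @inter V _ a u z x
        have := @inter V _ u w v a; have := @inter V _ a x v z
        by_cases q8 : L a w v
        · grind (splits := 40) only
        · by_cases q10 : L a v z
          · grind (splits := 40) only
          · grind (splits := 40) only
    · obtain rfl | n_v_z := eq_or_ne v z
      · obtain ⟨n_a_u, n_u_w, n_a_w⟩ := L_ne h1
        obtain ⟨_, n_v_w, n_a_v, _, n_u_v, _⟩ := h2.ne
        obtain ⟨n_x_a, n_x_u, n_x_w, _⟩ := h3.ne
        obtain ⟨_, _, n_v_x⟩ := L_ne h4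
        obtain ⟨_, _, n_a_y, _, n_x_y, _⟩ := h5.ne
        have n_w_y : w ≠ y := by
          rintro rfl
          grind [Cr, Opp, In, asymm, rot, L_self_left, L_self_right]
        simp only [Cr, Opp, In] at *
        have := tri n_a_u n_u_w n_a_w; have := tri n_a_u n_u_v n_a_v
        have := tri n_a_u n_x_u.symm n_x_a.symm; have := tri n_a_u n_u_y n_a_y
        have := tri n_a_w n_v_w.symm n_a_v; have := tri n_a_w n_x_w.symm n_x_a.symm
        have := tri n_a_w n_w_y n_a_y; have := tri n_a_v n_v_x n_x_a.symm
        have := tri n_a_v n_v_y n_a_y; have := tri n_x_a.symm n_x_y n_a_y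
        have := tri n_u_w n_v_w.symm n_u_v; have := tri n_u_w n_x_w.symm n_x_u.symm
        have := tri n_u_w n_w_y n_u_y; have := tri n_u_v n_v_x n_x_u.symm
        have := tri n_u_v n_v_y n_u_y; have := tri n_v_w.symm n_v_x n_x_w.symm
        have := tri n_v_w.symm n_v_y n_w_y; have := tri n_v_x n_x_y n_v_y
        have := @trans V _ x v u w a; have := @inter V _ a v x u
        grind (splits := 40) only
      · obtain rfl | n_w_z := eq_or_ne w z
        · obtain ⟨n_a_u, n_u_w, n_a_w⟩ := L_ne h1
          obtain ⟨_, _, n_a_v, _, n_u_v, _⟩ := h2.ne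
          obtain ⟨n_x_a, n_x_u, n_x_w, _⟩ := h3.ne
          obtain ⟨_, _, n_v_x⟩ := L_ne h4
          obtain ⟨_, n_y_w, n_a_y, _, n_x_y, _⟩ := h5.ne
          simp only [Cr, Opp, In] at *
          have := tri n_a_u n_u_w n_a_w; have := tri n_a_u n_u_v n_a_v
          have := tri n_a_u n_x_u.symm n_x_a.symm; have := tri n_a_u n_u_y n_a_y
          have := tri n_a_w n_v_z.symm n_a_v; have := tri n_a_w n_x_w.symm n_x_a.symm
          have := tri n_a_w n_y_w.symm n_a_y; have := tri n_x_a.symm n_x_y n_a_y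
          have := tri n_u_w n_v_z.symm n_u_v; have := tri n_u_w n_x_w.symm n_x_u.symm
          have := tri n_u_w n_y_w.symm n_u_y; have := tri n_v_z.symm n_v_x n_x_w.symm
          have := tri n_v_z.symm n_v_y n_y_w.symm; have := tri n_x_w.symm n_x_y n_y_w.symm
          have := @trans' V _ w u v y x; have := @trans V _ w a u y x
          have := @inter V _ a w x y; have := @inter V _ u w v a
          by_cases q10 : L a w y
          · grind (splits := 40) only
          · grind (splits := 40) only
        · obtain ⟨n_a_u, n_u_w, n_a_w⟩ := L_ne h1
          obtain ⟨_, n_v_w, n_a_v, _, n_u_v, _⟩ := h2.ne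
          obtain ⟨n_x_a, n_x_u, n_x_w, _⟩ := h3.ne
          obtain ⟨_, _, n_v_x⟩ := L_ne h4
          obtain ⟨_, n_y_z, n_a_y, n_a_z, n_x_y, n_x_z⟩ := h5.ne
          have n_u_z : u ≠ z := by
            rintro rfl
            grind [Cr, Opp, In, asymm, rot, L_self_left, L_self_right]
          have n_w_y : w ≠ y := by
            rintro rfl
            grind [Cr, Opp, In, asymm, rot, L_self_left, L_self_right]
          simp only [Cr, Opp, In] at *
          have := tri n_a_u n_u_w n_a_w; have := tri n_a_u n_u_v n_a_v
          have := tri n_a_u n_x_u.symm n_x_a.symm; have := tri n_a_u n_u_y n_a_y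
          have := tri n_a_u n_u_z n_a_z; have := tri n_a_w n_v_w.symm n_a_v
          have := tri n_a_w n_x_w.symm n_x_a.symm; have := tri n_a_w n_w_y n_a_y
          have := tri n_a_v n_v_x n_x_a.symm; have := tri n_a_v n_v_y n_a_y
          have := tri n_a_v n_v_z n_a_z; have := tri n_x_a.symm n_x_y n_a_y
          have := tri n_x_a.symm n_x_z n_a_z; have := tri n_a_y n_y_z n_a_z
          have := tri n_u_w n_v_w.symm n_u_v; have := tri n_u_w n_x_w.symm n_x_u.symm
          have := tri n_u_w n_w_y n_u_y; have := tri n_u_v n_v_x n_x_u.symm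
          have := tri n_u_v n_v_z n_u_z; have := tri n_x_u.symm n_x_y n_u_y
          have := tri n_x_u.symm n_x_z n_u_z; have := tri n_u_y n_y_z n_u_z
          have := tri n_v_w.symm n_v_x n_x_w.symm; have := tri n_v_w.symm n_v_y n_w_y
          have := tri n_v_w.symm n_v_z n_w_z; have := tri n_x_w.symm n_x_y n_w_y
          have := tri n_x_w.symm n_x_z n_w_z; have := tri n_w_y n_y_z n_w_z
          have := tri n_v_x n_x_y n_v_y; have := tri n_v_x n_x_z n_v_z
          have := tri n_v_y n_y_z n_v_z; have := tri n_x_y n_y_z n_x_z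
          have := @trans' V _ a w x v u; have := @trans V _ x u w z y
          have := @trans' V _ v a u x z; have := @trans' V _ a u y z v
          have := @trans V _ u w a v x; have := @trans V _ w a v u y
          have := @trans V _ y w a v x; have := @trans V _ w a v y x
          have := @trans V _ x v w z y; have := @trans' V _ y a z u x
          have := @trans V _ z a u y v; have := @trans V _ u w a y x
          have := @trans' V _ x u a v z; have := @trans' V _ z x v u a
          have := @trans V _ y x a v z; have := @trans V _ a y x z v
          have := @trans' V _ a z v u y; have := @trans V _ a u x w y
          have := @trans V _ x z y w a; have := @inter V _ w x z y; have := @inter V _ w x z v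
          have := @inter V _ x z y a; have := @inter V _ a w u y; have := @inter V _ a u v w
          have := @inter V _ a x u z
          by_cases q10 : L a w v
          · grind (splits := 40) only
          · by_cases q12 : L a y z
            · by_cases q14 : L a w y
              · by_cases q16 : L a v y
                · grind (splits := 40) only
                · grind (splits := 40) only
              · by_cases q16 : L w v y
                · by_cases q18 : L v x z
                  · by_cases q20 : L a v y
                    · grind (splits := 40) only
                    · by_cases q22 : L a u z
                      · grind (splits := 40) only
                      · grind (splits := 40) only
                  · grind (splits := 40) only
                · by_cases q18 : L a v y
                  · grind (splits := 40) only
                  · grind (splits := 40) only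
            · grind (splits := 40) only

theorem not_cross_first {a u w v x : V} (h1 : L a u w) (h2 : Cr a u v w) (h3 : In x a u w)
    (h4 : L v w x) :
    ¬ Cr a x v w := by
  obtain ⟨n_a_u, n_u_w, n_a_w⟩ := L_ne h1
  obtain ⟨_, n_v_w, n_a_v, _, n_u_v, _⟩ := h2.ne
  obtain ⟨n_x_a, n_x_u, n_x_w, _⟩ := h3.ne
  obtain ⟨_, _, n_v_x⟩ := L_ne h4
  simp only [Cr, Opp, In] at *
  have := tri n_a_u n_u_w n_a_w; have := tri n_a_u n_u_v n_a_v
  have := tri n_a_u n_x_u.symm n_x_a.symm; have := tri n_a_w n_v_w.symm n_a_v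
  have := tri n_a_w n_x_w.symm n_x_a.symm; have := tri n_a_v n_v_x n_x_a.symm
  have := tri n_u_w n_v_w.symm n_u_v; have := tri n_u_w n_x_w.symm n_x_u.symm
  have := tri n_v_w.symm n_v_x n_x_w.symm; have := @inter V _ a v w x
  grind (splits := 40) only

theorem left_of_cross {a p u v w : V} (h1 : L a p u) (h2 : Cr a u v w) :
    L a p v ∨ L a p w := by
  obtain rfl | n_p_v := eq_or_ne p v
  · obtain ⟨n_a_p, n_p_u, n_a_u⟩ := L_ne h1
    obtain ⟨_, n_p_w, _, n_a_w, _, n_u_w⟩ := h2.ne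
    simp only [Cr, Opp] at *
    have := tri n_a_p n_p_u n_a_u; have := tri n_a_p n_p_w n_a_w; have := tri n_a_u n_u_w n_a_w
    have := tri n_p_u n_u_w n_p_w; have := @inter V _ p u w a
    grind (splits := 40) only
  · obtain rfl | n_p_w := eq_or_ne p w
    · obtain ⟨n_a_p, n_p_u, n_a_u⟩ := L_ne h1
      obtain ⟨_, _, n_a_v, _, n_u_v, _⟩ := h2.ne
      simp only [Cr, Opp] at *
      have := tri n_a_p n_p_u n_a_u; have := tri n_a_p n_p_v n_a_v
      have := tri n_a_u n_u_v n_a_v; have := tri n_p_u n_u_v n_p_v; have := @inter V _ p u v a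
      grind (splits := 40) only
    · obtain ⟨n_a_p, n_p_u, n_a_u⟩ := L_ne h1
      obtain ⟨_, n_v_w, n_a_v, n_a_w, n_u_v, n_u_w⟩ := h2.ne
      simp only [Cr, Opp] at *
      have := tri n_a_p n_p_u n_a_u; have := tri n_a_p n_p_v n_a_v
      have := tri n_a_p n_p_w n_a_w; have := tri n_a_u n_u_v n_a_v
      have := tri n_a_u n_u_w n_a_w; have := tri n_a_v n_v_w n_a_w
      have := tri n_p_u n_u_v n_p_v; have := tri n_p_u n_u_w n_p_w
      have := tri n_p_v n_v_w n_p_w; have := tri n_u_v n_v_w n_u_w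
      have := @trans' V _ v u p a w; have := @trans' V _ p v a w u; have := @trans V _ a v u w p
      have := @trans' V _ w a p u v; have := @inter V _ a u p v; have := @inter V _ a v w u
      have := @inter V _ a v u w
      by_cases q6 : L a u v
      · by_cases q8 : L a v w
        · grind (splits := 40) only
        · grind (splits := 40) only
      · grind (splits := 40) only

theorem left_of_In {a p u w x : V} (h1 : L a p u) (h2 : L a p w) (h3 : In x a u w) :
    L a p x := by
  obtain ⟨n_a_p, n_p_u, n_a_u⟩ := L_ne h1
  obtain ⟨_, n_p_w, n_a_w⟩ := L_ne h2
  obtain ⟨n_x_a, n_x_u, n_x_w, _, n_u_w, _⟩ := h3.ne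
  have n_p_x : p ≠ x := by rintro rfl; grind [Cr, Opp, In, asymm, rot, L_self_left, L_self_right]
  simp only [In] at *
  have := tri n_a_p n_p_u n_a_u; have := tri n_a_p n_p_w n_a_w
  have := tri n_a_p n_p_x n_x_a.symm; have := tri n_a_u n_u_w n_a_w
  have := tri n_a_u n_x_u.symm n_x_a.symm; have := tri n_a_w n_x_w.symm n_x_a.symm
  have := tri n_u_w n_x_w.symm n_x_u.symm; have := @trans' V _ a w u x p
  have := @inter V _ a w x u
  grind (splits := 40) only

/-- The edges `e` and `f` cross. -/
def X (e f : Sym2 V) : Prop := ∃ a b c d, e = s(a, b) ∧ f = s(c, d) ∧ Cr a b c d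

theorem X_mk {a b c d : V} : X s(a, b) s(c, d) ↔ Cr a b c d := by
  refine ⟨?_, fun h => ⟨a, b, c, d, rfl, rfl, h⟩⟩
  rintro ⟨a', b', c', d', h1, h2, h⟩
  rcases Sym2.eq_iff.1 h1 with ⟨rfl, rfl⟩ | ⟨rfl, rfl⟩ <;>
    rcases Sym2.eq_iff.1 h2 with ⟨rfl, rfl⟩ | ⟨rfl, rfl⟩
  exacts [h, h.swap_right, h.swap_left, h.swap_left.swap_right]

/-- `G` is a crossing-free graph on the vertex set `s`. -/
structure Plane (s : Finset V) (G : Finset (Sym2 V)) : Prop where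
  mem : ∀ {a b}, s(a, b) ∈ G → a ∈ s
  ne : ∀ {a b}, s(a, b) ∈ G → a ≠ b
  noX : ∀ {a b c d}, s(a, b) ∈ G → s(c, d) ∈ G → ¬ Cr a b c d

theorem Plane.mem' {s : Finset V} {G : Finset (Sym2 V)} (h : Plane s G) {a b : V}
    (hab : s(a, b) ∈ G) : b ∈ s := h.mem (Sym2.eq_swap ▸ hab)

/-- The segment `ab` crosses no edge of `G`. -/
def Vis (G : Finset (Sym2 V)) (a b : V) : Prop := ∀ y z, s(y, z) ∈ G → ¬ Cr a b y z

/-- `G` is a maximal crossing-free graph on `s`. -/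
structure Tri (s : Finset V) (G : Finset (Sym2 V)) : Prop extends Plane s G where
  max : ∀ {a b}, a ∈ s → b ∈ s → a ≠ b → Vis G a b → s(a, b) ∈ G

theorem Tri.vis {s : Finset V} {G : Finset (Sym2 V)} (h : Tri s G) {a b : V}
    (hab : s(a, b) ∈ G) : Vis G a b := fun _ _ hyz => h.noX hab hyz

theorem mirror_Plane {s : Finset V} {G : Finset (Sym2 V)} :
    @Plane V (mirror V) s G ↔ Plane s G := by
  refine ⟨fun h => ?_, fun h => ?_⟩
  · exact ⟨@Plane.mem V (mirror V) _ _ h, @Plane.ne V (mirror V) _ _ h,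
      fun h1 h2 h3 => @Plane.noX V (mirror V) _ _ h _ _ _ _ h1 h2 (mirror_Cr.2 h3)⟩
  exact @Plane.mk V (mirror V) s G h.1 h.2 fun h1 h2 h3 => h.3 h1 h2 (mirror_Cr.1 h3)

theorem mirror_Vis {G : Finset (Sym2 V)} {a b : V} : @Vis V (mirror V) G a b ↔ Vis G a b := by
  simp only [Vis, mirror_Cr]

theorem mirror_Tri {s : Finset V} {G : Finset (Sym2 V)} :
    @Tri V (mirror V) s G ↔ Tri s G := by
  refine ⟨fun h => ⟨mirror_Plane.1 (@Tri.toPlane V (mirror V) _ _ h),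
    fun h1 h2 h3 h4 => @Tri.max V (mirror V) _ _ h _ _ h1 h2 h3 (mirror_Vis.2 h4)⟩, fun h => ?_⟩
  exact @Tri.mk V (mirror V) s G (mirror_Plane.2 h.toPlane)
    fun h1 h2 h3 h4 => h.max h1 h2 h3 (mirror_Vis.1 h4)

theorem exists_first {F : Finset V} (hF : F.Nonempty) {x : V} (hx : x ∉ F)
    (ht : ∀ u ∈ F, ∀ v ∈ F, ∀ w ∈ F, L x u v → L x v w → L x u w) :
    ∃ u ∈ F, ∀ v ∈ F, v ≠ u → L x u v := by
  induction hF using Finset.Nonempty.cons_induction with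
  | singleton a => exact ⟨a, by simp, by simp⟩
  | cons a F ha hF ih =>
    simp only [Finset.mem_cons, not_or] at hx
    obtain ⟨u, hu, h⟩ := ih hx.2 fun u hu v hv w hw =>
      ht u (Finset.mem_cons_of_mem hu) v (Finset.mem_cons_of_mem hv) w (Finset.mem_cons_of_mem hw)
    have hau : a ≠ u := fun h => ha (h ▸ hu)
    have hxu : x ≠ u := fun h => hx.2 (h ▸ hu)
    by_cases hl : L x u a
    · refine ⟨u, Finset.mem_cons_of_mem hu, fun v hv hvu => ?_⟩
      rcases Finset.mem_cons.1 hv with rfl | hv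
      exacts [hl, h v hv hvu]
    · have hl : L x a u := by
        have := tri hau (Ne.symm hxu) (Ne.symm hx.1)
        grind
      refine ⟨a, Finset.mem_cons_self _ _, fun v hv hva => ?_⟩
      rcases Finset.mem_cons.1 hv with rfl | hv
      · exact absurd rfl hva
      · by_cases hvu : v = u
        · exact hvu ▸ hl
        · exact ht _ (Finset.mem_cons_self _ _) _ (Finset.mem_cons_of_mem hu) _
            (Finset.mem_cons_of_mem hv) hl (h v hv hvu)

theorem exists_first_left {F : Finset V} (hF : F.Nonempty) {x a : V}
    (h : ∀ u ∈ F, L x a u) : ∃ u ∈ F, ∀ v ∈ F, v ≠ u → L x u v :=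
  exists_first hF (fun hx => L_self_mid x a (h x hx)) fun u hu v hv w hw h1 h2 =>
    trans (h u hu) (h v hv) (h w hw) h1 h2

theorem exists_first_right {F : Finset V} (hF : F.Nonempty) {x a : V}
    (h : ∀ u ∈ F, L a x u) : ∃ u ∈ F, ∀ v ∈ F, v ≠ u → L x u v :=
  exists_first hF (fun hx => L_self_right a x (h x hx)) fun u hu v hv w hw h1 h2 =>
    trans' (h u hu) (h v hv) (h w hw) h1 h2

theorem exists_last_left {F : Finset V} (hF : F.Nonempty) {x a : V}
    (h : ∀ u ∈ F, L x a u) : ∃ u ∈ F, ∀ v ∈ F, v ≠ u → L x v u := by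
  obtain ⟨u, hu, h⟩ := @exists_first_right V (mirror V) F hF x a h
  exact ⟨u, hu, fun v hv hvu => rot (mirror_L.1 (h v hv hvu))⟩

theorem exists_last_right {F : Finset V} (hF : F.Nonempty) {x a : V}
    (h : ∀ u ∈ F, L a x u) : ∃ u ∈ F, ∀ v ∈ F, v ≠ u → L x v u := by
  obtain ⟨u, hu, h⟩ := @exists_first_left V (mirror V) F hF x a h
  exact ⟨u, hu, fun v hv hvu => rot (mirror_L.1 (h v hv hvu))⟩

theorem exists_fewer_cross {s : Finset V} {H : Finset (Sym2 V)} (hH : Plane s H) {a u v w : V}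
    (hc : Cr a u v w) (hvw : s(v, w) ∈ H) (hw : L a u w) :
    ∃ x ∈ s, (x = w ∨ In x a u w) ∧ ¬ Cr a x v w ∧
      ∀ y z, s(y, z) ∈ H → Cr a x y z → Cr a u y z := by
  set F := s.filter fun x => x = w ∨ (In x a u w ∧ L v w x) with hF
  have hwF : w ∈ F := by simp [hF, hH.mem' hvw]
  obtain ⟨x, hx, hfirst⟩ := exists_first_left (x := a) (a := u) ⟨w, hwF⟩ (by
    intro y hy
    simp only [hF, Finset.mem_filter] at hy
    rcases hy.2 with rfl | hy
    exacts [hw, hy.1.1])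
  have key : ∀ y, y ∈ s → In y a u w → L v w y → y = x ∨ L a x y := fun y hy h1 h2 =>
    or_iff_not_imp_left.2 (hfirst y (by simp [hF, hy, h1, h2]))
  simp only [hF, Finset.mem_filter] at hx
  have wlog : (∀ y z, s(y, z) ∈ H → Cr a x y z → L a x z → Cr a u y z) →
      ∀ y z, s(y, z) ∈ H → Cr a x y z → Cr a u y z := by
    intro h y z hyz hcr
    have : L a x y ∨ L a x z := by simp only [Cr, Opp] at hcr; tauto
    rcases this with h1 | h1
    · exact (h z y (Sym2.eq_swap ▸ hyz) hcr.swap_right h1).swap_right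
    · exact h y z hyz hcr h1
  rcases hx.2 with rfl | ⟨h1, h2⟩
  · refine ⟨x, hx.1, Or.inl rfl, by simp [Cr, Opp], wlog fun y z hyz hcr hz => ?_⟩
    refine cross_of_cross_last hw hc hcr hz (hH.noX hvw hyz) fun ⟨h1, h2⟩ => ?_
    rcases key y (hH.mem hyz) h1 h2 with rfl | h
    · simp [Cr, Opp] at hcr
    · simp only [Cr, Opp] at hcr
      have := @asymm V _
      grind
  · refine ⟨x, hx.1, Or.inr h1, not_cross_first hw hc h1 h2, wlog fun y z hyz hcr hz => ?_⟩
    refine cross_of_cross_first hw hc h1 h2 hcr hz (hH.noX hvw hyz) fun ⟨h3, h4, h5⟩ => ?_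
    rcases key y (hH.mem hyz) h3 h4 with rfl | h
    · simp at h5
    · exact (asymm (rot h5) (rot h)).elim

theorem exists_vis {s : Finset V} {H : Finset (Sym2 V)} (hH : Plane s H) {a p r : V}
    (hr : r ∈ s) (h : L a p r) : ∃ u ∈ s, L a p u ∧ Vis H a u := by
  obtain ⟨u, hu, hmin⟩ := (s.filter (L a p)).exists_min_image
    (fun u => (H.filter (X s(a, u))).card) ⟨r, by simp [hr, h]⟩
  simp only [Finset.mem_filter] at hu hmin
  refine ⟨u, hu.1, hu.2, ?_⟩
  have main : ∀ v w, s(v, w) ∈ H → Cr a u v w → L a p w → False := by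
    intro v w hvw hcr hw
    have : ∃ x ∈ s, L a p x ∧ ¬ Cr a x v w ∧ ∀ y z, s(y, z) ∈ H → Cr a x y z → Cr a u y z := by
      have : L a u w ∨ L u a w := by simp only [Cr, Opp] at hcr; tauto
      rcases this with h1 | h1
      · obtain ⟨x, hx, h2, h3⟩ := exists_fewer_cross hH hcr hvw h1
        refine ⟨x, hx, ?_, h3⟩
        rcases h2 with rfl | h2
        exacts [hw, left_of_In hu.2 hw h2]
      · obtain ⟨x, hx, h2, h3⟩ := @exists_fewer_cross V (mirror V) s H (mirror_Plane.2 hH) a u v w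
          (mirror_Cr.2 hcr) hvw h1
        simp only [mirror_Cr, mirror_In] at h2 h3
        refine ⟨x, hx, ?_, h3⟩
        rcases h2 with rfl | h2
        · exact hw
        · exact left_of_In hw hu.2 ⟨h2.2.1, h2.2.2, h2.1⟩
    obtain ⟨x, hx, h1, h2, h3⟩ := this
    refine (hmin x ⟨hx, h1⟩).not_gt (Finset.card_lt_card ?_)
    refine Finset.ssubset_iff_of_subset (fun e he => ?_) |>.2
      ⟨s(v, w), by simp [hvw, X_mk, hcr], by simp [X_mk, h2]⟩
    induction e with | _ y z
    simp only [Finset.mem_filter, X_mk] at he ⊢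
    exact ⟨he.1, h3 y z he.1 he.2⟩
  intro v w hvw hcr
  rcases left_of_cross hu.2 hcr with h1 | h1
  · exact main w v (Sym2.eq_swap ▸ hvw) hcr.swap_right h1
  · exact main v w hvw hcr h1

theorem exists_vis_right {s : Finset V} {H : Finset (Sym2 V)} (hH : Plane s H) {a p r : V}
    (hr : r ∈ s) (h : L p a r) : ∃ u ∈ s, L p a u ∧ Vis H a u := by
  obtain ⟨u, hu, h1, h2⟩ := @exists_vis V (mirror V) s H (mirror_Plane.2 hH) a p r hr h
  exact ⟨u, hu, h1, mirror_Vis.1 h2⟩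

theorem pasch {p q a b c : V} (h1 : Cr p q a b) (h2 : L b a c) (h3 : p ≠ c) (h4 : q ≠ c)
    (h5 : ¬ In p b a c) (h6 : ¬ In q b a c) :
    Cr p q a c ∨ Cr p q b c := by
  obtain ⟨n_p_q, n_a_b, n_p_a, n_p_b, n_q_a, n_q_b⟩ := h1.ne
  obtain ⟨_, n_a_c, n_b_c⟩ := L_ne h2
  have n_p_c : p ≠ c := by rintro rfl; grind [Cr, Opp, In, asymm, rot, L_self_left, L_self_right]
  have n_q_c : q ≠ c := by rintro rfl; grind [Cr, Opp, In, asymm, rot, L_self_left, L_self_right]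
  simp only [Cr, Opp, In] at *
  have := tri n_p_q n_q_a n_p_a; have := tri n_p_q n_q_b n_p_b; have := tri n_p_q n_q_c n_p_c
  have := tri n_p_a n_a_b n_p_b; have := tri n_p_a n_a_c n_p_c; have := tri n_p_b n_b_c n_p_c
  have := tri n_q_a n_a_b n_q_b; have := tri n_q_a n_a_c n_q_c; have := tri n_q_b n_b_c n_q_c
  have := tri n_a_b n_b_c n_a_c; have := @trans' V _ b p q a c; have := @trans V _ c b a p q
  have := @trans V _ a p c b q; have := @trans' V _ c a p b q; have := @trans' V _ c a p q b
  have := @trans V _ a q c b p; have := @trans' V _ q a c b p; have := @trans' V _ b q p a c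
  have := @inter V _ a b p q; have := @inter V _ a p b q
  by_cases q2 : L p q a
  · by_cases q4 : L p a b
    · grind (splits := 40) only
    · by_cases q6 : L p a c
      · grind (splits := 40) only
      · by_cases q8 : L p b c
        · grind (splits := 40) only
        · grind (splits := 40) only
  · by_cases q4 : L p a b
    · by_cases q6 : L q a c
      · grind (splits := 40) only
      · grind (splits := 40) only
    · grind (splits := 40) only

theorem cross_ray_false {x b c u v w : V} (h1 : L x b c) (h2 : In u x b c) (h3 : Cr x u v w)
    (h4 : ¬ Cr x b v w) (h5 : ¬ Cr x c v w) (h6 : ¬ (In v x b c ∧ L b u v))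
    (h7 : ¬ (In w x b c ∧ L b u w)) :
    False := by
  obtain rfl | n_b_v := eq_or_ne b v
  · obtain ⟨n_x_b, n_b_c, n_x_c⟩ := L_ne h1
    obtain ⟨n_u_x, n_u_b, n_u_c, _⟩ := h2.ne
    obtain ⟨_, n_b_w, _, n_x_w, _, n_u_w⟩ := h3.ne
    have n_c_w : c ≠ w := by rintro rfl; grind [Cr, Opp, In, asymm, rot, L_self_left, L_self_right]
    simp only [Cr, Opp, In] at *
    have := tri n_x_b n_b_c n_x_c; have := tri n_x_b n_u_b.symm n_u_x.symm
    have := tri n_x_b n_b_w n_x_w; have := tri n_x_c n_u_c.symm n_u_x.symm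
    have := tri n_x_c n_c_w n_x_w; have := tri n_u_x.symm n_u_w n_x_w
    have := tri n_b_c n_u_c.symm n_u_b.symm; have := tri n_b_c n_c_w n_b_w
    have := tri n_u_b.symm n_u_w n_b_w; have := @trans V _ b c u x w
    have := @trans' V _ x c u w b; have := @trans' V _ b x u w c
    by_cases q4 : L x b w
    · grind (splits := 40) only
    · grind (splits := 40) only
  · obtain rfl | n_b_w := eq_or_ne b w
    · obtain ⟨n_x_b, n_b_c, n_x_c⟩ := L_ne h1
      obtain ⟨n_u_x, n_u_b, n_u_c, _⟩ := h2.ne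
      obtain ⟨_, _, n_x_v, _, n_u_v, _⟩ := h3.ne
      have n_c_v : c ≠ v := by
        rintro rfl
        grind [Cr, Opp, In, asymm, rot, L_self_left, L_self_right]
      simp only [Cr, Opp, In] at *
      have := tri n_x_b n_b_c n_x_c; have := tri n_x_b n_u_b.symm n_u_x.symm
      have := tri n_x_b n_b_v n_x_v; have := tri n_x_c n_u_c.symm n_u_x.symm
      have := tri n_x_c n_c_v n_x_v; have := tri n_u_x.symm n_u_v n_x_v
      have := tri n_b_c n_u_c.symm n_u_b.symm; have := tri n_b_c n_c_v n_b_v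
      have := tri n_u_b.symm n_u_v n_b_v; have := @trans V _ b c u x v
      have := @trans' V _ x c u v b; have := @trans' V _ b x u v c
      by_cases q6 : L x b v
      · grind (splits := 40) only
      · grind (splits := 40) only
    · obtain rfl | n_c_v := eq_or_ne c v
      · obtain ⟨n_x_b, _, n_x_c⟩ := L_ne h1
        obtain ⟨n_u_x, n_u_b, n_u_c, _⟩ := h2.ne
        obtain ⟨_, n_c_w, _, n_x_w, _, n_u_w⟩ := h3.ne
        simp only [Cr, Opp, In] at *
        have := tri n_x_b n_b_v n_x_c; have := tri n_x_b n_u_b.symm n_u_x.symm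
        have := tri n_x_b n_b_w n_x_w; have := tri n_x_c n_u_c.symm n_u_x.symm
        have := tri n_x_c n_c_w n_x_w; have := tri n_u_x.symm n_u_w n_x_w
        have := tri n_b_v n_u_c.symm n_u_b.symm; have := tri n_b_v n_c_w n_b_w
        have := tri n_u_b.symm n_u_w n_b_w; have := tri n_u_c.symm n_u_w n_c_w
        have := @trans' V _ u w x b c; have := @inter V _ c u w b; have := @inter V _ c x w u
        by_cases q8 : L x c w
        · grind (splits := 40) only
        · grind (splits := 40) only
      · obtain rfl | n_c_w := eq_or_ne c w
        · obtain ⟨n_x_b, _, n_x_c⟩ := L_ne h1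
          obtain ⟨n_u_x, n_u_b, n_u_c, _⟩ := h2.ne
          obtain ⟨_, _, n_x_v, _, n_u_v, _⟩ := h3.ne
          simp only [Cr, Opp, In] at *
          have := tri n_x_b n_b_w n_x_c; have := tri n_x_b n_u_b.symm n_u_x.symm
          have := tri n_x_b n_b_v n_x_v; have := tri n_x_c n_u_c.symm n_u_x.symm
          have := tri n_x_c n_c_v n_x_v; have := tri n_u_x.symm n_u_v n_x_v
          have := tri n_b_w n_u_c.symm n_u_b.symm; have := tri n_b_w n_c_v n_b_v
          have := tri n_u_b.symm n_u_v n_b_v; have := tri n_u_c.symm n_u_v n_c_v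
          have := @trans' V _ u v x b c; have := @inter V _ c u v b; have := @inter V _ c x v u
          by_cases q10 : L x c v
          · grind (splits := 40) only
          · grind (splits := 40) only
        · obtain ⟨n_x_b, n_b_c, n_x_c⟩ := L_ne h1
          obtain ⟨n_u_x, n_u_b, n_u_c, _⟩ := h2.ne
          obtain ⟨_, n_v_w, n_x_v, n_x_w, n_u_v, n_u_w⟩ := h3.ne
          simp only [Cr, Opp, In] at *
          have := tri n_x_b n_b_c n_x_c; have := tri n_x_b n_u_b.symm n_u_x.symm
          have := tri n_x_b n_b_v n_x_v; have := tri n_x_b n_b_w n_x_w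
          have := tri n_x_c n_u_c.symm n_u_x.symm; have := tri n_x_c n_c_v n_x_v
          have := tri n_x_c n_c_w n_x_w; have := tri n_u_x.symm n_u_v n_x_v
          have := tri n_u_x.symm n_u_w n_x_w; have := tri n_x_v n_v_w n_x_w
          have := tri n_b_c n_u_c.symm n_u_b.symm; have := tri n_b_c n_c_v n_b_v
          have := tri n_b_c n_c_w n_b_w; have := tri n_u_b.symm n_u_v n_b_v
          have := tri n_u_b.symm n_u_w n_b_w; have := tri n_b_v n_v_w n_b_w
          have := tri n_u_c.symm n_u_v n_c_v; have := tri n_u_c.symm n_u_w n_c_w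
          have := tri n_c_v n_v_w n_c_w; have := tri n_u_v n_v_w n_u_w
          have := @trans V _ w b c x u; have := @trans V _ v u c w x
          have := @trans' V _ w u v b x; have := @trans V _ x b w v c
          have := @trans V _ u b c w v; have := @trans' V _ x v c w u
          have := @trans' V _ v c b w x; have := @trans' V _ x c b u v
          have := @trans' V _ u w v x b; have := @trans' V _ v c u w b
          have := @trans V _ u w b c x; have := @trans' V _ u v b c x
          have := @trans' V _ c u w v x; have := @trans' V _ c b u v x
          have := @trans' V _ b x c u v; have := @trans' V _ b x c u w
          have := @trans V _ u w x v c; have := @inter V _ u w x v; have := @inter V _ b u w v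
          have := @inter V _ c u w b; have := @inter V _ b u v w; have := @inter V _ u v x w
          have := @inter V _ c x v u; have := @inter V _ b w x u; have := @inter V _ c x v b
          have := @inter V _ c u v w; have := @inter V _ b v u c; have := @inter V _ c v u w
          by_cases q10 : L x v w
          · by_cases q12 : L x u v
            · grind (splits := 40) only
            · by_cases q14 : L x c v
              · grind (splits := 40) only
              · by_cases q16 : L x b w
                · by_cases q18 : L c u v
                  · by_cases q20 : L b c w
                    · grind (splits := 40) only
                    · grind (splits := 40) only
                  · grind (splits := 40) only
                · grind (splits := 40) only
          · by_cases q12 : L x u v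
            · by_cases q14 : L x b v
              · by_cases q16 : L b u v
                · grind (splits := 40) only
                · grind (splits := 40) only
              · grind (splits := 40) only
            · grind (splits := 40) only

theorem eq_or_In_of_left {a b c d : V} (h1 : L a b c) (h2 : L a b d) (h3 : ¬ Cr a c b d)
    (h4 : ¬ Cr a d b c) :
    c = d ∨ In d a b c ∨ In c a b d := by
  obtain rfl | n_c_d := eq_or_ne c d
  · obtain ⟨n_a_b, n_b_c, n_a_c⟩ := L_ne h1
    simp only [Cr, Opp, In] at *
    have := tri n_a_b n_b_c n_a_c
    grind (splits := 40) only
  · obtain ⟨n_a_b, n_b_c, n_a_c⟩ := L_ne h1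
    obtain ⟨_, n_b_d, n_a_d⟩ := L_ne h2
    simp only [Cr, Opp, In] at *
    have := tri n_a_b n_b_c n_a_c; have := tri n_a_b n_b_d n_a_d; have := tri n_a_c n_c_d n_a_d
    have := tri n_b_c n_c_d n_b_d
    by_cases q4 : L a c d
    · grind (splits := 40) only
    · grind (splits := 40) only

theorem cone_of_cross {x b c w : V} (h1 : L x b c) (h2 : Cr b c x w) :
    L x b w ∧ L x w c := by
  obtain ⟨n_x_b, n_b_c, n_x_c⟩ := L_ne h1
  obtain ⟨_, n_x_w, _, n_b_w, _, n_c_w⟩ := h2.ne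
  simp only [Cr, Opp] at *
  have := tri n_x_b n_b_c n_x_c; have := tri n_x_b n_b_w n_x_w; have := tri n_x_c n_c_w n_x_w
  have := tri n_b_c n_c_w n_b_w; have := @inter V _ c x w b
  by_cases q2 : L x b w
  · grind (splits := 40) only
  · grind (splits := 40) only

theorem empty_and_vis {s : Finset V} {H : Finset (Sym2 V)} (hH : Plane s H) {x b c : V}
    (hb : Vis H x b) (hc : Vis H x c) (hl : L x b c)
    (hcone : ∀ u ∈ s, L x b u → L x u c → ¬ Vis H x u) :
    (∀ u ∈ s, ¬ In u x b c) ∧ Vis H b c := by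
  have hempty : ∀ u ∈ s, ¬ In u x b c := by
    by_contra! hne
    obtain ⟨u₀, hu₀, h₀⟩ := hne
    obtain ⟨u, hu, hlast⟩ := exists_last_right (F := s.filter fun u => In u x b c) (x := b) (a := x)
      ⟨u₀, by simp [hu₀, h₀]⟩ fun u hu => (Finset.mem_filter.1 hu).2.1
    simp only [Finset.mem_filter] at hu hlast
    have hn : ∀ v ∈ s, ¬ (In v x b c ∧ L b u v) := by
      rintro v hv ⟨h1, h2⟩
      exact asymm (rot h2) (rot (hlast v ⟨hv, h1⟩ (L_ne h2).2.1.symm))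
    refine hcone u hu.1 hu.2.1 (rot hu.2.2.2) fun v w hvw hcr => ?_
    exact cross_ray_false hl hu.2 hcr (hb v w hvw) (hc v w hvw) (hn v (hH.mem hvw))
      (hn w (hH.mem' hvw))
  refine ⟨hempty, fun v w hvw hcr => ?_⟩
  have hx : ∀ w, s(x, w) ∈ H → Cr b c x w → False := by
    intro w hw hcr
    obtain ⟨h1, h2⟩ := cone_of_cross hl hcr
    exact hcone w (hH.mem' hw) h1 h2 fun y z hyz => hH.noX hw hyz
  by_cases hv : v = x
  · exact hx w (hv ▸ hvw) (hv ▸ hcr)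
  by_cases hw : w = x
  · exact hx v (hw ▸ Sym2.eq_swap ▸ hvw) (hw ▸ hcr.swap_right)
  have rotIn : ∀ u, In u b c x → In u x b c := fun u h => ⟨h.2.2, h.1, h.2.1⟩
  rcases pasch hcr.symm.swap_right (rot hl) hv hw (fun h => hempty v (hH.mem hvw) (rotIn _ h))
    (fun h => hempty w (hH.mem' hvw) (rotIn _ h)) with h | h
  · exact hc v w hvw h.symm.swap_left
  · exact hb v w hvw h.symm.swap_left

theorem exists_apex {s : Finset V} {T : Finset (Sym2 V)} (hT : Tri s T) {a b r : V}
    (hab : s(a, b) ∈ T) (hr : r ∈ s) (hl : L a b r) :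
    ∃ c ∈ s, L a b c ∧ s(a, c) ∈ T ∧ s(b, c) ∈ T ∧ ∀ u ∈ s, ¬ In u a b c := by
  obtain ⟨r', hr', hl', hv'⟩ := exists_vis hT.toPlane hr hl
  have ha := hT.mem hab
  obtain ⟨c, hc, hfirst⟩ := exists_first_left (F := s.filter fun c => L a b c ∧ s(a, c) ∈ T)
    (x := a) (a := b)
    ⟨r', by simp [hr', hl', hT.max ha hr' (L_ne hl').2.2 hv']⟩
    fun u hu => (Finset.mem_filter.1 hu).2.1
  simp only [Finset.mem_filter] at hc hfirst
  obtain ⟨h1, h2⟩ := empty_and_vis hT.toPlane (hT.vis hab) (hT.vis hc.2.2) hc.2.1 (by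
    intro u hu h1 h2 h3
    have := hfirst u ⟨hu, h1, hT.max ha hu (L_ne h1).2.2 h3⟩ (L_ne h2).2.1
    exact asymm (rot h2) (rot this))
  exact ⟨c, hc.1, hc.2.1, hc.2.2, hT.max (hT.mem' hab) hc.1 (L_ne hc.2.1).2.1 h2, h1⟩

/-- The edge `ab` of `T` together with an empty triangle on its left side. -/
structure Face (s : Finset V) (T : Finset (Sym2 V)) (a b c : V) : Prop where
  left : L a b c
  ab : s(a, b) ∈ T
  bc : s(b, c) ∈ T
  ca : s(c, a) ∈ T
  empty : ∀ u ∈ s, ¬ In u a b c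

theorem Face.rot {s : Finset V} {T : Finset (Sym2 V)} {a b c : V} (h : Face s T a b c) :
    Face s T b c a :=
  ⟨CC.rot h.left, h.bc, h.ca, h.ab, fun u hu hi => h.empty u hu ⟨hi.2.2, hi.1, hi.2.1⟩⟩

theorem exists_face {s : Finset V} {T : Finset (Sym2 V)} (hT : Tri s T) {a b r : V}
    (hab : s(a, b) ∈ T) (hr : r ∈ s) (hl : L a b r) : ∃ c ∈ s, Face s T a b c := by
  obtain ⟨c, hc, h1, h2, h3, h4⟩ := exists_apex hT hab hr hl
  exact ⟨c, hc, h1, hab, h3, Sym2.eq_swap ▸ h2, h4⟩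

theorem Face.unique {s : Finset V} {T : Finset (Sym2 V)} (hT : Plane s T) {a b c d : V}
    (h : Face s T a b c) (h' : Face s T a b d) : c = d := by
  rcases eq_or_In_of_left h.left h'.left (fun hc => hT.noX h.ca h'.bc hc.swap_left)
    (fun hc => hT.noX h'.ca h.bc hc.swap_left) with h1 | h1 | h1
  · exact h1
  · exact (h.empty _ (hT.mem' h'.bc) h1).elim
  · exact (h'.empty _ (hT.mem' h.bc) h1).elim

theorem mirror_Face {s : Finset V} {T : Finset (Sym2 V)} {a b c : V} :
    @Face V (mirror V) s T a b c ↔ Face s T b a c := by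
  constructor
  · rintro ⟨h1, h2, h3, h4, h5⟩
    exact ⟨h1, Sym2.eq_swap ▸ h2, Sym2.eq_swap ▸ h4, Sym2.eq_swap ▸ h3,
      fun u hu hi => h5 u hu (mirror_In.2 hi)⟩
  · rintro ⟨h1, h2, h3, h4, h5⟩
    exact @Face.mk V (mirror V) _ _ _ _ _ h1 (Sym2.eq_swap ▸ h2) (Sym2.eq_swap ▸ h4)
      (Sym2.eq_swap ▸ h3) fun u hu hi => h5 u hu (mirror_In.1 hi)

theorem not_cross_of_In {p q a c v w : V} (h1 : In p q a c) (h2 : Cr p q v w) (h3 : ¬ Cr q a v w)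
    (h4 : ¬ Cr q c v w) (h5 : ¬ In v q a c) (h6 : ¬ In w q a c) :
    False := by
  obtain rfl | n_a_v := eq_or_ne a v
  · obtain rfl | n_c_w := eq_or_ne c w
    · obtain ⟨n_p_q, n_p_a, n_p_c, n_q_a, n_a_c, n_q_c⟩ := h1.ne
      simp only [Cr, Opp, In] at *
      have := tri n_p_q n_q_a n_p_a; have := tri n_p_q n_q_c n_p_c
      have := tri n_p_a n_a_c n_p_c; have := tri n_q_a n_a_c n_q_c; have := @inter V _ c p q a
      grind (splits := 40) only
    · obtain ⟨n_p_q, n_p_a, n_p_c, n_q_a, n_a_c, n_q_c⟩ := h1.ne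
      obtain ⟨_, n_a_w, _, n_p_w, _, n_q_w⟩ := h2.ne
      simp only [Cr, Opp, In] at *
      have := tri n_p_q n_q_a n_p_a; have := tri n_p_q n_q_c n_p_c
      have := tri n_p_q n_q_w n_p_w; have := tri n_p_a n_a_c n_p_c
      have := tri n_p_a n_a_w n_p_w; have := tri n_q_a n_a_c n_q_c
      have := tri n_q_a n_a_w n_q_w; have := tri n_q_c n_c_w n_q_w
      have := tri n_a_c n_c_w n_a_w; have := @trans' V _ a q w c p; have := @inter V _ a c q p
      have := @inter V _ a q p w
      by_cases q6 : L p a w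
      · grind (splits := 40) only
      · grind (splits := 40) only
  · obtain rfl | n_a_w := eq_or_ne a w
    · obtain rfl | n_c_v := eq_or_ne c v
      · obtain ⟨n_p_q, n_p_a, n_p_c, n_q_a, _, n_q_c⟩ := h1.ne
        simp only [Cr, Opp, In] at *
        have := tri n_p_q n_q_a n_p_a; have := tri n_p_q n_q_c n_p_c
        have := tri n_p_a n_a_v n_p_c; have := tri n_q_a n_a_v n_q_c; have := @inter V _ c p q a
        grind (splits := 40) only
      · obtain ⟨n_p_q, n_p_a, n_p_c, n_q_a, n_a_c, n_q_c⟩ := h1.ne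
        obtain ⟨_, _, n_p_v, _, n_q_v, _⟩ := h2.ne
        simp only [Cr, Opp, In] at *
        have := tri n_p_q n_q_a n_p_a; have := tri n_p_q n_q_c n_p_c
        have := tri n_p_q n_q_v n_p_v; have := tri n_p_a n_a_c n_p_c
        have := tri n_p_a n_a_v n_p_v; have := tri n_q_a n_a_c n_q_c
        have := tri n_q_a n_a_v n_q_v; have := tri n_q_c n_c_v n_q_v
        have := tri n_a_c n_c_v n_a_v; have := @trans' V _ a q v c p; have := @inter V _ a c q p
        have := @inter V _ a q p v
        by_cases q8 : L p a v
        · grind (splits := 40) only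
        · grind (splits := 40) only
    · obtain rfl | n_c_v := eq_or_ne c v
      · obtain ⟨n_p_q, n_p_a, n_p_c, n_q_a, _, n_q_c⟩ := h1.ne
        obtain ⟨_, n_c_w, _, n_p_w, _, n_q_w⟩ := h2.ne
        simp only [Cr, Opp, In] at *
        have := tri n_p_q n_q_a n_p_a; have := tri n_p_q n_q_c n_p_c
        have := tri n_p_q n_q_w n_p_w; have := tri n_p_a n_a_v n_p_c
        have := tri n_p_a n_a_w n_p_w; have := tri n_p_c n_c_w n_p_w
        have := tri n_q_a n_a_v n_q_c; have := tri n_q_a n_a_w n_q_w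
        have := tri n_q_c n_c_w n_q_w; have := tri n_a_v n_c_w n_a_w
        have := @trans' V _ p w c q a; have := @trans V _ q w p c a; have := @inter V _ a w p c
        have := @inter V _ p w q c
        by_cases q8 : L p c w
        · grind (splits := 40) only
        · grind (splits := 40) only
      · obtain rfl | n_c_w := eq_or_ne c w
        · obtain ⟨n_p_q, n_p_a, n_p_c, n_q_a, _, n_q_c⟩ := h1.ne
          obtain ⟨_, _, n_p_v, _, n_q_v, _⟩ := h2.ne
          simp only [Cr, Opp, In] at *
          have := tri n_p_q n_q_a n_p_a; have := tri n_p_q n_q_c n_p_c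
          have := tri n_p_q n_q_v n_p_v; have := tri n_p_a n_a_w n_p_c
          have := tri n_p_a n_a_v n_p_v; have := tri n_p_c n_c_v n_p_v
          have := tri n_q_a n_a_w n_q_c; have := tri n_q_a n_a_v n_q_v
          have := tri n_q_c n_c_v n_q_v; have := tri n_a_w n_c_v n_a_v
          have := @trans' V _ p v c q a; have := @trans V _ q v p c a
          have := @inter V _ a v p c; have := @inter V _ p v q c
          by_cases q10 : L p c v
          · grind (splits := 40) only
          · grind (splits := 40) only
        · obtain ⟨n_p_q, n_p_a, n_p_c, n_q_a, n_a_c, n_q_c⟩ := h1.ne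
          obtain ⟨_, n_v_w, n_p_v, n_p_w, n_q_v, n_q_w⟩ := h2.ne
          simp only [Cr, Opp, In] at *
          have := tri n_p_q n_q_a n_p_a; have := tri n_p_q n_q_c n_p_c
          have := tri n_p_q n_q_v n_p_v; have := tri n_p_q n_q_w n_p_w
          have := tri n_p_a n_a_c n_p_c; have := tri n_p_a n_a_v n_p_v
          have := tri n_p_a n_a_w n_p_w; have := tri n_p_c n_c_v n_p_v
          have := tri n_p_c n_c_w n_p_w; have := tri n_p_v n_v_w n_p_w
          have := tri n_q_a n_a_c n_q_c; have := tri n_q_a n_a_v n_q_v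
          have := tri n_q_a n_a_w n_q_w; have := tri n_q_c n_c_v n_q_v
          have := tri n_q_c n_c_w n_q_w; have := tri n_q_v n_v_w n_q_w
          have := tri n_a_c n_c_v n_a_v; have := tri n_a_c n_c_w n_a_w
          have := tri n_a_v n_v_w n_a_w; have := tri n_c_v n_v_w n_c_w
          have := @trans V _ q v a p w; have := @trans' V _ w q p v c
          have := @trans' V _ p w a c v; have := @trans V _ v q a w p
          have := @trans' V _ p v q a w; have := @trans V _ a p q w v
          have := @trans V _ p w a c q; have := @trans' V _ q c p v a
          have := @trans V _ q w v a c; have := @trans' V _ q v p c w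
          have := @trans V _ a c v w q; have := @trans V _ p v q a c
          have := @trans' V _ w a c q p; have := @trans V _ w p c a v
          have := @trans V _ a w v p q; have := @trans' V _ q c a v w
          have := @trans V _ q a p c v; have := @trans' V _ p c v a w
          have := @trans V _ w c q a v; have := @trans V _ q a w v c
          have := @trans V _ c q v p a; have := @inter V _ p w v q; have := @inter V _ c p q a
          have := @inter V _ q w v p; have := @inter V _ a c v q; have := @inter V _ a w v p
          have := @inter V _ a c w p; have := @inter V _ p v w c
          by_cases q10 : L p v w
          · by_cases q12 : L p q v
            · grind (splits := 40) only
            · by_cases q14 : L q c v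
              · by_cases q16 : L q a w
                · by_cases q18 : L p a v
                  · grind (splits := 40) only
                  · grind (splits := 40) only
                · grind (splits := 40) only
              · grind (splits := 40) only
          · by_cases q12 : L p q v
            · by_cases q14 : L q a w
              · by_cases q16 : L p a w
                · grind (splits := 40) only
                · by_cases q18 : L q a v
                  · grind (splits := 40) only
                  · grind (splits := 40) only
              · grind (splits := 40) only
            · grind (splits := 40) only

theorem left_of_not_In {p q a c : V} (h1 : L q a p) (h2 : L q p c) (h3 : L q a c)
    (h4 : ¬ In p q a c) :
    L p c a := by
  obtain ⟨n_q_a, n_a_p, n_q_p⟩ := L_ne h1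
  obtain ⟨_, n_p_c, n_q_c⟩ := L_ne h2
  obtain ⟨_, n_a_c, _⟩ := L_ne h3
  simp only [In] at *
  have := tri n_q_p.symm n_q_a n_a_p.symm; have := tri n_q_p.symm n_q_c n_p_c
  have := tri n_a_p.symm n_a_c n_p_c; have := tri n_q_a n_a_c n_q_c
  grind (splits := 40) only

theorem In_or_cross {q a b d p : V} (h1 : L q b p) (h2 : L q p a) (h3 : L q b a) (h4 : L q b d)
    (h5 : L q d p) :
    In d q b a ∨ Cr q d b a := by
  obtain ⟨n_q_b, n_b_p, n_q_p⟩ := L_ne h1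
  obtain ⟨_, n_p_a, n_q_a⟩ := L_ne h2
  obtain ⟨_, n_b_a, _⟩ := L_ne h3
  obtain ⟨_, n_b_d, n_q_d⟩ := L_ne h4
  obtain ⟨_, n_d_p, _⟩ := L_ne h5
  have n_a_d : a ≠ d := by rintro rfl; grind [Cr, Opp, In, asymm, rot, L_self_left, L_self_right]
  simp only [Cr, Opp, In] at *
  have := tri n_q_a n_b_a.symm n_q_b; have := tri n_q_a n_a_d n_q_d
  have := tri n_q_a n_p_a.symm n_q_p; have := tri n_q_b n_b_d n_q_d
  have := tri n_q_b n_b_p n_q_p; have := tri n_q_d n_d_p n_q_p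
  have := tri n_b_a.symm n_b_d n_a_d; have := @trans V _ q b a d p
  grind (splits := 40) only

theorem cross_of_far {p a b q : V} (h1 : L b a q) (h2 : L p a b) (h3 : L p a q) (h4 : L p q b) :
    Cr p q a b := by
  obtain ⟨n_b_a, n_a_q, n_b_q⟩ := L_ne h1
  obtain ⟨n_p_a, _, n_p_b⟩ := L_ne h2
  obtain ⟨_, _, n_p_q⟩ := L_ne h3
  simp only [Cr, Opp] at *
  have := tri n_p_a n_b_a.symm n_p_b; have := tri n_p_a n_a_q n_p_q
  have := tri n_p_b n_b_q n_p_q; have := tri n_b_a.symm n_b_q n_a_q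
  grind (splits := 40) only

theorem cross_of_not_In {p a b c q : V} (h1 : In p a b c) (h2 : ¬ In q a b c) (h3 : q ≠ a)
    (h4 : q ≠ b) (h5 : q ≠ c) (h6 : p ≠ q) :
    Cr p q a b ∨ Cr p q b c ∨ Cr p q c a := by
  obtain ⟨n_p_a, n_p_b, n_p_c, n_a_b, n_b_c, n_a_c⟩ := h1.ne
  have n_p_q : p ≠ q := by rintro rfl; grind [Cr, Opp, In, asymm, rot, L_self_left, L_self_right]
  have n_a_q : a ≠ q := by rintro rfl; grind [Cr, Opp, In, asymm, rot, L_self_left, L_self_right]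
  have n_b_q : b ≠ q := by rintro rfl; grind [Cr, Opp, In, asymm, rot, L_self_left, L_self_right]
  have n_c_q : c ≠ q := by rintro rfl; grind [Cr, Opp, In, asymm, rot, L_self_left, L_self_right]
  simp only [Cr, Opp, In] at *
  have := tri n_p_a n_a_b n_p_b; have := tri n_p_a n_a_c n_p_c; have := tri n_p_a n_a_q n_p_q
  have := tri n_p_b n_b_c n_p_c; have := tri n_p_b n_b_q n_p_q; have := tri n_p_c n_c_q n_p_q
  have := tri n_a_b n_b_c n_a_c; have := tri n_a_b n_b_q n_a_q; have := tri n_a_c n_c_q n_a_q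
  have := tri n_b_c n_c_q n_b_q; have := @trans V _ b c a q p; have := @trans V _ p q b c a
  have := @trans' V _ c b q a p; have := @trans V _ q b c a p; have := @trans V _ a b c q p
  have := @trans V _ q c b p a; have := @trans V _ c a p b q; have := @inter V _ a p b c
  have := @inter V _ a c b q
  by_cases q2 : L a b q
  · by_cases q4 : L a c q
    · grind (splits := 40) only
    · grind (splits := 40) only
  · by_cases q4 : L p a q
    · grind (splits := 40) only
    · grind (splits := 40) only

theorem side_of_In {p A B C u v : V} (h1 : In p A B C) (h2 : L u v p) :
    L u v A ∨ L u v B ∨ L u v C := by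
  obtain rfl | n_u_A := eq_or_ne u A
  · obtain rfl | n_v_B := eq_or_ne v B
    · obtain ⟨n_p_u, n_p_v, n_p_C, n_u_v, n_v_C, n_u_C⟩ := h1.ne
      simp only [In] at *
      have := tri n_p_C n_u_C.symm n_p_u; have := tri n_p_C n_v_C.symm n_p_v
      have := tri n_p_u n_u_v n_p_v; have := tri n_u_C.symm n_u_v n_v_C.symm
      have := @inter V _ C v p u
      grind (splits := 40) only
    · obtain ⟨n_p_u, n_p_B, n_p_C, n_u_B, n_B_C, n_u_C⟩ := h1.ne
      obtain ⟨n_u_v, n_v_p, _⟩ := L_ne h2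
      have n_C_v : C ≠ v := by
        rintro rfl
        grind [Cr, Opp, In, asymm, rot, L_self_left, L_self_right]
      simp only [In] at *
      have := tri n_p_B n_B_C n_p_C; have := tri n_p_B n_u_B.symm n_p_u
      have := tri n_p_C n_u_C.symm n_p_u; have := tri n_p_u n_u_v n_v_p.symm
      have := tri n_B_C n_u_C.symm n_u_B.symm; have := tri n_u_B.symm n_u_v n_v_B.symm
      have := tri n_u_C.symm n_u_v n_C_v; have := @trans V _ u B p C v; have := @inter V _ B p C u
      grind (splits := 40) only
  · obtain rfl | n_u_B := eq_or_ne u B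
    · obtain rfl | n_v_C := eq_or_ne v C
      · obtain ⟨n_p_A, n_p_u, n_p_v, _, n_u_v, n_A_v⟩ := h1.ne
        simp only [In] at *
        have := tri n_p_A n_u_A.symm n_p_u; have := tri n_p_A n_A_v n_p_v
        have := tri n_p_u n_u_v n_p_v; have := tri n_u_A.symm n_u_v n_A_v
        have := @inter V _ A v p u
        grind (splits := 40) only
      · obtain ⟨n_p_A, n_p_u, n_p_C, _, n_u_C, n_A_C⟩ := h1.ne
        obtain ⟨n_u_v, n_v_p, _⟩ := L_ne h2
        have n_A_v : A ≠ v := by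
          rintro rfl
          grind [Cr, Opp, In, asymm, rot, L_self_left, L_self_right]
        simp only [In] at *
        have := tri n_p_A n_A_C n_p_C; have := tri n_p_A n_u_A.symm n_p_u
        have := tri n_p_C n_u_C.symm n_p_u; have := tri n_p_u n_u_v n_v_p.symm
        have := tri n_A_C n_u_C.symm n_u_A.symm; have := tri n_u_A.symm n_u_v n_A_v
        have := tri n_u_C.symm n_u_v n_v_C.symm; have := @trans V _ u C A v p
        have := @inter V _ C u p A
        grind (splits := 40) only
    · obtain rfl | n_u_C := eq_or_ne u C
      · obtain rfl | n_v_A := eq_or_ne v A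
        · obtain ⟨n_p_v, n_p_B, n_p_u, n_v_B, _⟩ := h1.ne
          simp only [In] at *
          have := tri n_p_B n_u_B.symm n_p_u; have := tri n_p_B n_v_B.symm n_p_v
          have := tri n_p_u n_u_A n_p_v; have := tri n_u_B.symm n_u_A n_v_B.symm
          have := @inter V _ B v p u
          grind (splits := 40) only
        · obtain ⟨n_p_A, n_p_B, n_p_u, n_A_B, _⟩ := h1.ne
          obtain ⟨n_u_v, n_v_p, _⟩ := L_ne h2
          have n_B_v : B ≠ v := by
            rintro rfl
            grind [Cr, Opp, In, asymm, rot, L_self_left, L_self_right]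
          simp only [In] at *
          have := tri n_p_A n_A_B n_p_B; have := tri n_p_A n_u_A.symm n_p_u
          have := tri n_p_B n_u_B.symm n_p_u; have := tri n_p_u n_u_v n_v_p.symm
          have := tri n_A_B n_u_B.symm n_u_A.symm; have := tri n_u_A.symm n_u_v n_v_A.symm
          have := tri n_u_B.symm n_u_v n_B_v; have := @trans V _ u A p B v
          have := @inter V _ A p B u
          grind (splits := 40) only
      · obtain rfl | n_v_A := eq_or_ne v A
        · obtain ⟨n_p_v, n_p_B, n_p_C, n_v_B, n_B_C, n_v_C⟩ := h1.ne
          obtain ⟨_, _, n_u_p⟩ := L_ne h2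
          simp only [In] at *
          have := tri n_p_B n_B_C n_p_C; have := tri n_p_B n_v_B.symm n_p_v
          have := tri n_p_C n_v_C.symm n_p_v; have := tri n_u_p.symm n_u_A n_p_v
          have := tri n_B_C n_v_C.symm n_v_B.symm; have := tri n_u_B.symm n_u_A n_v_B.symm
          have := tri n_u_C.symm n_u_A n_v_C.symm; have := @trans' V _ v C B p u
          have := @inter V _ B C v p
          grind (splits := 40) only
        · obtain rfl | n_v_B := eq_or_ne v B
          · obtain ⟨n_p_A, n_p_v, n_p_C, _, n_v_C, n_A_C⟩ := h1.ne
            obtain ⟨_, _, n_u_p⟩ := L_ne h2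
            simp only [In] at *
            have := tri n_p_A n_A_C n_p_C; have := tri n_p_A n_v_A.symm n_p_v
            have := tri n_p_C n_v_C.symm n_p_v; have := tri n_u_p.symm n_u_B n_p_v
            have := tri n_A_C n_v_C.symm n_v_A.symm; have := tri n_u_A.symm n_u_B n_v_A.symm
            have := tri n_u_C.symm n_u_B n_v_C.symm; have := @trans' V _ v A p u C
            have := @inter V _ C v p A
            grind (splits := 40) only
          · obtain rfl | n_v_C := eq_or_ne v C
            · obtain ⟨n_p_A, n_p_B, n_p_v, n_A_B, _⟩ := h1.ne
              obtain ⟨_, _, n_u_p⟩ := L_ne h2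
              simp only [In] at *
              have := tri n_p_A n_A_B n_p_B; have := tri n_p_A n_v_A.symm n_p_v
              have := tri n_p_B n_v_B.symm n_p_v; have := tri n_u_p.symm n_u_C n_p_v
              have := tri n_A_B n_v_B.symm n_v_A.symm; have := tri n_u_A.symm n_u_C n_v_A.symm
              have := tri n_u_B.symm n_u_C n_v_B.symm; have := @trans' V _ v B A p u
              have := @inter V _ A B v p
              grind (splits := 40) only
            · obtain ⟨n_p_A, n_p_B, n_p_C, n_A_B, n_B_C, n_A_C⟩ := h1.ne
              obtain ⟨n_u_v, n_v_p, n_u_p⟩ := L_ne h2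
              simp only [In] at *
              have := tri n_p_A n_A_B n_p_B; have := tri n_p_A n_A_C n_p_C
              have := tri n_p_A n_u_A.symm n_u_p.symm; have := tri n_p_B n_B_C n_p_C
              have := tri n_p_B n_u_B.symm n_u_p.symm; have := tri n_p_C n_u_C.symm n_u_p.symm
              have := tri n_u_p.symm n_u_v n_v_p.symm; have := tri n_A_B n_u_B.symm n_u_A.symm
              have := tri n_A_C n_u_C.symm n_u_A.symm; have := tri n_u_A.symm n_u_v n_v_A.symm
              have := tri n_B_C n_u_C.symm n_u_B.symm; have := tri n_u_B.symm n_u_v n_v_B.symm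
              have := tri n_u_C.symm n_u_v n_v_C.symm; have := @trans V _ p u C A B
              have := @trans V _ u C A v p; have := @trans' V _ p u A B C
              have := @trans V _ u B C v p; have := @trans V _ u A B v p
              have := @inter V _ B C u p; have := @inter V _ A u C p; have := @inter V _ A p B u
              by_cases q14 : L p A u
              · by_cases q16 : L p C u
                · grind (splits := 40) only
                · grind (splits := 40) only
              · by_cases q16 : L p B u
                · grind (splits := 40) only
                · grind (splits := 40) only

theorem left_of_In_hull {p A B C u : V} (h1 : In p A B C) (h2 : u ≠ p) :
    L p u A ∨ L p u B ∨ L p u C := by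
  obtain rfl | n_u_A := eq_or_ne u A
  · obtain ⟨n_p_u, n_p_B, n_p_C, n_u_B, n_B_C, n_u_C⟩ := h1.ne
    simp only [In] at *
    have := tri n_p_B n_B_C n_p_C; have := tri n_p_B n_u_B.symm n_p_u
    have := tri n_p_C n_u_C.symm n_p_u
    grind (splits := 40) only
  · obtain rfl | n_u_B := eq_or_ne u B
    · obtain ⟨n_p_A, n_p_u, n_p_C, _, n_u_C, n_A_C⟩ := h1.ne
      simp only [In] at *
      have := tri n_p_A n_A_C n_p_C; have := tri n_p_A n_u_A.symm n_p_u
      have := tri n_p_C n_u_C.symm n_p_u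
      grind (splits := 40) only
    · obtain rfl | n_u_C := eq_or_ne u C
      · obtain ⟨n_p_A, n_p_B, n_p_u, n_A_B, _⟩ := h1.ne
        simp only [In] at *
        have := tri n_p_A n_A_B n_p_B; have := tri n_p_A n_u_A.symm n_p_u
        have := tri n_p_B n_u_B.symm n_p_u
        grind (splits := 40) only
      · obtain ⟨n_p_A, n_p_B, n_p_C, n_A_B, n_B_C, n_A_C⟩ := h1.ne
        have n_p_u : p ≠ u := by
          rintro rfl
          grind [Cr, Opp, In, asymm, rot, L_self_left, L_self_right]
        simp only [In] at *
        have := tri n_p_A n_A_B n_p_B; have := tri n_p_A n_A_C n_p_C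
        have := tri n_p_A n_u_A.symm n_p_u; have := tri n_p_B n_B_C n_p_C
        have := tri n_p_B n_u_B.symm n_p_u; have := tri n_p_C n_u_C.symm n_p_u
        have := @trans' V _ p u C A B
        grind (splits := 40) only

theorem right_of_In_hull {p A B C u : V} (h1 : In p A B C) (h2 : u ≠ p) :
    L u p A ∨ L u p B ∨ L u p C := by
  obtain rfl | n_u_A := eq_or_ne u A
  · obtain ⟨n_p_u, n_p_B, n_p_C, n_u_B, n_B_C, n_u_C⟩ := h1.ne
    simp only [In] at *
    have := tri n_p_B n_B_C n_p_C; have := tri n_p_B n_u_B.symm n_p_u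
    have := tri n_p_C n_u_C.symm n_p_u
    grind (splits := 40) only
  · obtain rfl | n_u_B := eq_or_ne u B
    · obtain ⟨n_p_A, n_p_u, n_p_C, _, n_u_C, n_A_C⟩ := h1.ne
      simp only [In] at *
      have := tri n_p_A n_A_C n_p_C; have := tri n_p_A n_u_A.symm n_p_u
      have := tri n_p_C n_u_C.symm n_p_u
      grind (splits := 40) only
    · obtain rfl | n_u_C := eq_or_ne u C
      · obtain ⟨n_p_A, n_p_B, n_p_u, n_A_B, _⟩ := h1.ne
        simp only [In] at *
        have := tri n_p_A n_A_B n_p_B; have := tri n_p_A n_u_A.symm n_p_u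
        have := tri n_p_B n_u_B.symm n_p_u
        grind (splits := 40) only
      · obtain ⟨n_p_A, n_p_B, n_p_C, n_A_B, n_B_C, n_A_C⟩ := h1.ne
        have n_p_u : p ≠ u := by
          rintro rfl
          grind [Cr, Opp, In, asymm, rot, L_self_left, L_self_right]
        simp only [In] at *
        have := tri n_p_A n_A_B n_p_B; have := tri n_p_A n_A_C n_p_C
        have := tri n_p_A n_u_A.symm n_p_u; have := tri n_p_B n_B_C n_p_C
        have := tri n_p_B n_u_B.symm n_p_u; have := tri n_p_C n_u_C.symm n_p_u
        have := @trans V _ p u B C A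
        grind (splits := 40) only

/-- The points of `t` are in convex position around the outer triangle `ABC`. -/
structure Hull (t : Finset V) (A B C : V) : Prop where
  A_mem : A ∈ t
  B_mem : B ∈ t
  C_mem : C ∈ t
  left : L A B C
  inside : ∀ x ∈ t, x = A ∨ x = B ∨ x = C ∨ In x A B C

/-- `p` is surrounded by the points of `t`. -/
structure Inside (t : Finset V) (p : V) : Prop where
  notMem : p ∉ t
  side : ∀ u v, L u v p → ∃ r ∈ t, L u v r
  left : ∀ u, u ≠ p → ∃ r ∈ t, L p u r
  right : ∀ u, u ≠ p → ∃ r ∈ t, L u p r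

theorem Hull.inside_of_In {t : Finset V} {A B C p : V} (h : Hull t A B C) (hp : In p A B C)
    (hpt : p ∉ t) : Inside t p where
  notMem := hpt
  side u v hl := by
    rcases side_of_In hp hl with h1 | h1 | h1
    exacts [⟨_, h.A_mem, h1⟩, ⟨_, h.B_mem, h1⟩, ⟨_, h.C_mem, h1⟩]
  left u hu := by
    rcases left_of_In_hull hp hu with h1 | h1 | h1
    exacts [⟨_, h.A_mem, h1⟩, ⟨_, h.B_mem, h1⟩, ⟨_, h.C_mem, h1⟩]
  right u hu := by
    rcases right_of_In_hull hp hu with h1 | h1 | h1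
    exacts [⟨_, h.A_mem, h1⟩, ⟨_, h.B_mem, h1⟩, ⟨_, h.C_mem, h1⟩]

/-- The face of `T` beyond the edge `ab`, seen from `p`, has apex `q` visible through `ab`. -/
structure Far (t : Finset V) (T : Finset (Sym2 V)) (p a b q : V) : Prop where
  face : Face t T b a q
  base : L p a b
  left : L p a q
  right : L p q b

theorem mirror_Far {t : Finset V} {T : Finset (Sym2 V)} {p a b q : V} :
    @Far V (mirror V) t T p a b q ↔ Far t T p b a q := by
  constructor
  · intro h
    exact ⟨mirror_Face.1 (@Far.face V (mirror V) _ _ _ _ _ _ h),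
      rot (mirror_L.1 (@Far.base V (mirror V) _ _ _ _ _ _ h)),
      rot (mirror_L.1 (@Far.right V (mirror V) _ _ _ _ _ _ h)),
      rot (mirror_L.1 (@Far.left V (mirror V) _ _ _ _ _ _ h))⟩
  · rintro ⟨h1, h2, h3, h4⟩
    exact @Far.mk V (mirror V) _ _ _ _ _ _ (mirror_Face.2 h1) (mirror_L.2 (rot (rot h2)))
      (mirror_L.2 (rot (rot h4))) (mirror_L.2 (rot (rot h3)))

theorem Far.cross {t : Finset V} {T : Finset (Sym2 V)} {p a b q : V} (h : Far t T p a b q) :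
    Cr p q a b := cross_of_far h.face.left h.base h.left h.right

theorem Face.not_cross_of_In {t : Finset V} {T : Finset (Sym2 V)} (hT : Tri t T) {p a b c v w : V}
    (hf : Face t T a b c) (hp : In p a b c) (hvw : s(v, w) ∈ T) : ¬ Cr p a v w := fun hc =>
  CC.not_cross_of_In hp hc (hT.noX hf.ab hvw) (hT.noX (Sym2.eq_swap ▸ hf.ca) hvw)
    (hf.empty _ (hT.mem hvw)) (hf.empty _ (hT.mem' hvw))

theorem exists_far {t : Finset V} {T : Finset (Sym2 V)} (hT : Tri t T) {p q v w : V}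
    (hp : Inside t p) (hq : q ∈ t) (hvw : s(v, w) ∈ T) (hcr : Cr p q v w) :
    ∃ a b, Far t T p a b q := by
  have hqp : q ≠ p := fun h => hp.notMem (h ▸ hq)
  obtain ⟨r, hr, hl⟩ := hp.left q hqp
  obtain ⟨u, hu, hul, huv⟩ := exists_vis_right hT.toPlane hr hl
  obtain ⟨a, ha, hlast⟩ := exists_last_right (F := t.filter fun a => L p q a ∧ s(q, a) ∈ T)
    (x := q) (a := p) ⟨u, by simp [hu, hul, hT.max hq hu (L_ne hul).2.1 huv]⟩
    fun u hu => (Finset.mem_filter.1 hu).2.1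
  simp only [Finset.mem_filter] at ha hlast
  obtain ⟨ha, hla, hqa⟩ := ha
  obtain ⟨r, hr, hl⟩ := hp.side q a (rot hla)
  obtain ⟨c, hc, hf⟩ := exists_face hT hqa hr hl
  have hac := (L_ne hf.left).2.1
  have hqc := (L_ne hf.left).2.2
  have hpc : p ≠ c := fun h => hp.notMem (h ▸ hc)
  have hlc : L q p c := by
    by_contra hn
    have h1 : L p q c := by
      have := total (V := V) hqp hpc hqc
      tauto
    have := hlast c ⟨hc, h1, Sym2.eq_swap ▸ hf.ca⟩ hac.symm
    exact asymm (rot hf.left) (rot this)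
  have hpin : ¬ In p q a c := fun h => hf.not_cross_of_In hT h hvw hcr
  exact ⟨c, a, hf.rot, left_of_not_In (rot hla) hlc hf.left hpin, rot hlc, hla⟩

theorem Far.left_right_unique {t : Finset V} {T : Finset (Sym2 V)} (hT : Plane t T)
    {p a b a' b' q : V} (h : Far t T p a b q) (h' : Far t T p a' b' q) : a = a' ∧ b = b' := by
  have key : ∀ {a b a' b' : V}, Far t T p a b q → Far t T p a' b' q → ¬ L q b b' := by
    intro a b a' b' h h' hl
    rcases In_or_cross (rot h.right) (rot (rot h.left)) (rot (rot h.face.left)) hl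
        (rot h'.right) with
      h1 | h1
    · exact h.face.empty _ (hT.mem h'.face.ab) ⟨h1.2.1, h1.2.2, h1.1⟩
    · exact hT.noX (Sym2.eq_swap ▸ h'.face.ca) h.face.ab h1
  have hb : b = b' := by
    by_contra hne
    have h1 := (L_ne h.right).2.1
    have h2 := (L_ne h'.right).2.1
    have := total h1 hne h2
    have h3 := key h h'
    have h4 := key h' h
    have := @rot V _
    grind
  subst hb
  exact ⟨(h.face.rot.rot.unique hT h'.face.rot.rot).symm ▸ rfl, rfl⟩

theorem Far.unique {t : Finset V} {T : Finset (Sym2 V)} (hT : Plane t T) {p a b q a' b' q' : V}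
    (h : Far t T p a b q) (h' : Far t T p a' b' q') (he : s(a, b) = s(a', b')) :
    a = a' ∧ b = b' ∧ q = q' := by
  rcases Sym2.eq_iff.1 he with ⟨rfl, rfl⟩ | ⟨rfl, rfl⟩
  · exact ⟨rfl, rfl, h.face.unique hT h'.face⟩
  · exact (asymm (rot h.base) (rot (rot (rot (rot h'.base))))).elim

theorem exists_root {t : Finset V} {T : Finset (Sym2 V)} (hT : Tri t T) {p : V}
    (hp : Inside t p) (hne : t.Nonempty) : ∃ a b c, Face t T a b c ∧ In p a b c := by
  obtain ⟨x, hx⟩ := hne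
  obtain ⟨r, hr, hl⟩ := hp.left x fun h => hp.notMem (h ▸ hx)
  obtain ⟨u, hu, hul, huv⟩ := exists_vis hT.toPlane hr hl
  obtain ⟨r, hr, hl⟩ := hp.left u (L_ne hul).2.2.symm
  obtain ⟨v, hv, hvl, hvv⟩ := exists_vis hT.toPlane hr hl
  obtain ⟨w, hw, hfirst⟩ := exists_first_left (F := t.filter fun w => L p u w ∧ Vis T p w)
    (x := p) (a := u) ⟨v, by simp [hv, hvl, hvv]⟩ fun w hw => (Finset.mem_filter.1 hw).2.1
  simp only [Finset.mem_filter] at hw hfirst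
  obtain ⟨hw, hwl, hwv⟩ := hw
  obtain ⟨hempty, huw⟩ := empty_and_vis hT.toPlane huv hwv hwl fun y hy h1 h2 h3 =>
    asymm (rot h2) (rot (hfirst y ⟨hy, h1, h3⟩ (L_ne h2).2.1))
  have hE : s(u, w) ∈ T := hT.max hu hw (L_ne hwl).2.1 huw
  obtain ⟨r, hr, hl⟩ := hp.side u w (rot hwl)
  obtain ⟨c, hc, hf⟩ := exists_face hT hE hr hl
  refine ⟨u, w, c, hf, ?_⟩
  rcases eq_or_In_of_left hf.left (rot hwl) (fun h => hwv _ _ hf.ca h.symm.swap_left.swap_right)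
    (fun h => huv _ _ hf.bc h.swap_left) with h1 | h1 | h1
  · exact (hp.notMem (h1 ▸ hc)).elim
  · exact h1
  · exact (hempty c hc ⟨h1.2.2, h1.1, h1.2.1⟩).elim

theorem vis_iff_of_root {t : Finset V} {T : Finset (Sym2 V)} (hT : Tri t T) {p a b c : V}
    (hpt : p ∉ t) (hf : Face t T a b c) (hp : In p a b c) {q : V} (hq : q ∈ t) :
    Vis T p q ↔ q = a ∨ q = b ∨ q = c := by
  constructor
  · intro h
    by_contra! hne
    rcases cross_of_not_In hp (hf.empty q hq) hne.1 hne.2.1 hne.2.2 fun h => hpt (h ▸ hq) with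
      h1 | h1 | h1
    exacts [h _ _ hf.ab h1, h _ _ hf.bc h1, h _ _ hf.ca h1]
  · rintro (rfl | rfl | rfl) v w hvw
    · exact hf.not_cross_of_In hT hp hvw
    · exact hf.rot.not_cross_of_In hT ⟨hp.2.1, hp.2.2, hp.1⟩ hvw
    · exact hf.rot.rot.not_cross_of_In hT ⟨hp.2.2, hp.1, hp.2.1⟩ hvw

/-- The points of `t` that `p` sees after the edges of `D` have been removed from `T`. -/
def nbr (t : Finset V) (T : Finset (Sym2 V)) (p : V) (D : Finset (Sym2 V)) : Finset V :=
  t.filter (Vis (T \ D) p)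

/-- Every edge of `D` lies on the boundary of a face beyond it whose apex is seen from `p`
once `D` has been removed. -/
def Tight (t : Finset V) (T : Finset (Sym2 V)) (p : V) (D : Finset (Sym2 V)) : Prop :=
  D ⊆ T ∧ ∀ e ∈ D, ∃ a b q, e = s(a, b) ∧ Far t T p a b q ∧ Vis (T \ D) p q

theorem Tight.card_nbr {t : Finset V} {T D : Finset (Sym2 V)} (hT : Tri t T) {p : V}
    (hp : Inside t p) (hne : t.Nonempty) (hD : Tight t T p D) :
    (nbr t T p D).card = D.card + 3 := by
  obtain ⟨a, b, c, hf, hin⟩ := exists_root hT hp hne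
  have hpt := hp.notMem
  have hroot := @vis_iff_of_root V _ t T hT p a b c hpt hf hin
  obtain ⟨-, hab, hac, hbc⟩ : True ∧ a ≠ b ∧ a ≠ c ∧ b ≠ c :=
    ⟨trivial, (L_ne hf.left).1, (L_ne hf.left).2.2, (L_ne hf.left).2.1⟩
  have hR : ({a, b, c} : Finset V) ⊆ nbr t T p D := by
    intro q hq
    have hq' : q = a ∨ q = b ∨ q = c := by simpa using hq
    have hqt : q ∈ t := by
      rcases hq' with rfl | rfl | rfl
      exacts [hT.mem hf.ab, hT.mem hf.bc, hT.mem hf.ca]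
    exact Finset.mem_filter.2 ⟨hqt, fun v w hvw =>
      (hroot hqt).2 hq' v w (Finset.mem_sdiff.1 hvw).1⟩
  have hR3 : ({a, b, c} : Finset V).card = 3 := Finset.card_eq_three.2 ⟨a, b, c, hab, hac, hbc, rfl⟩
  suffices h : D.card = (nbr t T p D \ {a, b, c}).card by
    rw [h, ← hR3, Finset.card_sdiff_add_card_eq_card hR]
  have : Nonempty V := ⟨a⟩
  choose! l r f hlr hfar hvis using hD.2
  refine Finset.card_bij (fun e _ => f e) ?_ ?_ ?_
  · intro e he
    have h1 := hfar e he
    have hft : f e ∈ t := hT.mem' h1.face.bc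
    simp only [Finset.mem_sdiff, nbr, Finset.mem_filter, Finset.mem_insert, Finset.mem_singleton]
    exact ⟨⟨hft, hvis e he⟩, fun h => (hroot hft).2 h _ _ (hlr e he ▸ hD.1 he) h1.cross⟩
  · intro e he e' he' hee
    have h1 := hfar e he
    have h2 := (h1.left_right_unique hT.toPlane (hee ▸ hfar e' he'))
    rw [hlr e he, hlr e' he', h2.1, h2.2]
  · intro q hq
    simp only [Finset.mem_sdiff, nbr, Finset.mem_filter, Finset.mem_insert,
      Finset.mem_singleton] at hq
    obtain ⟨⟨hqt, hqv⟩, hq3⟩ := hq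
    rw [← hroot hqt] at hq3
    simp only [Vis, not_forall, not_not] at hq3
    obtain ⟨v, w, hvw, hcr⟩ := hq3
    obtain ⟨x, y, hxy⟩ := exists_far hT hp hqt hvw hcr
    have hxyD : s(x, y) ∈ D := by
      by_contra hn
      exact hqv x y (Finset.mem_sdiff.2 ⟨Sym2.eq_swap ▸ hxy.face.ab, hn⟩) hxy.cross
    refine ⟨_, hxyD, ?_⟩
    exact ((hfar _ hxyD).unique hT.toPlane hxy (hlr _ hxyD).symm).2.2

theorem cross_of_apex {p a b c q r : V} (h1 : L p a b) (h2 : L b a c) (h3 : Cr p q a b)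
    (h4 : Cr p q a c) (h5 : L p q r) (h6 : r ≠ c) (h7 : r ≠ p) (h8 : ¬ In a p q r)
    (h9 : ¬ In b p q r) (h10 : ¬ In c p q r) (h11 : ¬ Cr q r a b) (h12 : ¬ Cr q r a c)
    (h13 : ¬ Cr q r b c) (h14 : ¬ In q b a c) (h15 : ¬ In r b a c) :
    Cr p r a b ∧ Cr p r a c := by
  obtain rfl | n_r_a := eq_or_ne r a
  · obtain ⟨n_p_r, n_r_b, n_p_b⟩ := L_ne h1
    obtain ⟨_, n_r_c, n_b_c⟩ := L_ne h2
    obtain ⟨n_p_q, _, _, _, n_q_r, n_q_b⟩ := h3.ne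
    obtain ⟨_, _, _, n_p_c, _, n_q_c⟩ := h4.ne
    simp only [Cr, Opp, In] at *
    have := tri n_p_b n_q_b.symm n_p_q; have := tri n_p_b n_r_b.symm n_p_r
    have := tri n_p_c n_q_c.symm n_p_q; have := tri n_p_c n_r_c.symm n_p_r
    have := tri n_p_q n_q_r n_p_r; have := tri n_b_c n_q_c.symm n_q_b.symm
    have := tri n_b_c n_r_c.symm n_r_b.symm; have := tri n_q_b.symm n_q_r n_r_b.symm
    have := tri n_q_c.symm n_q_r n_r_c.symm; have := @inter V _ b q r p
    grind (splits := 40) only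
  · obtain rfl | n_r_b := eq_or_ne r b
    · obtain ⟨n_p_a, _, n_p_r⟩ := L_ne h1
      obtain ⟨_, n_a_c, n_r_c⟩ := L_ne h2
      obtain ⟨n_p_q, _, _, _, n_q_a, n_q_r⟩ := h3.ne
      obtain ⟨_, _, _, n_p_c, _, n_q_c⟩ := h4.ne
      simp only [Cr, Opp, In] at *
      have := tri n_p_a n_a_c n_p_c; have := tri n_p_a n_q_a.symm n_p_q
      have := tri n_p_a n_r_a.symm n_p_r; have := tri n_p_c n_q_c.symm n_p_q
      have := tri n_p_c n_r_c.symm n_p_r; have := tri n_p_q n_q_r n_p_r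
      have := tri n_a_c n_q_c.symm n_q_a.symm; have := tri n_a_c n_r_c.symm n_r_a.symm
      have := tri n_q_a.symm n_q_r n_r_a.symm; have := tri n_q_c.symm n_q_r n_r_c.symm
      have := @trans' V _ r q p a c
      by_cases q6 : L p a c
      · grind (splits := 40) only
      · grind (splits := 40) only
    · obtain ⟨n_p_a, n_a_b, n_p_b⟩ := L_ne h1
      obtain ⟨_, n_a_c, n_b_c⟩ := L_ne h2
      obtain ⟨n_p_q, _, _, _, n_q_a, n_q_b⟩ := h3.ne
      obtain ⟨_, _, _, n_p_c, _, n_q_c⟩ := h4.ne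
      obtain ⟨_, n_q_r, n_p_r⟩ := L_ne h5
      have n_c_r : c ≠ r := by
        rintro rfl
        grind [Cr, Opp, In, asymm, rot, L_self_left, L_self_right]
      simp only [Cr, Opp, In] at *
      have := tri n_p_a n_a_b n_p_b; have := tri n_p_a n_a_c n_p_c
      have := tri n_p_a n_q_a.symm n_p_q; have := tri n_p_a n_r_a.symm n_p_r
      have := tri n_p_b n_q_b.symm n_p_q; have := tri n_p_b n_r_b.symm n_p_r
      have := tri n_p_c n_q_c.symm n_p_q; have := tri n_p_c n_c_r n_p_r
      have := tri n_p_q n_q_r n_p_r; have := tri n_a_b n_b_c n_a_c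
      have := tri n_a_b n_q_b.symm n_q_a.symm; have := tri n_a_b n_r_b.symm n_r_a.symm
      have := tri n_a_c n_q_c.symm n_q_a.symm; have := tri n_a_c n_c_r n_r_a.symm
      have := tri n_q_a.symm n_q_r n_r_a.symm; have := tri n_b_c n_q_c.symm n_q_b.symm
      have := tri n_b_c n_c_r n_r_b.symm; have := tri n_q_b.symm n_q_r n_r_b.symm
      have := tri n_q_c.symm n_q_r n_c_r; have := @trans V _ q c p a r
      have := @trans' V _ q p c b r; have := @trans' V _ b q p a r; have := @trans V _ a q r c p
      have := @trans V _ r c a b p; have := @trans V _ c p q r a; have := @trans V _ r p a q c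
      have := @inter V _ b r c a; have := @inter V _ a q p b; have := @inter V _ a q c p
      have := @inter V _ p r q a
      by_cases q6 : L p a q
      · by_cases q8 : L p a c
        · by_cases q10 : L p a r
          · by_cases q12 : L p b r
            · grind (splits := 40) only
            · by_cases q14 : L c q r
              · grind (splits := 40) only
              · grind (splits := 40) only
          · grind (splits := 40) only
        · grind (splits := 40) only
      · grind (splits := 40) only

theorem left_of_apex {p a b c q : V} (h1 : L p a b) (h2 : L b a c) (h3 : Cr p q a b)
    (h4 : Cr p q a c) (h5 : L p q c) (h6 : ¬ In b p q c) :
    L p c b := by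
  obtain ⟨n_p_a, n_a_b, n_p_b⟩ := L_ne h1
  obtain ⟨_, n_a_c, n_b_c⟩ := L_ne h2
  obtain ⟨n_p_q, _, _, _, n_q_a, n_q_b⟩ := h3.ne
  obtain ⟨_, _, _, n_p_c, _, n_q_c⟩ := h4.ne
  simp only [Cr, Opp, In] at *
  have := tri n_p_a n_a_b n_p_b; have := tri n_p_a n_a_c n_p_c
  have := tri n_p_a n_q_a.symm n_p_q; have := tri n_p_b n_b_c n_p_c
  have := tri n_p_b n_q_b.symm n_p_q; have := tri n_p_c n_q_c.symm n_p_q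
  have := tri n_a_b n_b_c n_a_c; have := tri n_a_b n_q_b.symm n_q_a.symm
  have := tri n_a_c n_q_c.symm n_q_a.symm; have := tri n_b_c n_q_c.symm n_q_b.symm
  have := @trans' V _ b q c p a
  grind (splits := 40) only

theorem fan_of_cross {p a b q : V} (h1 : L p a b) (h2 : Cr p q a b) :
    L p a q ∧ L p q b := by
  obtain ⟨n_p_a, n_a_b, n_p_b⟩ := L_ne h1
  obtain ⟨n_p_q, _, _, _, n_q_a, n_q_b⟩ := h2.ne
  simp only [Cr, Opp] at *
  have := tri n_p_a n_a_b n_p_b; have := tri n_p_a n_q_a.symm n_p_q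
  have := tri n_p_b n_q_b.symm n_p_q; have := tri n_a_b n_q_b.symm n_q_a.symm
  have := @inter V _ b p q a
  by_cases q2 : L p a q
  · grind (splits := 40) only
  · grind (splits := 40) only

theorem left_of_cross_right {p a b c q : V} (h1 : L p a b) (h2 : L b a c) (h3 : Cr p q a b)
    (h4 : Cr p q a c) (h5 : L p q c) :
    L p a c := by
  obtain ⟨n_p_a, n_a_b, n_p_b⟩ := L_ne h1
  obtain ⟨_, n_a_c, n_b_c⟩ := L_ne h2
  obtain ⟨n_p_q, _, _, _, n_q_a, n_q_b⟩ := h3.ne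
  obtain ⟨_, _, _, n_p_c, _, n_q_c⟩ := h4.ne
  simp only [Cr, Opp] at *
  have := tri n_p_a n_a_b n_p_b; have := tri n_p_a n_a_c n_p_c
  have := tri n_p_a n_q_a.symm n_p_q; have := tri n_p_b n_q_b.symm n_p_q
  have := tri n_p_c n_q_c.symm n_p_q; have := tri n_a_b n_b_c n_a_c
  have := tri n_a_b n_q_b.symm n_q_a.symm; have := tri n_a_c n_q_c.symm n_q_a.symm
  have := @inter V _ a q c p
  grind (splits := 40) only

/-- The edges of `T` that avoid `p`. -/
def away (T : Finset (Sym2 V)) (p : V) : Finset (Sym2 V) := T.filter fun e => p ∉ e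

theorem mem_away {α : Type*} {T : Finset (Sym2 α)} {p a b : α} :
    s(a, b) ∈ away T p ↔ s(a, b) ∈ T ∧ p ≠ a ∧ p ≠ b := by
  simp [away]

theorem Plane.away {t : Finset V} {T : Finset (Sym2 V)} {p : V} (hT : Plane (insert p t) T) :
    Plane t (away T p) where
  mem h := by
    obtain ⟨h1, h2, -⟩ := mem_away.1 h
    exact Finset.mem_of_mem_insert_of_ne (hT.mem h1) h2.symm
  ne h := hT.ne (mem_away.1 h).1
  noX h h' := hT.noX (mem_away.1 h).1 (mem_away.1 h').1

theorem Tri.edge_iff_vis_away {t : Finset V} {T : Finset (Sym2 V)} {p q : V}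
    (hT : Tri (insert p t) T) (hq : q ∈ t) (hpt : p ∉ t) :
    s(p, q) ∈ T ↔ Vis (away T p) p q := by
  refine ⟨fun h v w hvw => hT.noX h (mem_away.1 hvw).1, fun h => ?_⟩
  refine hT.max (by simp) (by simp [hq]) (fun e => hpt (e ▸ hq)) fun v w hvw hcr => ?_
  exact h v w (mem_away.2 ⟨hvw, hcr.ne.2.2.1, hcr.ne.2.2.2.1⟩) hcr

theorem far_of_cross {t : Finset V} {T T' : Finset (Sym2 V)} {p a b c q : V}
    (hT' : Tri (insert p t) T') (hT : Tri t T) (hsub : away T' p ⊆ T)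
    (hb : L p a b) (hf : Face t T b a c) (hpq : s(p, q) ∈ T') (hab : Cr p q a b)
    (hac : Cr p q a c) : s(p, c) ∈ T' ∧ Far t T p a b c := by
  have hat := hT.mem' hf.ab
  have hbt := hT.mem hf.ab
  have hct := hT.mem' hf.bc
  have hfan : ∀ q, Cr p q a b → L p a q ∧ L p q b := fun q h => fan_of_cross hb h
  obtain ⟨q, hq, hlast⟩ := exists_last_left
    (F := t.filter fun q => s(p, q) ∈ T' ∧ Cr p q a b ∧ Cr p q a c) (x := p) (a := a)
    ⟨q, by
      simp only [Finset.mem_filter]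
      exact ⟨Finset.mem_of_mem_insert_of_ne (hT'.mem' hpq) (hT'.ne hpq).symm, hpq, hab, hac⟩⟩
    fun q hq => (hfan q (Finset.mem_filter.1 hq).2.2.1).1
  clear hpq hab hac
  simp only [Finset.mem_filter] at hq hlast
  obtain ⟨hqt, hpq, hab, hac⟩ := hq
  obtain ⟨r, hr, hqr, hpr, hqre, hempty⟩ := exists_apex hT' hpq (Finset.mem_insert_of_mem hbt)
    (hfan q hab).2
  have hrp := (L_ne hqr).2.2.symm
  have hrt := Finset.mem_of_mem_insert_of_ne hr hrp
  have hqrT : s(q, r) ∈ T := hsub (mem_away.2 ⟨hqre, (L_ne hqr).1, hrp.symm⟩)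
  have hem : ∀ u ∈ t, ¬ In u p q r := fun u hu => hempty u (Finset.mem_insert_of_mem hu)
  by_cases hrc : r = c
  · subst hrc
    exact ⟨hpr, hf, hb, left_of_cross_right hb hf.left hab hac hqr,
      left_of_apex hb hf.left hab hac hqr (hem b hbt)⟩
  · have := cross_of_apex hb hf.left hab hac hqr hrc hrp (hem a hat) (hem b hbt) (hem c hct)
      (hT.noX hqrT (Sym2.eq_swap ▸ hf.ab)) (hT.noX hqrT hf.bc)
      (hT.noX hqrT (Sym2.eq_swap ▸ hf.ca)) (hf.empty q hqt) (hf.empty r hrt)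
    exact (asymm (rot (hlast r ⟨hrt, hpr, this⟩ (L_ne hqr).2.1.symm))
      (rot (rot (rot (rot hqr))))).elim

theorem exists_far_of_cross {t : Finset V} {T T' : Finset (Sym2 V)} {p a b q : V} (hpi : Inside t p)
    (hT' : Tri (insert p t) T') (hT : Tri t T) (hsub : away T' p ⊆ T) (hb : L p a b)
    (hE : s(a, b) ∈ T) (hpq : s(p, q) ∈ T') (hab : Cr p q a b) :
    ∃ c ∈ t, s(p, c) ∈ T' ∧ Far t T p a b c := by
  have hqt : q ∈ t := Finset.mem_of_mem_insert_of_ne (hT'.mem' hpq) (hT'.ne hpq).symm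
  obtain ⟨h1, h2⟩ := fan_of_cross hb hab
  have hl : L b a q := by
    simp only [Cr, Opp] at hab
    have := @asymm V _
    have := @rot V _
    grind
  obtain ⟨c, hc, hf⟩ := exists_face hT (Sym2.eq_swap ▸ hE) hqt hl
  refine ⟨c, hc, ?_⟩
  by_cases hqc : q = c
  · subst hqc
    exact ⟨hpq, hf, hb, h1, h2⟩
  rcases pasch hab hf.left (fun h => hpi.notMem (h ▸ hc)) hqc
    (fun h => asymm h.1 (rot hb)) (hf.empty q hqt) with h | h
  · exact far_of_cross hT' hT hsub hb hf hpq hab h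
  · obtain ⟨h3, h4⟩ := @far_of_cross V (mirror V) t T T' p b a c q (mirror_Tri.2 hT')
      (mirror_Tri.2 hT) hsub (mirror_L.2 (rot (rot hb))) (mirror_Face.2 hf) hpq
      (mirror_Cr.2 hab.swap_right) (mirror_Cr.2 h)
    exact ⟨h3, mirror_Far.1 h4⟩

/-- Deleting `p` from a maximal plane graph leaves a plane graph that is obtained from any of its
maximal extensions by deleting a tight set of edges. -/
theorem tight_sdiff {t : Finset V} {T T' : Finset (Sym2 V)} {p : V} (hpi : Inside t p)
    (hT' : Tri (insert p t) T') (hT : Tri t T) (hsub : away T' p ⊆ T) :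
    Tight t T p (T \ away T' p) := by
  refine ⟨Finset.sdiff_subset, fun e he => ?_⟩
  rw [Finset.sdiff_sdiff_eq_self hsub]
  induction e with | _ a b =>
  obtain ⟨heT, heH⟩ := Finset.mem_sdiff.1 he
  have ha := hT.mem heT
  have hb := hT.mem' heT
  have hap : p ≠ a := fun h => hpi.notMem (h ▸ ha)
  have hbp : p ≠ b := fun h => hpi.notMem (h ▸ hb)
  have hnot : ¬ Vis T' a b := fun h => heH (mem_away.2 ⟨hT'.max (Finset.mem_insert_of_mem ha)
    (Finset.mem_insert_of_mem hb) (hT.ne heT) h, hap, hbp⟩)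
  simp only [Vis, not_forall, not_not] at hnot
  obtain ⟨v, w, hvw, hcr⟩ := hnot
  obtain ⟨q, hq, hcr⟩ : ∃ q, s(p, q) ∈ T' ∧ Cr p q a b := by
    by_cases hv : p = v
    · exact ⟨w, hv ▸ hvw, hv ▸ hcr.symm⟩
    by_cases hw : p = w
    · exact ⟨v, hw ▸ Sym2.eq_swap ▸ hvw, hw ▸ hcr.symm.swap_left⟩
    exact (hT.noX heT (hsub (mem_away.2 ⟨hvw, hv, hw⟩)) hcr).elim
  have hside : L p a b ∨ L p b a := (total hap (hT.ne heT) hbp).imp_right rot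
  rcases hside with h | h
  · obtain ⟨c, hc, h1, h2⟩ := exists_far_of_cross hpi hT' hT hsub h heT hq hcr
    exact ⟨a, b, c, rfl, h2, (hT'.edge_iff_vis_away hc hpi.notMem).1 h1⟩
  · obtain ⟨c, hc, h1, h2⟩ := exists_far_of_cross hpi hT' hT hsub h (Sym2.eq_swap ▸ heT) hq
      hcr.swap_right
    exact ⟨b, a, c, Sym2.eq_swap, h2, (hT'.edge_iff_vis_away hc hpi.notMem).1 h1⟩

theorem exists_tri {s : Finset V} {H : Finset (Sym2 V)} (hH : Plane s H) :
    ∃ T, Tri s T ∧ H ⊆ T := by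
  have hsub : ∀ G, Plane s G → G ⊆ s.sym2 := by
    intro G hG e he
    induction e with | _ a b => exact Finset.mk_mem_sym2_iff.2 ⟨hG.mem he, hG.mem' he⟩
  obtain ⟨T, hT, hmax⟩ := (s.sym2.powerset.filter fun G => Plane s G ∧ H ⊆ G).exists_max_image
    Finset.card ⟨H, by simp [hH, hsub H hH]⟩
  simp only [Finset.mem_filter, Finset.mem_powerset] at hT hmax
  refine ⟨T, ⟨hT.2.1, fun {a b} ha hb hab hv => ?_⟩, hT.2.2⟩
  by_contra hn
  have hP : Plane s (insert s(a, b) T) := by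
    refine ⟨fun {x y} h => ?_, fun {x y} h => ?_, fun {x y z w} h h' hc => ?_⟩
    · rcases Finset.mem_insert.1 h with h | h
      · rcases Sym2.eq_iff.1 h with ⟨rfl, rfl⟩ | ⟨rfl, rfl⟩ <;> assumption
      · exact hT.2.1.mem h
    · rcases Finset.mem_insert.1 h with h | h
      · rcases Sym2.eq_iff.1 h with ⟨rfl, rfl⟩ | ⟨rfl, rfl⟩
        exacts [hab, hab.symm]
      · exact hT.2.1.ne h
    · rw [← X_mk] at hc
      rcases Finset.mem_insert.1 h with h | h <;> rcases Finset.mem_insert.1 h' with h' | h'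
      · rw [h, h', X_mk] at hc
        exact hc.ne.2.2.1 rfl
      · rw [h, X_mk] at hc
        exact hv _ _ h' hc
      · rw [h', X_mk] at hc
        exact hv _ _ h hc.symm
      · exact hT.2.1.noX h h' (X_mk.1 hc)
  have := hmax _ ⟨hsub _ hP, hP, hT.2.2.trans (Finset.subset_insert _ _)⟩
  rw [Finset.card_insert_of_notMem hn] at this
  omega

theorem card_eq_away_add {α : Type*} {T : Finset (Sym2 α)} (p : α) :
    T.card = (away T p).card + (T.filter fun e => p ∈ e).card := by
  rw [away, add_comm, Finset.card_filter_add_card_filter_not]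

theorem Tri.star_eq {t : Finset V} {T T' : Finset (Sym2 V)} {p : V} (hpt : p ∉ t)
    (hT' : Tri (insert p t) T') (hsub : away T' p ⊆ T) :
    T'.filter (fun e => p ∈ e) = (nbr t T p (T \ away T' p)).image fun q => s(p, q) := by
  ext e
  simp only [Finset.mem_filter, Finset.mem_image, nbr, Finset.sdiff_sdiff_eq_self hsub]
  constructor
  · rintro ⟨he, hpe⟩
    obtain ⟨q, rfl⟩ := hpe
    have hq := Finset.mem_of_mem_insert_of_ne (hT'.mem' he) (hT'.ne he).symm
    exact ⟨q, ⟨hq, (hT'.edge_iff_vis_away hq hpt).1 he⟩, rfl⟩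
  · rintro ⟨q, ⟨hq, hv⟩, rfl⟩
    exact ⟨(hT'.edge_iff_vis_away hq hpt).2 hv, by simp⟩

theorem Tri.card_star {t : Finset V} {T T' : Finset (Sym2 V)} {p : V} (hpi : Inside t p)
    (hne : t.Nonempty) (hT' : Tri (insert p t) T') (hT : Tri t T) (hsub : away T' p ⊆ T) :
    (T'.filter fun e => p ∈ e).card = (T \ away T' p).card + 3 := by
  rw [hT'.star_eq hpi.notMem hsub,
    Finset.card_image_of_injective _ fun x y h => Sym2.congr_right.1 h,
    (tight_sdiff hpi hT' hT hsub).card_nbr hT hpi hne]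

theorem Tri.card_insert {t : Finset V} {T T' : Finset (Sym2 V)} {p : V} (hpi : Inside t p)
    (hne : t.Nonempty) (hT' : Tri (insert p t) T') (hT : Tri t T) (hsub : away T' p ⊆ T) :
    T'.card = T.card + 3 := by
  rw [card_eq_away_add p, hT'.card_star hpi hne hT hsub, ← add_assoc, add_comm (away T' p).card,
    Finset.card_sdiff_add_card_eq_card hsub]

theorem Hull.erase {s : Finset V} {A B C p : V} (h : Hull s A B C) (hA : p ≠ A) (hB : p ≠ B)
    (hC : p ≠ C) : Hull (s.erase p) A B C :=
  ⟨Finset.mem_erase.2 ⟨hA.symm, h.A_mem⟩, Finset.mem_erase.2 ⟨hB.symm, h.B_mem⟩,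
    Finset.mem_erase.2 ⟨hC.symm, h.C_mem⟩, h.left,
    fun x hx => h.inside x (Finset.mem_of_mem_erase hx)⟩

theorem Hull.inside_erase {s : Finset V} {A B C p : V} (h : Hull s A B C) (hp : p ∈ s)
    (hA : p ≠ A) (hB : p ≠ B) (hC : p ≠ C) : Inside (s.erase p) p :=
  (h.erase hA hB hC).inside_of_In (by have := h.inside p hp; tauto) (by simp)

theorem Tri.side_mem {s : Finset V} {T : Finset (Sym2 V)} {A B C : V} (h : Hull s A B C)
    (hT : Tri s T) : s(A, B) ∈ T ∧ s(B, C) ∈ T ∧ s(C, A) ∈ T := by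
  obtain ⟨h1, h2, h3⟩ := L_ne h.left
  have key : ∀ {A B C : V}, Hull s A B C → Vis T A B := by
    intro A B C h y z hyz hc
    have hl : ∀ x ∈ s, x ≠ A → x ≠ B → L A B x := by
      intro x hx h1 h2
      rcases h.inside x hx with rfl | rfl | rfl | h3
      exacts [(h1 rfl).elim, (h2 rfl).elim, h.left, h3.1]
    have hy := hl y (hT.mem hyz) hc.ne.2.2.1.symm hc.ne.2.2.2.2.1.symm
    have hz := hl z (hT.mem' hyz) hc.ne.2.2.2.1.symm hc.ne.2.2.2.2.2.symm
    rcases hc.1 with h | h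
    exacts [asymm hz h.2, asymm hy h.1]
  have hrot : ∀ {A B C : V}, Hull s A B C → Hull s B C A := fun h =>
    ⟨h.B_mem, h.C_mem, h.A_mem, rot h.left, fun x hx => by
      rcases h.inside x hx with h1 | h1 | h1 | h1
      exacts [.inr (.inr (.inl h1)), .inl h1, .inr (.inl h1),
        .inr (.inr (.inr ⟨h1.2.1, h1.2.2, h1.1⟩))]⟩
  exact ⟨hT.max h.A_mem h.B_mem h1 (key h), hT.max h.B_mem h.C_mem h2 (key (hrot h)),
    hT.max h.C_mem h.A_mem h3.symm (key (hrot (hrot h)))⟩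

theorem Tri.card_eq {s : Finset V} {T : Finset (Sym2 V)} {A B C : V} (h : Hull s A B C)
    (hT : Tri s T) : T.card + 6 = 3 * s.card := by
  induction hn : s.card generalizing s T with
  | zero => exact absurd h.A_mem (by simp [Finset.card_eq_zero.1 hn])
  | succ n ih =>
    obtain ⟨h1, h2, h3⟩ := L_ne h.left
    by_cases hs : ∃ p ∈ s, p ≠ A ∧ p ≠ B ∧ p ≠ C
    · obtain ⟨p, hp, hA, hB, hC⟩ := hs
      have hin := h.inside_erase hp hA hB hC
      rw [← Finset.insert_erase hp] at hT
      obtain ⟨T₀, hT₀, hsub⟩ := exists_tri hT.toPlane.away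
      have hc := Finset.card_erase_of_mem hp
      have := ih (h.erase hA hB hC) hT₀ (by omega)
      have := hT.card_insert hin ⟨A, (h.erase hA hB hC).A_mem⟩ hT₀ hsub
      omega
    · push Not at hs
      have hs3 : s = {A, B, C} := by
        ext x
        simp only [Finset.mem_insert, Finset.mem_singleton]
        refine ⟨fun hx => ?_, ?_⟩
        · have := hs x hx
          tauto
        · rintro (rfl | rfl | rfl)
          exacts [h.A_mem, h.B_mem, h.C_mem]
      have hT3 : T = {s(A, B), s(B, C), s(C, A)} := by
        obtain ⟨e1, e2, e3⟩ := hT.side_mem h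
        refine Finset.Subset.antisymm (fun e he => ?_) ?_
        · induction e with | _ x y =>
          have hx := hT.mem he
          have hy := hT.mem' he
          have hxy := hT.ne he
          simp only [hs3, Finset.mem_insert, Finset.mem_singleton] at hx hy
          rcases hx with rfl | rfl | rfl <;> rcases hy with rfl | rfl | rfl <;>
            simp_all [Sym2.eq_swap]
        · simp [Finset.insert_subset_iff, e1, e2, e3]
      have c1 : s.card = 3 := by rw [hs3, Finset.card_eq_three.2 ⟨A, B, C, h1, h3, h2, rfl⟩]
      have c2 : T.card = 3 := by
        rw [hT3, Finset.card_eq_three.2 ⟨s(A, B), s(B, C), s(C, A), ?_, ?_, ?_, rfl⟩] <;>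
          simp [h1, h2, h3, h1.symm, h3.symm]
      omega

/-- The graph obtained by replacing `D` with a star centred at `p`. -/
def glue (t : Finset V) (T : Finset (Sym2 V)) (p : V) (D : Finset (Sym2 V)) : Finset (Sym2 V) :=
  (T \ D) ∪ (nbr t T p D).image fun q => s(p, q)

theorem mem_glue {t : Finset V} {T D : Finset (Sym2 V)} {p a b : V} (hT : Plane t T) (hpt : p ∉ t) :
    s(a, b) ∈ glue t T p D ↔ (s(a, b) ∈ T \ D ∧ p ≠ a ∧ p ≠ b) ∨
      (a = p ∧ b ∈ nbr t T p D) ∨ (b = p ∧ a ∈ nbr t T p D) := by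
  simp only [glue, Finset.mem_union, Finset.mem_image, Sym2.eq_iff]
  constructor
  · rintro (h | ⟨q, hq, ⟨rfl, rfl⟩ | ⟨rfl, rfl⟩⟩)
    · have h' := (Finset.mem_sdiff.1 h).1
      exact .inl ⟨h, fun e => hpt (e ▸ hT.mem h'), fun e => hpt (e ▸ hT.mem' h')⟩
    · exact .inr (.inl ⟨rfl, hq⟩)
    · exact .inr (.inr ⟨rfl, hq⟩)
  · rintro (h | ⟨rfl, hq⟩ | ⟨rfl, hq⟩)
    exacts [.inl h.1, .inr ⟨_, hq, .inl ⟨rfl, rfl⟩⟩, .inr ⟨_, hq, .inr ⟨rfl, rfl⟩⟩]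

theorem away_glue {t : Finset V} {T D : Finset (Sym2 V)} {p : V} (hT : Plane t T) (hpt : p ∉ t) :
    away (glue t T p D) p = T \ D := by
  ext e
  induction e with | _ a b =>
  rw [mem_away, mem_glue hT hpt]
  constructor
  · rintro ⟨h | h | h, h1, h2⟩
    exacts [h.1, (h1 h.1.symm).elim, (h2 h.1.symm).elim]
  · intro h
    have h' := (Finset.mem_sdiff.1 h).1
    have := fun e : p = a => hpt (e ▸ hT.mem h')
    have := fun e : p = b => hpt (e ▸ hT.mem' h')
    tauto

theorem Tight.glue {t : Finset V} {T D : Finset (Sym2 V)} {p A B C : V} (h : Hull t A B C)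
    (hpi : In p A B C) (hpt : p ∉ t) (hT : Tri t T) (hD : Tight t T p D) :
    Tri (insert p t) (CC.glue t T p D) := by
  have hp := h.inside_of_In hpi hpt
  have hne : t.Nonempty := ⟨A, h.A_mem⟩
  have hmem := @mem_glue V _ t T D p
  have hnt : ∀ q ∈ nbr t T p D, q ∈ t := fun q hq => (Finset.mem_filter.1 hq).1
  have hnv : ∀ q ∈ nbr t T p D, Vis (T \ D) p q := fun q hq => (Finset.mem_filter.1 hq).2
  have hP : Plane (insert p t) (CC.glue t T p D) := by
    refine ⟨fun {x y} h => ?_, fun {x y} h => ?_, fun {x y z w} h h' hc => ?_⟩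
    · rcases (hmem hT.toPlane hpt).1 h with h | h | h
      · exact Finset.mem_insert_of_mem (hT.mem (Finset.mem_sdiff.1 h.1).1)
      · simp [h.1]
      · exact Finset.mem_insert_of_mem (hnt _ h.2)
    · rcases (hmem hT.toPlane hpt).1 h with h | h | h
      · exact hT.ne (Finset.mem_sdiff.1 h.1).1
      · rintro rfl
        exact hpt (h.1 ▸ hnt _ h.2)
      · rintro rfl
        exact hpt (h.1 ▸ hnt _ h.2)
    · have hne := hc.ne
      rcases (hmem hT.toPlane hpt).1 h with h | ⟨rfl, h⟩ | ⟨rfl, h⟩ <;>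
        rcases (hmem hT.toPlane hpt).1 h' with h' | ⟨rfl, h'⟩ | ⟨rfl, h'⟩
      · exact hT.noX (Finset.mem_sdiff.1 h.1).1 (Finset.mem_sdiff.1 h'.1).1 hc
      · exact hnv _ h' _ _ h.1 hc.symm
      · exact hnv _ h' _ _ h.1 hc.symm.swap_left
      · exact hnv _ h _ _ h'.1 hc
      · tauto
      · tauto
      · exact hnv _ h _ _ h'.1 hc.swap_left
      · tauto
      · tauto
  obtain ⟨T', hT', hsub⟩ := exists_tri hP
  have hcard : (CC.glue t T p D).card = T.card + 3 := by
    rw [card_eq_away_add p, away_glue hT.toPlane hpt]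
    have : (CC.glue t T p D).filter (fun e => p ∈ e) = (nbr t T p D).image fun q => s(p, q) := by
      ext e
      induction e with | _ a b =>
      simp only [Finset.mem_filter, hmem hT.toPlane hpt, Finset.mem_image, Sym2.eq_iff,
        Sym2.mem_iff]
      constructor
      · rintro ⟨h | ⟨rfl, h⟩ | ⟨rfl, h⟩, h'⟩
        exacts [by tauto, ⟨_, h, .inl ⟨rfl, rfl⟩⟩, ⟨_, h, .inr ⟨rfl, rfl⟩⟩]
      · rintro ⟨q, hq, ⟨rfl, rfl⟩ | ⟨rfl, rfl⟩⟩
        exacts [⟨.inr (.inl ⟨rfl, hq⟩), .inl rfl⟩, ⟨.inr (.inr ⟨rfl, hq⟩), .inr rfl⟩]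
    rw [this, Finset.card_image_of_injective _ fun x y h => Sym2.congr_right.1 h,
      hD.card_nbr hT hp hne, ← add_assoc, Finset.card_sdiff_add_card_eq_card hD.1]
  have hH : Hull (insert p t) A B C := ⟨by simp [h.A_mem], by simp [h.B_mem], by simp [h.C_mem],
    h.left, fun x hx => by
      rcases Finset.mem_insert.1 hx with rfl | hx
      exacts [.inr (.inr (.inr hpi)), h.inside x hx]⟩
  have e1 := hT'.card_eq hH
  have e2 := hT.card_eq h
  rw [Finset.card_insert_of_notMem hpt] at e1
  rwa [Finset.eq_of_subset_of_card_le hsub (by omega)]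

theorem side_of_cross {u v w a : V} (h1 : L u v w) (h2 : Cr u v w a) :
    L w a v ∧ L a w u ∧ L u a v := by
  obtain ⟨n_u_v, n_v_w, n_u_w⟩ := L_ne h1
  obtain ⟨_, n_w_a, _, n_u_a, _, n_v_a⟩ := h2.ne
  simp only [Cr, Opp] at *
  have := tri n_u_v n_v_w n_u_w; have := tri n_u_v n_v_a n_u_a; have := tri n_u_w n_w_a n_u_a
  have := tri n_v_w n_w_a n_v_a; have := @inter V _ a w u v
  by_cases q2 : L u w a
  · grind (splits := 40) only
  · grind (splits := 40) only

theorem not_In_flip_u_w {u v w a d : V} (h1 : L u v w) (h2 : Cr u v w a) (h3 : L w a d)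
    (h4 : Cr u v w d) (h5 : L u a d) (h6 : In a u d w) :
    False := by
  obtain ⟨n_u_v, n_v_w, n_u_w⟩ := L_ne h1
  obtain ⟨_, n_w_a, _, n_u_a, _, n_v_a⟩ := h2.ne
  obtain ⟨_, n_a_d, n_w_d⟩ := L_ne h3
  obtain ⟨_, _, _, n_u_d, _, n_v_d⟩ := h4.ne
  simp only [Cr, Opp, In] at *
  have := tri n_u_v n_v_w n_u_w; have := tri n_u_v n_v_a n_u_a; have := tri n_u_v n_v_d n_u_d
  have := tri n_u_w n_w_a n_u_a; have := tri n_u_w n_w_d n_u_d; have := tri n_u_a n_a_d n_u_d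
  have := tri n_v_w n_w_a n_v_a; have := tri n_v_w n_w_d n_v_d; have := tri n_w_a n_a_d n_w_d
  grind (splits := 40) only

theorem not_In_flip_u_a {u v w a d : V} (h1 : L u v w) (h2 : Cr u v w a) (h3 : L w a d)
    (h4 : Cr u v a d) (h5 : In a u d w) :
    False := by
  obtain ⟨n_u_v, n_v_w, n_u_w⟩ := L_ne h1
  obtain ⟨_, n_w_a, _, n_u_a, _, n_v_a⟩ := h2.ne
  obtain ⟨_, n_a_d, n_w_d⟩ := L_ne h3
  obtain ⟨_, _, _, n_u_d, _, n_v_d⟩ := h4.ne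
  simp only [Cr, Opp, In] at *
  have := tri n_u_v n_v_w n_u_w; have := tri n_u_v n_v_a n_u_a; have := tri n_u_v n_v_d n_u_d
  have := tri n_u_w n_w_a n_u_a; have := tri n_u_a n_a_d n_u_d; have := tri n_v_w n_w_a n_v_a
  have := tri n_v_a n_a_d n_v_d; have := tri n_w_a n_a_d n_w_d; have := @inter V _ a d u v
  grind (splits := 40) only

theorem not_In_flip_w_v {u v w a c : V} (h1 : L u v w) (h2 : Cr u v w a) (h3 : L a w c)
    (h4 : L w a v) (h5 : Cr u v w c) (h6 : L u a c) (h7 : In a c v w) :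
    False := by
  obtain ⟨n_u_v, n_v_w, n_u_w⟩ := L_ne h1
  obtain ⟨_, n_w_a, _, n_u_a, _, n_v_a⟩ := h2.ne
  obtain ⟨_, n_w_c, n_a_c⟩ := L_ne h3
  obtain ⟨_, _, _, n_u_c, _, n_v_c⟩ := h5.ne
  simp only [Cr, Opp, In] at *
  have := tri n_u_v n_v_w n_u_w; have := tri n_u_v n_v_a n_u_a; have := tri n_u_v n_v_c n_u_c
  have := tri n_u_w n_w_a n_u_a; have := tri n_u_w n_w_c n_u_c; have := tri n_u_a n_a_c n_u_c
  have := tri n_v_w n_w_a n_v_a; have := tri n_v_w n_w_c n_v_c; have := tri n_v_a n_a_c n_v_c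
  have := tri n_w_a n_a_c n_w_c; have := @trans' V _ a u v w c
  grind (splits := 40) only

theorem not_In_flip_w_w {u v w a c d : V} (h1 : L u v w) (h2 : Cr u v w a) (h3 : L a w c)
    (h4 : L w a d) (h5 : Cr u v w c) (h6 : L u a c) (h7 : Cr u v w d) (h8 : L u a d)
    (h9 : In a c d w) :
    False := by
  obtain ⟨n_u_v, n_v_w, n_u_w⟩ := L_ne h1
  obtain ⟨_, n_w_a, _, n_u_a, _, n_v_a⟩ := h2.ne
  obtain ⟨_, n_w_c, n_a_c⟩ := L_ne h3
  obtain ⟨_, n_a_d, n_w_d⟩ := L_ne h4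
  obtain ⟨_, _, _, n_u_c, _, n_v_c⟩ := h5.ne
  obtain ⟨_, _, _, n_u_d, _, n_v_d⟩ := h7.ne
  obtain ⟨_, _, _, n_c_d, _⟩ := h9.ne
  simp only [Cr, Opp, In] at *
  have := tri n_u_v n_v_w n_u_w; have := tri n_u_v n_v_a n_u_a; have := tri n_u_v n_v_c n_u_c
  have := tri n_u_v n_v_d n_u_d; have := tri n_u_w n_w_a n_u_a; have := tri n_u_w n_w_c n_u_c
  have := tri n_u_w n_w_d n_u_d; have := tri n_u_a n_a_c n_u_c; have := tri n_u_a n_a_d n_u_d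
  have := tri n_v_w n_w_a n_v_a; have := tri n_v_w n_w_c n_v_c; have := tri n_v_w n_w_d n_v_d
  have := tri n_w_a n_a_c n_w_c; have := tri n_w_a n_a_d n_w_d; have := tri n_a_c n_c_d n_a_d
  have := @trans' V _ a u w c d; have := @inter V _ u w v a
  grind (splits := 40) only

theorem not_In_flip_w_a {u v w a c d : V} (h1 : L u v w) (h2 : Cr u v w a) (h3 : L a w c)
    (h4 : L w a d) (h5 : Cr u v w c) (h6 : L u a c) (h7 : Cr u v a d) (h8 : In a c d w) :
    False := by
  obtain ⟨n_u_v, n_v_w, n_u_w⟩ := L_ne h1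
  obtain ⟨_, n_w_a, _, n_u_a, _, n_v_a⟩ := h2.ne
  obtain ⟨_, n_w_c, n_a_c⟩ := L_ne h3
  obtain ⟨_, n_a_d, n_w_d⟩ := L_ne h4
  obtain ⟨_, _, _, n_u_c, _, n_v_c⟩ := h5.ne
  obtain ⟨_, _, _, n_u_d, _, n_v_d⟩ := h7.ne
  obtain ⟨_, _, _, n_c_d, _⟩ := h8.ne
  simp only [Cr, Opp, In] at *
  have := tri n_u_v n_v_w n_u_w; have := tri n_u_v n_v_a n_u_a; have := tri n_u_v n_v_c n_u_c
  have := tri n_u_v n_v_d n_u_d; have := tri n_u_w n_w_a n_u_a; have := tri n_u_w n_w_c n_u_c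
  have := tri n_u_a n_a_c n_u_c; have := tri n_u_a n_a_d n_u_d; have := tri n_v_w n_w_a n_v_a
  have := tri n_v_w n_w_c n_v_c; have := tri n_v_a n_a_d n_v_d; have := tri n_w_a n_a_c n_w_c
  have := tri n_w_a n_a_d n_w_d; have := tri n_a_c n_c_d n_a_d; have := @trans' V _ a u w c d
  have := @inter V _ a u v d; have := @inter V _ u w v a
  by_cases q2 : L u w a
  · grind (splits := 40) only
  · grind (splits := 40) only

theorem not_In_flip_a_v {u v w a c : V} (h1 : L u v w) (h2 : Cr u v w a) (h3 : L a w c)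
    (h4 : Cr u v a c) (h5 : In a c v w) :
    False := by
  obtain ⟨n_u_v, n_v_w, n_u_w⟩ := L_ne h1
  obtain ⟨_, n_w_a, _, n_u_a, _, n_v_a⟩ := h2.ne
  obtain ⟨_, n_w_c, n_a_c⟩ := L_ne h3
  obtain ⟨_, _, _, n_u_c, _, n_v_c⟩ := h4.ne
  simp only [Cr, Opp, In] at *
  have := tri n_u_v n_v_w n_u_w; have := tri n_u_v n_v_a n_u_a; have := tri n_u_v n_v_c n_u_c
  have := tri n_u_w n_w_a n_u_a; have := tri n_u_a n_a_c n_u_c; have := tri n_v_w n_w_a n_v_a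
  have := tri n_v_a n_a_c n_v_c; have := tri n_w_a n_a_c n_w_c; have := @inter V _ a c u v
  grind (splits := 40) only

theorem not_In_flip_a_w {u v w a c d : V} (h1 : L u v w) (h2 : Cr u v w a) (h3 : L a w c)
    (h4 : L w a d) (h5 : Cr u v a c) (h6 : Cr u v w d) (h7 : L u a d) (h8 : In a c d w) :
    False := by
  obtain ⟨n_u_v, n_v_w, n_u_w⟩ := L_ne h1
  obtain ⟨_, n_w_a, _, n_u_a, _, n_v_a⟩ := h2.ne
  obtain ⟨_, n_w_c, n_a_c⟩ := L_ne h3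
  obtain ⟨_, n_a_d, n_w_d⟩ := L_ne h4
  obtain ⟨_, _, _, n_u_c, _, n_v_c⟩ := h5.ne
  obtain ⟨_, _, _, n_u_d, _, n_v_d⟩ := h6.ne
  obtain ⟨_, _, _, n_c_d, _⟩ := h8.ne
  simp only [Cr, Opp, In] at *
  have := tri n_u_v n_v_w n_u_w; have := tri n_u_v n_v_a n_u_a; have := tri n_u_v n_v_c n_u_c
  have := tri n_u_v n_v_d n_u_d; have := tri n_u_w n_w_a n_u_a; have := tri n_u_w n_w_d n_u_d
  have := tri n_u_a n_a_c n_u_c; have := tri n_u_a n_a_d n_u_d; have := tri n_v_w n_w_a n_v_a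
  have := tri n_v_w n_w_d n_v_d; have := tri n_v_a n_a_c n_v_c; have := tri n_w_a n_a_c n_w_c
  have := tri n_w_a n_a_d n_w_d; have := tri n_a_c n_c_d n_a_d; have := @trans' V _ a u w c d
  have := @inter V _ c v u a; have := @inter V _ u w v a
  by_cases q2 : L u w a
  · grind (splits := 40) only
  · grind (splits := 40) only

theorem not_In_flip_a_a {u v w a c d : V} (h1 : L u v w) (h2 : Cr u v w a) (h3 : L a w c)
    (h4 : L w a d) (h5 : Cr u v a c) (h6 : Cr u v a d) (h7 : In a c d w) :
    False := by
  obtain ⟨n_u_v, n_v_w, n_u_w⟩ := L_ne h1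
  obtain ⟨_, n_w_a, _, n_u_a, _, n_v_a⟩ := h2.ne
  obtain ⟨_, n_w_c, n_a_c⟩ := L_ne h3
  obtain ⟨_, n_a_d, n_w_d⟩ := L_ne h4
  obtain ⟨_, _, _, n_u_c, _, n_v_c⟩ := h5.ne
  obtain ⟨_, _, _, n_u_d, _, n_v_d⟩ := h6.ne
  obtain ⟨_, _, _, n_c_d, _⟩ := h7.ne
  simp only [Cr, Opp, In] at *
  have := tri n_u_v n_v_w n_u_w; have := tri n_u_v n_v_a n_u_a; have := tri n_u_v n_v_c n_u_c
  have := tri n_u_v n_v_d n_u_d; have := tri n_u_w n_w_a n_u_a; have := tri n_u_a n_a_c n_u_c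
  have := tri n_u_a n_a_d n_u_d; have := tri n_v_w n_w_a n_v_a; have := tri n_v_a n_a_c n_v_c
  have := tri n_v_a n_a_d n_v_d; have := tri n_w_a n_a_c n_w_c; have := tri n_w_a n_a_d n_w_d
  have := tri n_a_c n_c_d n_a_d; have := @trans V _ a v w c d; have := @inter V _ a u v d
  have := @inter V _ a v w u; have := @inter V _ a u v c
  by_cases q2 : L u w a
  · grind (splits := 40) only
  · by_cases q4 : L u a c
    · grind (splits := 40) only
    · grind (splits := 40) only

theorem cross_of_flip {w a c d : V} (h1 : L a w c) (h2 : L w a d) (h3 : ¬ In a c d w)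
    (h4 : ¬ In w d c a) :
    Cr c d w a := by
  obtain ⟨n_a_w, n_w_c, n_a_c⟩ := L_ne h1
  obtain ⟨_, n_a_d, n_w_d⟩ := L_ne h2
  have n_c_d : c ≠ d := by rintro rfl; grind [Cr, Opp, In, asymm, rot, L_self_left, L_self_right]
  simp only [Cr, Opp, In] at *
  have := tri n_a_w.symm n_a_c n_w_c; have := tri n_a_w.symm n_a_d n_w_d
  have := tri n_w_c n_c_d n_w_d; have := tri n_a_c n_c_d n_a_d
  grind (splits := 40) only

theorem unique_cross_flip {w a c d x y : V} (h1 : L a w c) (h2 : L w a d) (h3 : Cr c d w a)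
    (h4 : Cr c d x y) (h5 : ¬ Cr a w x y) (h6 : ¬ Cr w c x y) (h7 : ¬ Cr c a x y)
    (h8 : ¬ Cr a d x y) (h9 : ¬ Cr d w x y) (h10 : ¬ In x a w c) (h11 : ¬ In y a w c)
    (h12 : ¬ In x w a d) (h13 : ¬ In y w a d) :
    (x = a ∧ y = w) ∨ (x = w ∧ y = a) := by
  obtain rfl | n_x_w := eq_or_ne x w
  · obtain rfl | n_y_a := eq_or_ne y a
    · obtain ⟨n_y_x, n_x_c, n_y_c⟩ := L_ne h1
      obtain ⟨_, n_y_d, n_x_d⟩ := L_ne h2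
      obtain ⟨n_c_d, _⟩ := h3.ne
      simp only [Cr, Opp, In] at *
      have := tri n_c_d n_x_d.symm n_x_c.symm; have := tri n_c_d n_y_d.symm n_y_c.symm
      have := tri n_x_c.symm n_y_x.symm n_y_c.symm; have := tri n_x_d.symm n_y_x.symm n_y_d.symm
      grind (splits := 40) only
    · obtain ⟨n_a_x, n_x_c, n_a_c⟩ := L_ne h1
      obtain ⟨_, n_a_d, n_x_d⟩ := L_ne h2
      obtain ⟨n_c_d, _⟩ := h3.ne
      obtain ⟨_, n_x_y, _, n_c_y, _, n_d_y⟩ := h4.ne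
      simp only [Cr, Opp, In] at *
      have := tri n_a_c n_c_d n_a_d; have := tri n_a_c n_x_c.symm n_a_x
      have := tri n_a_c n_c_y n_y_a.symm; have := tri n_a_d n_x_d.symm n_a_x
      have := tri n_a_d n_d_y n_y_a.symm; have := tri n_a_x n_x_y n_y_a.symm
      have := tri n_c_d n_x_d.symm n_x_c.symm; have := tri n_c_d n_d_y n_c_y
      have := tri n_x_c.symm n_x_y n_c_y; have := tri n_x_d.symm n_x_y n_d_y
      have := @inter V _ a d c x; have := @inter V _ c x d y
      by_cases q6 : L a c d
      · grind (splits := 40) only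
      · by_cases q8 : L c x y
        · grind (splits := 40) only
        · by_cases q10 : L a c y
          · grind (splits := 40) only
          · grind (splits := 40) only
  · obtain rfl | n_x_a := eq_or_ne x a
    · obtain rfl | n_y_w := eq_or_ne y w
      · obtain ⟨_, n_y_c, n_x_c⟩ := L_ne h1
        obtain ⟨_, n_x_d, n_y_d⟩ := L_ne h2
        obtain ⟨n_c_d, _⟩ := h3.ne
        simp only [Cr, Opp, In] at *
        have := tri n_c_d n_x_d.symm n_x_c.symm; have := tri n_c_d n_y_d.symm n_y_c.symm
        have := tri n_x_c.symm n_x_w n_y_c.symm; have := tri n_x_d.symm n_x_w n_y_d.symm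
        grind (splits := 40) only
      · obtain ⟨_, n_w_c, n_x_c⟩ := L_ne h1
        obtain ⟨_, n_x_d, n_w_d⟩ := L_ne h2
        obtain ⟨n_c_d, _⟩ := h3.ne
        obtain ⟨_, n_x_y, _, n_c_y, _, n_d_y⟩ := h4.ne
        simp only [Cr, Opp, In] at *
        have := tri n_w_c n_c_d n_w_d; have := tri n_w_c n_x_c.symm n_x_w.symm
        have := tri n_w_c n_c_y n_y_w.symm; have := tri n_w_d n_x_d.symm n_x_w.symm
        have := tri n_w_d n_d_y n_y_w.symm; have := tri n_x_w.symm n_x_y n_y_w.symm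
        have := tri n_c_d n_x_d.symm n_x_c.symm; have := tri n_c_d n_d_y n_c_y
        have := tri n_x_c.symm n_x_y n_c_y; have := tri n_x_d.symm n_x_y n_d_y
        have := @inter V _ c x d w; have := @inter V _ c y d x
        by_cases q8 : L w c d
        · by_cases q10 : L c x y
          · by_cases q12 : L w c y
            · grind (splits := 40) only
            · grind (splits := 40) only
          · grind (splits := 40) only
        · grind (splits := 40) only
    · obtain rfl | n_y_w := eq_or_ne y w
      · obtain ⟨n_a_y, n_y_c, n_a_c⟩ := L_ne h1
        obtain ⟨_, n_a_d, n_y_d⟩ := L_ne h2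
        obtain ⟨n_c_d, _⟩ := h3.ne
        obtain ⟨_, _, n_c_x, _, n_d_x, _⟩ := h4.ne
        simp only [Cr, Opp, In] at *
        have := tri n_a_c n_c_d n_a_d; have := tri n_a_c n_c_x n_x_a.symm
        have := tri n_a_c n_y_c.symm n_a_y; have := tri n_a_d n_d_x n_x_a.symm
        have := tri n_a_d n_y_d.symm n_a_y; have := tri n_x_a.symm n_x_w n_a_y
        have := tri n_c_d n_d_x n_c_x; have := tri n_c_d n_y_d.symm n_y_c.symm
        have := tri n_c_x n_x_w n_y_c.symm; have := tri n_d_x n_x_w n_y_d.symm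
        have := @inter V _ c d x y; have := @inter V _ a c y d
        by_cases q8 : L a c d
        · grind (splits := 40) only
        · by_cases q10 : L c x y
          · by_cases q12 : L a c x
            · grind (splits := 40) only
            · grind (splits := 40) only
          · grind (splits := 40) only
      · obtain rfl | n_y_a := eq_or_ne y a
        · obtain ⟨_, n_w_c, n_y_c⟩ := L_ne h1
          obtain ⟨_, n_y_d, n_w_d⟩ := L_ne h2
          obtain ⟨n_c_d, _⟩ := h3.ne
          obtain ⟨_, _, n_c_x, _, n_d_x, _⟩ := h4.ne
          simp only [Cr, Opp, In] at *
          have := tri n_w_c n_c_d n_w_d; have := tri n_w_c n_c_x n_x_w.symm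
          have := tri n_w_c n_y_c.symm n_y_w.symm; have := tri n_w_d n_d_x n_x_w.symm
          have := tri n_w_d n_y_d.symm n_y_w.symm; have := tri n_x_w.symm n_x_a n_y_w.symm
          have := tri n_c_d n_d_x n_c_x; have := tri n_c_d n_y_d.symm n_y_c.symm
          have := tri n_c_x n_x_a n_y_c.symm; have := tri n_d_x n_x_a n_y_d.symm
          have := @inter V _ c y x d; have := @inter V _ d y w c
          by_cases q10 : L w c d
          · by_cases q12 : L c x y
            · grind (splits := 40) only
            · by_cases q14 : L w c x
              · grind (splits := 40) only
              · grind (splits := 40) only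
          · grind (splits := 40) only
        · obtain ⟨n_a_w, n_w_c, n_a_c⟩ := L_ne h1
          obtain ⟨_, n_a_d, n_w_d⟩ := L_ne h2
          obtain ⟨n_c_d, _⟩ := h3.ne
          obtain ⟨_, n_x_y, n_c_x, n_c_y, n_d_x, n_d_y⟩ := h4.ne
          simp only [Cr, Opp, In] at *
          have := tri n_a_w.symm n_a_c n_w_c; have := tri n_a_w.symm n_a_d n_w_d
          have := tri n_a_w.symm n_x_a.symm n_x_w.symm
          have := tri n_a_w.symm n_y_a.symm n_y_w.symm; have := tri n_w_c n_c_d n_w_d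
          have := tri n_w_c n_c_x n_x_w.symm; have := tri n_w_c n_c_y n_y_w.symm
          have := tri n_w_d n_d_x n_x_w.symm; have := tri n_w_d n_d_y n_y_w.symm
          have := tri n_x_w.symm n_x_y n_y_w.symm; have := tri n_a_c n_c_d n_a_d
          have := tri n_a_c n_c_x n_x_a.symm; have := tri n_a_c n_c_y n_y_a.symm
          have := tri n_a_d n_d_x n_x_a.symm; have := tri n_a_d n_d_y n_y_a.symm
          have := tri n_x_a.symm n_x_y n_y_a.symm; have := tri n_c_d n_d_x n_c_x
          have := tri n_c_d n_d_y n_c_y; have := tri n_c_x n_x_y n_c_y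
          have := tri n_d_x n_x_y n_d_y; have := @trans V _ y d x c w
          have := @trans V _ a w x y c; have := @trans V _ x d a y c
          have := @trans' V _ y w d c a; have := @trans' V _ d y c a x
          have := @trans V _ c x y a d; have := @trans' V _ y c a d x
          have := @trans' V _ x d y a c; have := @trans V _ d x y w a
          have := @trans V _ c a d w x; have := @trans' V _ y w a x c
          have := @trans' V _ x a y w c; have := @trans' V _ d a c x w
          have := @trans' V _ d x y c a; have := @trans V _ y w a d c
          have := @inter V _ d x y c; have := @inter V _ c w d y; have := @inter V _ a x c d
          have := @inter V _ c x y d; have := @inter V _ a d c w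
          by_cases q10 : L w c d
          · by_cases q12 : L c x y
            · by_cases q14 : L c d x
              · grind (splits := 40) only
              · by_cases q16 : L a d x
                · by_cases q18 : L w c x
                  · grind (splits := 40) only
                  · grind (splits := 40) only
                · grind (splits := 40) only
            · by_cases q14 : L c d x
              · by_cases q16 : L w x y
                · by_cases q18 : L w c x
                  · by_cases q20 : L a c x
                    · grind (splits := 40) only
                    · by_cases q22 : L a d x
                      · grind (splits := 40) only
                      · grind (splits := 40) only
                  · grind (splits := 40) only
                · by_cases q18 : L a x y
                  · by_cases q20 : L a c x
                    · grind (splits := 40) only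
                    · by_cases q22 : L w c y
                      · by_cases q24 : L w d x
                        · grind (splits := 40) only
                        · grind (splits := 40) only
                      · grind (splits := 40) only
                  · by_cases q20 : L a d x
                    · by_cases q22 : L w a y
                      · grind (splits := 40) only
                      · grind (splits := 40) only
                    · grind (splits := 40) only
              · grind (splits := 40) only
          · grind (splits := 40) only

theorem not_In_of_last {O w a c d : V} (h1 : L O a w) (h2 : L O c w) (h3 : L O d w)
    (h4 : In w d c a) :
    False := by
  obtain ⟨n_O_a, n_a_w, n_O_w⟩ := L_ne h1
  obtain ⟨n_O_c, n_c_w, _⟩ := L_ne h2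
  obtain ⟨n_O_d, n_d_w, _⟩ := L_ne h3
  obtain ⟨_, _, _, n_d_c, n_c_a, n_d_a⟩ := h4.ne
  simp only [In] at *
  have := tri n_O_w n_a_w.symm n_O_a; have := tri n_O_w n_c_w.symm n_O_c
  have := tri n_O_w n_d_w.symm n_O_d; have := tri n_a_w.symm n_c_a.symm n_c_w.symm
  have := tri n_a_w.symm n_d_a.symm n_d_w.symm; have := tri n_c_w.symm n_d_c.symm n_d_w.symm
  have := @trans V _ w O d c a
  grind (splits := 40) only

theorem not_In_of_last_corner {O w c d : V} (h1 : L O c w) (h2 : L O d w) (h3 : In w d c O) :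
    False := by
  obtain ⟨n_O_c, n_c_w, n_O_w⟩ := L_ne h1
  obtain ⟨n_O_d, n_d_w, _⟩ := L_ne h2
  obtain ⟨_, _, _, n_d_c, _⟩ := h3.ne
  simp only [In] at *
  have := tri n_O_w n_c_w.symm n_O_c; have := tri n_O_w n_d_w.symm n_O_d
  have := tri n_c_w.symm n_d_c.symm n_d_w.symm
  grind (splits := 40) only

/-- The position of `u` in the angular order of `t` around the hull vertex `A`, where `A` itself
comes first. -/
def rk (t : Finset V) (A u : V) : ℕ := (t.filter fun x => x ≠ u ∧ (x = A ∨ L A x u)).card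

theorem Hull.rk_lt {t : Finset V} {A B C : V} (h : Hull t A B C) {u v : V} (hu : u ∈ t)
    (hv : v ∈ t) : rk t A u < rk t A v ↔ v ≠ A ∧ (u = A ∨ L A u v) := by
  have hB : ∀ x ∈ t, x ≠ A → x = B ∨ L A B x := by
    intro x hx h1
    rcases h.inside x hx with rfl | rfl | rfl | h3
    exacts [(h1 rfl).elim, .inl rfl, .inr h.left, .inr h3.1]
  have key : ∀ {u v : V}, u ∈ t → v ∈ t → v ≠ A → (u = A ∨ L A u v) → rk t A u < rk t A v := by
    intro u v hu hv hvA huv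
    have huv' : u ≠ v := by
      rcases huv with h1 | h1
      exacts [h1 ▸ hvA.symm, (L_ne h1).2.1]
    refine Finset.card_lt_card (Finset.ssubset_iff_of_subset ?_ |>.2 ⟨u, by simp [hu, huv', huv],
      by simp⟩)
    intro x hx
    simp only [Finset.mem_filter] at hx ⊢
    obtain ⟨hxt, hxu, hx⟩ := hx
    refine ⟨hxt, ?_⟩
    rcases hx with rfl | hx
    · exact ⟨hvA.symm, .inl rfl⟩
    rcases huv with rfl | huv
    · simp at hx
    suffices hl : L A x v from ⟨(L_ne hl).2.1, .inr hl⟩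
    have n1 := (L_ne hx).1.symm
    have n2 := (L_ne hx).2.2.symm
    rcases hB u hu n2 with rfl | h1
    · rcases hB x hxt n1 with rfl | h2
      · exact huv
      · exact (asymm (rot h2) (rot (rot (rot (rot hx))))).elim
    rcases hB v hv hvA with rfl | h2
    · exact (asymm (rot h1) (rot (rot (rot (rot huv))))).elim
    rcases hB x hxt n1 with rfl | h3
    · exact h2
    · exact trans h3 h1 h2 hx huv
  refine ⟨fun hlt => ?_, fun ⟨h1, h2⟩ => key hu hv h1 h2⟩
  have huv : u ≠ v := by rintro rfl; exact lt_irrefl _ hlt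
  by_contra hn
  refine absurd hlt (not_lt.2 (le_of_lt (key hv hu ?_ ?_)))
  · rintro rfl
    exact hn ⟨huv.symm, .inl rfl⟩
  · by_cases hvA : v = A
    · exact .inl hvA
    · right
      have : u ≠ A ∧ ¬ L A u v := by tauto
      have := total (Ne.symm this.1) huv (Ne.symm hvA)
      have := @rot V _
      grind

theorem Hull.rk_ne {t : Finset V} {A B C : V} (h : Hull t A B C) {u v : V} (hu : u ∈ t)
    (hv : v ∈ t) (huv : u ≠ v) : rk t A u ≠ rk t A v := by
  intro he
  have h1 := (h.rk_lt hu hv).not.1 he.not_lt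
  have h2 := (h.rk_lt hv hu).not.1 he.not_gt
  have h3 : u ≠ A ∧ v ≠ A ∧ ¬ L A u v ∧ ¬ L A v u := by grind
  have := total (Ne.symm h3.1) huv (Ne.symm h3.2.1)
  have := @rot V _
  grind

theorem exists_flip {t : Finset V} {T : Finset (Sym2 V)} {A B C u v w : V} (h : Hull t A B C)
    (hT : Tri t T) (hu : u ∈ t) (hv : v ∈ t) (hl : L u v w)
    (hw : ∃ a, s(w, a) ∈ T ∧ Cr u v w a)
    (hmax : ∀ x y, s(x, y) ∈ T → Cr u v x y → x = w ∨ rk t A x < rk t A w)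
    (hru : rk t A u < rk t A w) (hrv : rk t A v < rk t A w) :
    ∃ a c d, s(w, a) ∈ T ∧ Cr u v w a ∧ c ∈ t ∧ d ∈ t ∧ Cr c d w a ∧
      Vis (T.erase s(w, a)) c d ∧ rk t A c < rk t A w ∧ rk t A d < rk t A w := by
  obtain ⟨a, ha, hlast⟩ := exists_first_right (F := t.filter fun a => s(w, a) ∈ T ∧ Cr u v w a)
    (x := u) (a := v) (by
      obtain ⟨a, ha, hc⟩ := hw
      exact ⟨a, by simp [hT.mem' ha, ha, hc]⟩) fun a ha =>
        rot (rot (side_of_cross hl (Finset.mem_filter.1 ha).2.2).2.2)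
  simp only [Finset.mem_filter] at ha hlast
  obtain ⟨hat, hwa, hcr⟩ := ha
  have hwt := hT.mem hwa
  obtain ⟨hlv, hlu, hla⟩ := side_of_cross hl hcr
  obtain ⟨c, hc, hfc⟩ := exists_face hT (Sym2.eq_swap ▸ hwa) hu hlu
  obtain ⟨d, hd, hfd⟩ := exists_face hT hwa hv hlv
  have hcrs : ∀ {x}, x ≠ a → s(w, x) ∈ T → Cr u v w x → L u a x := fun {x} hx h1 h2 =>
    hlast x ⟨hT.mem' h1, h1, h2⟩ hx
  have hcC : c = u ∨ (Cr u v w c ∧ L u a c) ∨ Cr u v a c := by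
    by_cases hcu : c = u
    · exact .inl hcu
    right
    rcases pasch hcr hfc.left (Ne.symm hcu) (fun e => asymm hlv (e ▸ hfc.left)) (hfc.empty u hu)
      (hfc.empty v hv) with h1 | h1
    exacts [.inl ⟨h1, hcrs (L_ne hfc.left).2.2.symm hfc.bc h1⟩, .inr h1]
  have hdD : d = v ∨ (Cr u v w d ∧ L u a d) ∨ Cr u v a d := by
    by_cases hdv : d = v
    · exact .inl hdv
    right
    rcases pasch hcr.swap_right hfd.left (fun e => asymm hlu (e ▸ hfd.left)) (Ne.symm hdv)
      (hfd.empty u hu) (hfd.empty v hv) with h1 | h1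
    exacts [.inr h1, .inl ⟨h1, hcrs (L_ne hfd.left).2.1.symm (Sym2.eq_swap ▸ hfd.ca) h1⟩]
  have hra : rk t A a < rk t A w :=
    (hmax a w (Sym2.eq_swap ▸ hwa) hcr.swap_right).resolve_left (L_ne hlv).1.symm
  have hrc : rk t A c < rk t A w := by
    rcases hcC with rfl | h1 | h1
    · exact hru
    · exact (hmax c w (Sym2.eq_swap ▸ hfc.bc) h1.1.swap_right).resolve_left (L_ne hfc.left).2.1.symm
    · exact (hmax c a hfc.ca h1.swap_right).resolve_left (L_ne hfc.left).2.1.symm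
  have hrd : rk t A d < rk t A w := by
    rcases hdD with rfl | h1 | h1
    · exact hrv
    · exact (hmax d w hfd.ca h1.1.swap_right).resolve_left (L_ne hfd.left).2.2.symm
    · exact (hmax d a (Sym2.eq_swap ▸ hfd.bc) h1.swap_right).resolve_left (L_ne hfd.left).2.2.symm
  have hin : ¬ In a c d w := by
    intro hin
    rcases hcC with rfl | h1 | h1 <;> rcases hdD with rfl | h2 | h2
    · exact asymm (rot hin.1) (rot hla)
    · exact not_In_flip_u_w hl hcr hfd.left h2.1 h2.2 hin
    · exact not_In_flip_u_a hl hcr hfd.left h2 hin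
    · exact not_In_flip_w_v hl hcr hfc.left hfd.left h1.1 h1.2 hin
    · exact not_In_flip_w_w hl hcr hfc.left hfd.left h1.1 h1.2 h2.1 h2.2 hin
    · exact not_In_flip_w_a hl hcr hfc.left hfd.left h1.1 h1.2 h2 hin
    · exact not_In_flip_a_v hl hcr hfc.left h1 hin
    · exact not_In_flip_a_w hl hcr hfc.left hfd.left h1 h2.1 h2.2 hin
    · exact not_In_flip_a_a hl hcr hfc.left hfd.left h1 h2 hin
  have hin' : ¬ In w d c a := by
    have h1 := ((h.rk_lt hat hwt).1 hra).2
    have h2 := ((h.rk_lt hc hwt).1 hrc).2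
    have h3 := ((h.rk_lt hd hwt).1 hrd).2
    have n1 := (L_ne hfc.left).2.2
    have n2 := (L_ne hfd.left).2.1
    intro hi
    have n3 := hi.ne.2.2.2.1
    by_cases ea : a = A
    · subst ea
      exact not_In_of_last_corner (h2.resolve_left n1.symm) (h3.resolve_left n2.symm) hi
    by_cases ec : c = A
    · subst ec
      exact not_In_of_last_corner (h3.resolve_left n3) (h1.resolve_left n1)
        ⟨hi.2.2, hi.1, hi.2.1⟩
    by_cases ed : d = A
    · subst ed
      exact not_In_of_last_corner (h1.resolve_left n2) (h2.resolve_left n3.symm)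
        ⟨hi.2.1, hi.2.2, hi.1⟩
    exact not_In_of_last (h1.resolve_left ea) (h2.resolve_left ec) (h3.resolve_left ed) hi
  have hcd := cross_of_flip hfc.left hfd.left hin hin'
  refine ⟨a, c, d, hwa, hcr, hc, hd, hcd, fun x y hxy hx => ?_, hrc, hrd⟩
  obtain ⟨hne, hxy⟩ := Finset.mem_erase.1 hxy
  refine hne ?_
  have h1 := hT.mem hxy
  have h2 := hT.mem' hxy
  rcases unique_cross_flip hfc.left hfd.left hcd hx (hT.noX hfc.ab hxy) (hT.noX hfc.bc hxy)
    (hT.noX hfc.ca hxy) (hT.noX hfd.bc hxy) (hT.noX hfd.ca hxy) (hfc.empty x h1) (hfc.empty y h2)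
    (hfd.empty x h1) (hfd.empty y h2) with ⟨rfl, rfl⟩ | ⟨rfl, rfl⟩
  exacts [Sym2.eq_swap, rfl]

/-- The larger of the two ranks of the endpoints of an edge. -/
def kap (t : Finset V) (A : V) (e : Sym2 V) : ℕ := (t.filter (· ∈ e)).sup (rk t A)

theorem kap_mk {t : Finset V} {A a b : V} (ha : a ∈ t) (hb : b ∈ t) :
    kap t A s(a, b) = max (rk t A a) (rk t A b) := by
  have : t.filter (· ∈ s(a, b)) = {a, b} := by
    ext x
    simp only [Finset.mem_filter, Sym2.mem_iff, Finset.mem_insert, Finset.mem_singleton]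
    constructor
    · exact fun h => h.2
    · rintro (rfl | rfl) <;> simp [*]
  rw [kap, this]
  simp

theorem Hull.kap_ne {t : Finset V} {A B C : V} (h : Hull t A B C) {a b c d : V} (ha : a ∈ t)
    (hb : b ∈ t) (hc : c ∈ t) (hd : d ∈ t) (hcr : Cr a b c d) :
    kap t A s(a, b) ≠ kap t A s(c, d) := by
  rw [kap_mk ha hb, kap_mk hc hd]
  have n := hcr.ne
  have := h.rk_ne ha hc n.2.2.1
  have := h.rk_ne ha hd n.2.2.2.1
  have := h.rk_ne hb hc n.2.2.2.2.1
  have := h.rk_ne hb hd n.2.2.2.2.2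
  omega

/-- Every missing edge is blocked by an edge of `H` or by an edge of `T` of smaller rank. -/
def Greedy (t : Finset V) (A : V) (H T : Finset (Sym2 V)) : Prop :=
  ∀ u ∈ t, ∀ v ∈ t, u ≠ v → s(u, v) ∉ T →
    ∃ e ∈ T, X e s(u, v) ∧ (e ∈ H ∨ kap t A e < kap t A s(u, v))

/-- The edges of `T` whose flip does not decrease the rank. -/
def locked (t : Finset V) (A : V) (T : Finset (Sym2 V)) : Finset (Sym2 V) :=
  T.filter fun e => ∀ u ∈ t, ∀ v ∈ t, X e s(u, v) → Vis (T.erase e) u v →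
    kap t A e < kap t A s(u, v)

theorem Greedy.sdiff_subset_locked {t : Finset V} {T H : Finset (Sym2 V)} {A : V}
    (hT : Plane t T) (hG : Greedy t A H T) : T \ H ⊆ locked t A T := by
  intro e he
  obtain ⟨heT, heH⟩ := Finset.mem_sdiff.1 he
  refine Finset.mem_filter.2 ⟨heT, fun u hu v hv hX hvis => ?_⟩
  induction e with | _ a b =>
  have hX' := X_mk.1 hX
  obtain ⟨f, hf, hfX, hfk⟩ := hG u hu v hv hX'.ne.2.1 fun h => hT.noX heT h hX'
  induction f with | _ x y =>
  by_cases hef : s(x, y) = s(a, b)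
  · rw [hef] at hfk
    exact hfk.resolve_left heH
  · exact (hvis x y (Finset.mem_erase.2 ⟨hef, hf⟩) (X_mk.1 hfX).symm).elim

theorem greedy_of_subset_locked {t : Finset V} {T D : Finset (Sym2 V)} {A B C : V}
    (h : Hull t A B C) (hT : Tri t T) (hD : D ⊆ locked t A T) : Greedy t A (T \ D) T := by
  intro u hu v hv huv hn
  by_contra! hcon
  have hex : ∃ x y, s(x, y) ∈ T ∧ Cr u v x y := by
    by_contra! hno
    exact hn (hT.max hu hv huv hno)
  obtain ⟨x, y, hxy, hcr⟩ := hex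
  obtain ⟨w, hw, hmax⟩ := (t.filter fun w => ∃ a, s(w, a) ∈ T ∧ Cr u v w a).exists_max_image
    (rk t A) ⟨x, Finset.mem_filter.2 ⟨hT.mem hxy, y, hxy, hcr⟩⟩
  clear hxy hcr x y
  have hmax' : ∀ x y, s(x, y) ∈ T → Cr u v x y → rk t A x ≤ rk t A w := fun x y h1 h2 =>
    hmax x (Finset.mem_filter.2 ⟨hT.mem h1, y, h1, h2⟩)
  obtain ⟨hwt, b, hwb, hcb⟩ := Finset.mem_filter.1 hw
  have hlt : rk t A u < rk t A w ∧ rk t A v < rk t A w := by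
    have h1 := (hcon _ hwb (X_mk.2 hcb.symm)).2
    have h2 := hmax' b w (Sym2.eq_swap ▸ hwb) hcb.swap_right
    rw [kap_mk hu hv, kap_mk hwt (hT.mem' hwb)] at h1
    have h3 := h.rk_ne hu hwt hcb.ne.2.2.1
    have h4 := h.rk_ne hv hwt hcb.ne.2.2.2.2.1
    omega
  have key : ∀ {u v : V}, u ∈ t → v ∈ t → L u v w → Cr u v w b →
      (∀ x y, s(x, y) ∈ T → Cr u v x y → rk t A x ≤ rk t A w) →
      (∀ x y, s(x, y) ∈ T → Cr u v x y → s(x, y) ∈ D) →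
      rk t A u < rk t A w → rk t A v < rk t A w → False := by
    intro u v hu hv hl hcb hmax hcon h1 h2
    obtain ⟨a, c, d, hwa, hcr, hc, hd, hcd, hvis, hrc, hrd⟩ := exists_flip h hT hu hv hl
      ⟨b, hwb, hcb⟩ (fun x y h1 h2 => or_iff_not_imp_left.2 fun h3 =>
        lt_of_le_of_ne (hmax x y h1 h2) (h.rk_ne (hT.mem h1) hwt h3)) h1 h2
    have := (Finset.mem_filter.1 (hD (hcon w a hwa hcr))).2 c hc d hd (X_mk.2 hcd.symm) hvis
    rw [kap_mk hwt (hT.mem' hwa), kap_mk hc hd] at this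
    omega
  have hcon' : ∀ x y, s(x, y) ∈ T → Cr u v x y → s(x, y) ∈ D := by
    intro x y h1 h2
    have := (hcon _ h1 (X_mk.2 h2.symm)).1
    by_contra h3
    exact this (Finset.mem_sdiff.2 ⟨h1, h3⟩)
  rcases total huv hcb.ne.2.2.2.2.1 hcb.ne.2.2.1 with h1 | h1
  · exact key hu hv h1 hcb hmax' hcon' hlt.1 hlt.2
  · exact key hv hu h1 hcb.swap_left (fun x y h1 h2 => hmax' x y h1 h2.swap_left)
      (fun x y h1 h2 => hcon' x y h1 h2.swap_left) hlt.2 hlt.1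

theorem Greedy.unique {t : Finset V} {T T' H : Finset (Sym2 V)} {A : V} (hT : Plane t T)
    (hH : H ⊆ T) (hT' : Plane t T') (hG' : Greedy t A H T') (hG : Greedy t A H T)
    (hH' : H ⊆ T') : T = T' := by
  have key : ∀ n, ∀ u v, kap t A s(u, v) < n → (s(u, v) ∈ T ↔ s(u, v) ∈ T') := by
    have half : ∀ {T T' : Finset (Sym2 V)}, Plane t T → H ⊆ T → Greedy t A H T' → ∀ u v,
        (∀ x y, kap t A s(x, y) < kap t A s(u, v) → s(x, y) ∈ T' → s(x, y) ∈ T) →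
        s(u, v) ∈ T → s(u, v) ∈ T' := by
      intro T T' hT hH hG u v ih hm
      by_contra hn
      obtain ⟨e, he, hX, hk⟩ := hG u (hT.mem hm) v (hT.mem' hm) (hT.ne hm) hn
      induction e with | _ x y =>
      refine hT.noX ?_ hm (X_mk.1 hX)
      exact hk.elim (fun h => hH h) fun h => ih x y h he
    intro n
    induction n with
    | zero => intro u v h; omega
    | succ n ih =>
      intro u v h
      exact ⟨half hT hH hG' u v fun x y h1 => (ih x y (by omega)).2,
        half hT' hH' hG u v fun x y h1 => (ih x y (by omega)).1⟩
  ext e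
  induction e with | _ x y => exact key _ x y (Nat.lt_succ_self _)

theorem exists_greedy {t : Finset V} {H : Finset (Sym2 V)} {A B C : V} (h : Hull t A B C)
    (hH : Plane t H) : ∃ T, Tri t T ∧ H ⊆ T ∧ Greedy t A H T := by
  have stage : ∀ n, ∃ G, Plane t G ∧ H ⊆ G ∧ (∀ e ∈ G, e ∈ H ∨ kap t A e < n) ∧
      ∀ u ∈ t, ∀ v ∈ t, u ≠ v → kap t A s(u, v) < n → s(u, v) ∉ G →
        ∃ e ∈ G, X e s(u, v) ∧ (e ∈ H ∨ kap t A e < kap t A s(u, v)) := by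
    intro n
    induction n with
    | zero => exact ⟨H, hH, subset_rfl, fun e he => .inl he, fun _ _ _ _ _ h => by omega⟩
    | succ n ih =>
      obtain ⟨G, hG, hHG, hk, hb⟩ := ih
      set F := t.sym2.filter fun e => kap t A e = n ∧ ¬ e.IsDiag ∧ ∀ f ∈ G, ¬ X f e with hF
      have hFm : ∀ {a b}, s(a, b) ∈ F ↔ (a ∈ t ∧ b ∈ t) ∧ kap t A s(a, b) = n ∧ a ≠ b ∧
          ∀ f ∈ G, ¬ X f s(a, b) := by
        intro a b
        simp [hF]
      refine ⟨G ∪ F, ⟨fun {a b} h1 => ?_, fun {a b} h1 => ?_, fun {a b c d} h1 h2 hc => ?_⟩,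
        hHG.trans Finset.subset_union_left, fun e he => ?_, fun u hu v hv huv hlt hn => ?_⟩
      · rcases Finset.mem_union.1 h1 with h1 | h1
        exacts [hG.mem h1, (hFm.1 h1).1.1]
      · rcases Finset.mem_union.1 h1 with h1 | h1
        exacts [hG.ne h1, (hFm.1 h1).2.2.1]
      · rcases Finset.mem_union.1 h1 with h1 | h1 <;> rcases Finset.mem_union.1 h2 with h2 | h2
        · exact hG.noX h1 h2 hc
        · exact (hFm.1 h2).2.2.2 _ h1 (X_mk.2 hc)
        · exact (hFm.1 h1).2.2.2 _ h2 (X_mk.2 hc.symm)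
        · have h3 := hFm.1 h1
          have h4 := hFm.1 h2
          exact h.kap_ne h3.1.1 h3.1.2 h4.1.1 h4.1.2 hc (h3.2.1.trans h4.2.1.symm)
      · rcases Finset.mem_union.1 he with he | he
        · exact (hk e he).imp_right fun h => by omega
        · have := (Finset.mem_filter.1 he).2.1
          exact .inr (by omega)
      · rw [Finset.mem_union, not_or] at hn
        by_cases hlt' : kap t A s(u, v) < n
        · obtain ⟨e, he, h1⟩ := hb u hu v hv huv hlt' hn.1
          exact ⟨e, Finset.mem_union_left _ he, h1⟩
        · have hn2 := hn.2
          rw [hFm] at hn2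
          have : ∃ f ∈ G, X f s(u, v) := by
            by_contra! hno
            exact hn2 ⟨⟨hu, hv⟩, by omega, huv, hno⟩
          obtain ⟨f, hf, hX⟩ := this
          exact ⟨f, Finset.mem_union_left _ hf, hX, (hk f hf).imp_right fun h => by omega⟩
  obtain ⟨T, hT, hHT, -, hb⟩ := stage (t.sup (rk t A) + 1)
  have hG : Greedy t A H T := fun u hu v hv huv hn => by
    refine hb u hu v hv huv ?_ hn
    rw [kap_mk hu hv]
    have h1 := Finset.le_sup (f := rk t A) hu
    have h2 := Finset.le_sup (f := rk t A) hv
    omega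
  refine ⟨T, ⟨hT, fun {a b} ha hb hab hv => ?_⟩, hHT, hG⟩
  by_contra hn
  obtain ⟨e, he, hX, -⟩ := hG a ha b hb hab hn
  induction e with | _ x y => exact hv x y he (X_mk.1 hX).symm

/-- The maximal plane graphs on `s`. -/
def tris (s : Finset V) : Finset (Finset (Sym2 V)) := s.sym2.powerset.filter (Tri s)

theorem mem_tris {s : Finset V} {T : Finset (Sym2 V)} : T ∈ tris s ↔ Tri s T := by
  simp only [tris, Finset.mem_filter, Finset.mem_powerset, and_iff_right_iff_imp]
  intro hT e he
  induction e with | _ a b => exact Finset.mk_mem_sym2_iff.2 ⟨hT.mem he, hT.mem' he⟩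

/-- The tight sets of edges of `T` all of whose edges are locked. -/
def tights (t : Finset V) (A : V) (T : Finset (Sym2 V)) (p : V) : Finset (Finset (Sym2 V)) :=
  (locked t A T).powerset.filter (Tight t T p)

theorem sum_tris_insert {t : Finset V} {A B C p : V} (h : Hull t A B C) (hpi : In p A B C)
    (hpt : p ∉ t) (f : ℕ → ℤ) :
    ∑ T' ∈ tris (insert p t), f (T'.filter fun e => p ∈ e).card =
      ∑ T ∈ tris t, ∑ D ∈ tights t A T p, f (D.card + 3) := by
  have hne : t.Nonempty := ⟨A, h.A_mem⟩
  have hp := h.inside_of_In hpi hpt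
  rw [Finset.sum_sigma']
  symm
  have hmem : ∀ x : (_ : Finset (Sym2 V)) × Finset (Sym2 V),
      x ∈ (tris t).sigma (fun T => tights t A T p) ↔
        Tri t x.1 ∧ x.2 ⊆ locked t A x.1 ∧ Tight t x.1 p x.2 := by
    intro x
    simp only [Finset.mem_sigma, mem_tris, tights, Finset.mem_filter, Finset.mem_powerset]
  refine Finset.sum_bij (fun x _ => glue t x.1 p x.2) ?_ ?_ ?_ ?_
  · rintro ⟨T, D⟩ hx
    obtain ⟨hT, -, hD⟩ := (hmem _).1 hx
    exact mem_tris.2 (hD.glue h hpi hpt hT)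
  · rintro ⟨T, D⟩ hx ⟨T₁, D₁⟩ hx₁ he
    obtain ⟨hT, hl, hD⟩ := (hmem _).1 hx
    obtain ⟨hT₁, hl₁, hD₁⟩ := (hmem _).1 hx₁
    dsimp only at *
    have h1 : T \ D = T₁ \ D₁ := by
      rw [← away_glue hT.toPlane hpt, ← away_glue hT₁.toPlane hpt, he]
    have h2 : T = T₁ := by
      have g1 := greedy_of_subset_locked h hT hl
      have g2 := greedy_of_subset_locked h hT₁ hl₁
      rw [← h1] at g2
      exact Greedy.unique hT.toPlane Finset.sdiff_subset hT₁.toPlane g2 g1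
        (h1 ▸ Finset.sdiff_subset)
    subst h2
    rw [← Finset.sdiff_sdiff_eq_self hD.1, ← Finset.sdiff_sdiff_eq_self hD₁.1, h1]
  · intro T' hT'
    rw [mem_tris] at hT'
    obtain ⟨T, hT, hsub, hG⟩ := exists_greedy h hT'.toPlane.away
    refine ⟨⟨T, T \ away T' p⟩, (hmem _).2 ⟨hT, hG.sdiff_subset_locked hT.toPlane,
      tight_sdiff hp hT' hT hsub⟩, ?_⟩
    simp only [glue]
    rw [← hT'.star_eq hpt hsub, Finset.sdiff_sdiff_eq_self hsub, away, Finset.union_comm,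
      Finset.filter_union_filter_not_eq]
  · rintro ⟨T, D⟩ hx
    obtain ⟨hT, -, hD⟩ := (hmem _).1 hx
    dsimp only at *
    have e := away_glue (D := D) hT.toPlane hpt
    rw [(hD.glue h hpi hpt hT).card_star hp hne hT (e ▸ Finset.sdiff_subset), e,
      Finset.sdiff_sdiff_eq_self hD.1]

open Polynomial in
/-- Generating polynomials of the closed subsets of a binary tree. -/
inductive Feas : ℤ[X] → Prop
  | one : Feas 1
  | node {g h : ℤ[X]} : Feas g → Feas h → Feas (1 + Polynomial.X * g * h)

/-- The sets `D ⊆ U` such that the slot of each element of `D` belongs to `S` or to a member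
of `D`. -/
def closedSets {E R : Type*} (U : Finset E) (sl : E → R ⊕ E × Bool) (S : Finset (R ⊕ E × Bool)) :
    Finset (Finset E) :=
  U.powerset.filter fun D => ∀ e ∈ D, sl e ∈ S ∨ ∃ e' ∈ D, ∃ b, sl e = .inr (e', b)

theorem mem_closedSets {E R : Type*} {U : Finset E} {sl : E → R ⊕ E × Bool}
    {S : Finset (R ⊕ E × Bool)} {D : Finset E} : D ∈ closedSets U sl S ↔
      D ⊆ U ∧ ∀ e ∈ D, sl e ∈ S ∨ ∃ e' ∈ D, ∃ b, sl e = .inr (e', b) := by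
  simp [closedSets]

open Polynomial in
theorem exists_feas {E R : Type*} (sl : E → R ⊕ E × Bool) (μ : E → ℕ)
    (hμ : ∀ e e' b, sl e = .inr (e', b) → μ e < μ e') (U : Finset E)
    (hinj : Set.InjOn sl U) :
    ∃ g : R ⊕ E × Bool → ℤ[X], (∀ s, Feas (g s)) ∧
      ∀ S : Finset (R ⊕ E × Bool), (∀ e ∈ U, ∀ b, Sum.inr (e, b) ∉ S) →
        ∑ D ∈ closedSets U sl S, (Polynomial.X : ℤ[X]) ^ D.card = ∏ s ∈ S, g s := by
  induction U using Finset.strongInduction with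
  | H U ih =>
    rcases U.eq_empty_or_nonempty with rfl | hne
    · refine ⟨fun _ => 1, fun _ => .one, fun S _ => ?_⟩
      have : closedSets (∅ : Finset E) sl S = {∅} := by
        ext D
        simp only [mem_closedSets, Finset.subset_empty, Finset.mem_singleton, and_iff_left_iff_imp]
        rintro rfl
        simp
      simp [this]
    obtain ⟨e, he, hmax⟩ := U.exists_max_image μ hne
    obtain ⟨g, hg, hsum⟩ := ih (U.erase e) (Finset.erase_ssubset he)
      (hinj.mono (Finset.erase_subset e U))
    have hpar : ∀ e' ∈ U, ∀ b, sl e ≠ .inr (e', b) := fun e' h b h' =>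
      absurd (hμ _ _ _ h') (not_lt.2 (hmax e' h))
    refine ⟨Function.update g (sl e) (1 + Polynomial.X * g (.inr (e, false)) * g (.inr (e, true))),
      fun s => ?_, fun S hS => ?_⟩
    · by_cases hs : s = sl e
      · subst hs
        simpa using Feas.node (hg _) (hg _)
      · simpa [hs] using hg s
    have hS' : ∀ e' ∈ U.erase e, ∀ b, Sum.inr (e', b) ∉ S := fun e' h =>
      hS e' (Finset.mem_of_mem_erase h)
    have hout : (closedSets U sl S).filter (fun D => e ∉ D) =
        closedSets (U.erase e) sl (S.erase (sl e)) := by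
      ext D
      simp only [Finset.mem_filter, mem_closedSets]
      constructor
      · rintro ⟨⟨h1, h2⟩, h3⟩
        refine ⟨Finset.subset_erase.2 ⟨h1, h3⟩, fun x hx => (h2 x hx).imp_left fun h => ?_⟩
        refine Finset.mem_erase.2 ⟨fun h' => h3 ?_, h⟩
        exact hinj (h1 hx) he h' ▸ hx
      · rintro ⟨h1, h2⟩
        obtain ⟨h1, h3⟩ := Finset.subset_erase.1 h1
        exact ⟨⟨h1, fun x hx => (h2 x hx).imp_left Finset.mem_of_mem_erase⟩, h3⟩
    by_cases hs : sl e ∈ S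
    · have hin : ∑ D ∈ (closedSets U sl S).filter (fun D => e ∈ D), (Polynomial.X : ℤ[X]) ^ D.card =
          ∑ D ∈ closedSets (U.erase e) sl
            (insert (.inr (e, false)) (insert (.inr (e, true)) (S.erase (sl e)))),
              Polynomial.X * Polynomial.X ^ D.card := by
        symm
        refine Finset.sum_bij' (fun D _ => insert e D) (fun D _ => D.erase e) ?_ ?_ ?_ ?_ ?_
        · intro D hD
          simp only [Finset.mem_filter, mem_closedSets, Finset.mem_insert] at hD ⊢
          obtain ⟨h1, h2⟩ := hD
          refine ⟨⟨Finset.insert_subset he (h1.trans (Finset.erase_subset _ _)), ?_⟩, by simp⟩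
          rintro x (rfl | hx)
          · exact .inl hs
          rcases h2 x hx with (h | h | h) | ⟨e', h, b, h'⟩
          exacts [.inr ⟨e, .inl rfl, _, h⟩, .inr ⟨e, .inl rfl, _, h⟩,
            .inl (Finset.mem_of_mem_erase h), .inr ⟨e', .inr h, b, h'⟩]
        · intro D hD
          simp only [Finset.mem_filter, mem_closedSets, Finset.mem_insert] at hD ⊢
          obtain ⟨⟨h1, h2⟩, -⟩ := hD
          refine ⟨Finset.erase_subset_erase _ h1, fun x hx => ?_⟩
          obtain ⟨hxe, hx⟩ := Finset.mem_erase.1 hx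
          rcases h2 x hx with h | ⟨e', h, b, h'⟩
          · exact .inl (.inr (.inr (Finset.mem_erase.2 ⟨fun h => hxe (hinj (h1 hx) he h), h⟩)))
          by_cases hee : e' = e
          · subst hee
            cases b
            exacts [.inl (.inl h'), .inl (.inr (.inl h'))]
          · exact .inr ⟨e', Finset.mem_erase.2 ⟨hee, h⟩, b, h'⟩
        · intro D hD
          have := (Finset.subset_erase.1 (mem_closedSets.1 hD).1).2
          exact Finset.erase_insert this
        · intro D hD
          exact Finset.insert_erase (Finset.mem_filter.1 hD).2
        · intro D hD
          have := (Finset.subset_erase.1 (mem_closedSets.1 hD).1).2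
          rw [Finset.card_insert_of_notMem this, pow_succ']
      have hf := hS e he false
      have ht := hS e he true
      rw [← Finset.sum_filter_add_sum_filter_not _ (fun D => e ∈ D), hout, hin, ← Finset.mul_sum,
        hsum _ (fun e' h b h' => hS' e' h b (Finset.mem_of_mem_erase h')), hsum,
        Finset.prod_insert, Finset.prod_insert, ← Finset.mul_prod_erase S _ hs,
        Finset.prod_congr rfl fun x hx => Function.update_of_ne (Finset.ne_of_mem_erase hx) _ g]
      · simp only [Function.update_self]
        ring
      · exact fun h => ht (Finset.mem_of_mem_erase h)
      · simpa using fun _ => hf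
      · intro e' h b h'
        simp only [Finset.mem_insert, Sum.inr.injEq, Prod.mk.injEq] at h'
        rcases h' with h' | h' | h'
        exacts [Finset.ne_of_mem_erase h h'.1, Finset.ne_of_mem_erase h h'.1,
          hS' e' h b (Finset.mem_of_mem_erase h')]
    · have hnot : (closedSets U sl S).filter (fun D => e ∉ D) = closedSets U sl S := by
        refine Finset.filter_true_of_mem fun D hD heD => ?_
        obtain ⟨h1, h2⟩ := mem_closedSets.1 hD
        rcases h2 e heD with h | ⟨e', h, b, h'⟩
        exacts [hs h, hpar e' (h1 h) b h']
      rw [← hnot, hout, Finset.erase_eq_of_notMem hs, hsum S hS']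
      exact Finset.prod_congr rfl fun x hx =>
        (Function.update_of_ne (fun h => hs (by rwa [← h])) _ g).symm

open Polynomial in
theorem Feas.bounds {g : ℤ[X]} (h : Feas g) :
    1 ≤ g.eval 1 ∧ 0 ≤ (derivative g).eval 1 ∧
      5 * g.eval 1 ≤ 2 * (derivative g).eval 1 + 9 ∧
      7 * g.eval 1 ≤ 2 * (derivative g).eval 1 + 19 ∧
      4 * g.eval 1 ≤ (derivative g).eval 1 + 13 ∧
      5 * g.eval 1 ≤ (derivative g).eval 1 + 26 := by
  induction h with
  | one => simp
  | @node g h _ _ ihg ihh =>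
    have e : (derivative (1 + Polynomial.X * g * h)).eval 1 =
      g.eval 1 * h.eval 1 + (derivative g).eval 1 * h.eval 1 +
        g.eval 1 * (derivative h).eval 1 := by
      simp
      ring
    rw [e]
    simp only [eval_add, eval_one, eval_mul, eval_X, one_mul]
    generalize g.eval 1 = a at *
    generalize h.eval 1 = b at *
    generalize (derivative g).eval 1 = s at *
    generalize (derivative h).eval 1 = t at *
    obtain ⟨a1, s0, s1, s2, s3, s4⟩ := ihg
    obtain ⟨b1, t0, t1, t2, t3, t4⟩ := ihh
    have hab : 1 ≤ a * b := one_le_mul_of_one_le_of_one_le a1 b1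
    have hsb : 0 ≤ s * b := mul_nonneg s0 (by omega)
    have hat : 0 ≤ a * t := mul_nonneg (by omega) t0
    clear e
    by_cases ha : a ≤ 10
    · by_cases hb : b ≤ 10
      · interval_cases a <;> interval_cases b <;> omega
      obtain ⟨m, hm⟩ : ∃ m, m = max (max ((5 * a - 8) / 2) ((7 * a - 18) / 2)) (4 * a - 13) :=
        ⟨_, rfl⟩
      have hms : m * b ≤ s * b := mul_le_mul_of_nonneg_right (by omega) (by omega)
      generalize s * b = z at *
      interval_cases a <;> norm_num at hm <;> subst hm <;> omega
    by_cases hb : b ≤ 10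
    · obtain ⟨m, hm⟩ : ∃ m, m = max (max ((5 * b - 8) / 2) ((7 * b - 18) / 2)) (4 * b - 13) :=
        ⟨_, rfl⟩
      have hmt : a * m ≤ a * t := mul_le_mul_of_nonneg_left (by omega) (by omega)
      generalize a * t = z at *
      interval_cases b <;> norm_num at hm <;> subst hm <;> omega
    have h1 : 2 * a * b ≤ s * b := mul_le_mul_of_nonneg_right (by omega) (by omega)
    have h2 : a * (2 * b) ≤ a * t := mul_le_mul_of_nonneg_left (by omega) (by omega)
    refine ⟨?_, ?_, ?_, ?_, ?_, ?_⟩ <;> linarith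

theorem weight_le_of_lt : ∀ a < 30, ∀ b < 30, ∀ c < 30,
    let φ (u : ℕ) : ℕ := max (max ((5 * u - 8) / 2) ((7 * u - 18) / 2))
      (max (4 * u - 13) (5 * u - 26))
    41 * (a * b * c) ≤ 300 + 10 * (φ a * b * c + φ b * a * c + φ c * a * b) := by
  decide +kernel

theorem weight_le {a b c s t r : ℤ} (ha : 1 ≤ a ∧ 0 ≤ s ∧ 5 * a ≤ 2 * s + 9 ∧ 7 * a ≤ 2 * s + 19 ∧
    4 * a ≤ s + 13 ∧ 5 * a ≤ s + 26) (hb : 1 ≤ b ∧ 0 ≤ t ∧ 5 * b ≤ 2 * t + 9 ∧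
    7 * b ≤ 2 * t + 19 ∧ 4 * b ≤ t + 13 ∧ 5 * b ≤ t + 26) (hc : 1 ≤ c ∧ 0 ≤ r ∧
    5 * c ≤ 2 * r + 9 ∧ 7 * c ≤ 2 * r + 19 ∧ 4 * c ≤ r + 13 ∧ 5 * c ≤ r + 26) :
    41 * (a * b * c) ≤ 300 + 10 * (s * b * c + t * a * c + r * a * b) := by
  have ha0 : 0 ≤ a := by omega
  have hb0 : 0 ≤ b := by omega
  have hc0 : 0 ≤ c := by omega
  have hbc := mul_nonneg hb0 hc0
  have hac := mul_nonneg ha0 hc0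
  have hab := mul_nonneg ha0 hb0
  have hs := mul_nonneg ha.2.1 hbc
  have ht := mul_nonneg hb.2.1 hac
  have hr := mul_nonneg hc.2.1 hab
  by_cases h1 : 41 * a ≤ 10 * s
  · have := mul_le_mul_of_nonneg_right h1 hbc
    linarith
  by_cases h2 : 41 * b ≤ 10 * t
  · have := mul_le_mul_of_nonneg_right h2 hac
    linarith
  by_cases h3 : 41 * c ≤ 10 * r
  · have := mul_le_mul_of_nonneg_right h3 hab
    linarith
  lift a to ℕ using ha0
  lift b to ℕ using hb0
  lift c to ℕ using hc0
  have := weight_le_of_lt a (by omega) b (by omega) c (by omega)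
  obtain ⟨φ, hφ⟩ : ∃ φ : ℕ → ℕ, φ = fun u => max (max ((5 * u - 8) / 2) ((7 * u - 18) / 2))
    (max (4 * u - 13) (5 * u - 26)) := ⟨_, rfl⟩
  have key : 41 * (a * b * c) ≤ 300 + 10 * (φ a * b * c + φ b * a * c + φ c * a * b) := by
    subst hφ
    exact this
  have ka : (φ a : ℤ) ≤ s := by rw [hφ]; dsimp only; omega
  have kb : (φ b : ℤ) ≤ t := by rw [hφ]; dsimp only; omega
  have kc : (φ c : ℤ) ≤ r := by rw [hφ]; dsimp only; omega
  zify at key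
  have k1 := mul_le_mul_of_nonneg_right ka hbc
  have k2 := mul_le_mul_of_nonneg_right kb hac
  have k3 := mul_le_mul_of_nonneg_right kc hab
  linarith

open Polynomial in
theorem sum_closedSets_le {E R : Type*} (sl : E → R ⊕ E × Bool) (μ : E → ℕ)
    (hμ : ∀ e e' b, sl e = .inr (e', b) → μ e < μ e') (U : Finset E) (hinj : Set.InjOn sl U)
    {r₁ r₂ r₃ : R} (h₁₂ : r₁ ≠ r₂) (h₁₃ : r₁ ≠ r₃) (h₂₃ : r₂ ≠ r₃) :
    ∑ D ∈ closedSets U sl {.inl r₁, .inl r₂, .inl r₃}, (71 - 10 * (D.card + 3 : ℕ) : ℤ) ≤ 300 := by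
  obtain ⟨g, hg, hs⟩ := exists_feas sl μ hμ U hinj
  have h := hs {.inl r₁, .inl r₂, .inl r₃} (by simp)
  rw [Finset.prod_insert (by simp [h₁₂, h₁₃]), Finset.prod_insert (by simp [h₂₃]),
    Finset.prod_singleton] at h
  have h0 := congrArg (eval 1) h
  have h1 := congrArg (fun f => eval 1 (derivative f)) h
  simp only [eval_finsetSum, derivative_sum, derivative_X_pow, eval_mul, eval_pow, eval_X,
    one_pow, mul_one, derivative_mul, eval_add, eval_natCast, map_natCast] at h0 h1
  have := weight_le (hg (.inl r₁)).bounds (hg (.inl r₂)).bounds (hg (.inl r₃)).bounds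
  push_cast
  rw [Finset.sum_congr rfl fun D _ => show (71 - 10 * ((D.card : ℤ) + 3)) = 41 * 1 - 10 * D.card by
    ring, Finset.sum_sub_distrib, ← Finset.mul_sum, ← Finset.mul_sum, h0, h1]
  linarith

theorem slot_cases {p u v q z : V} (n_p_z : p ≠ z) (h1 : L p u v) (h2 : L p u q) (h3 : L p q v)
    (h4 : L v u q) (h5 : L u v z) :
    In p u v z ∨ (Cr p q u z ∧ L p u z) ∨ (Cr p q z v ∧ L p z v) := by
  obtain ⟨n_p_u, n_u_v, n_p_v⟩ := L_ne h1
  obtain ⟨_, n_u_q, n_p_q⟩ := L_ne h2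
  obtain ⟨_, n_q_v, _⟩ := L_ne h3
  obtain ⟨_, n_v_z, n_u_z⟩ := L_ne h5
  have n_q_z : q ≠ z := by rintro rfl; grind [Cr, Opp, In, asymm, rot, L_self_left, L_self_right]
  simp only [Cr, Opp, In] at *
  have := tri n_p_u n_u_v n_p_v; have := tri n_p_u n_u_q n_p_q; have := tri n_p_u n_u_z n_p_z
  have := tri n_p_v n_q_v.symm n_p_q; have := tri n_p_v n_v_z n_p_z
  have := tri n_p_q n_q_z n_p_z; have := tri n_u_v n_q_v.symm n_u_q
  have := tri n_u_v n_v_z n_u_z; have := tri n_u_q n_q_z n_u_z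
  have := tri n_q_v.symm n_q_z n_v_z; have := @trans' V _ u p q v z
  have := @trans V _ p u q v z; have := @trans V _ v p q z u; have := @trans' V _ p v q z u
  by_cases q2 : L p u z
  · grind (splits := 40) only
  · grind (splits := 40) only

theorem eq_of_cross_far {p a b q v w : V} (h1 : L p a b) (h2 : L p a q) (h3 : L p q b)
    (h4 : L b a q) (h5 : ¬ Cr a q v w) (h6 : ¬ Cr q b v w) (h7 : ¬ Cr p a v w)
    (h8 : ¬ Cr p b v w) (h9 : ¬ Cr a b v w) (h10 : ¬ In v p a b) (h11 : ¬ In w p a b)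
    (h12 : ¬ In v b a q) (h13 : ¬ In w b a q) (h14 : Cr p q v w) :
    (v = a ∧ w = b) ∨ (v = b ∧ w = a) := by
  obtain rfl | n_v_a := eq_or_ne v a
  · obtain rfl | n_w_b := eq_or_ne w b
    · obtain ⟨n_p_v, n_v_w, n_p_w⟩ := L_ne h1
      obtain ⟨_, n_v_q, n_p_q⟩ := L_ne h2
      obtain ⟨_, n_q_w, _⟩ := L_ne h3
      simp only [Cr, Opp, In] at *
      have := tri n_p_q n_v_q.symm n_p_v; have := tri n_p_q n_q_w n_p_w
      have := tri n_p_v n_v_w n_p_w; have := tri n_v_q.symm n_v_w n_q_w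
      grind (splits := 40) only
    · obtain ⟨n_p_v, n_v_b, n_p_b⟩ := L_ne h1
      obtain ⟨_, n_v_q, n_p_q⟩ := L_ne h2
      obtain ⟨_, n_q_b, _⟩ := L_ne h3
      obtain ⟨_, n_v_w, _, n_p_w, _, n_q_w⟩ := h14.ne
      simp only [Cr, Opp, In] at *
      have := tri n_p_b n_q_b.symm n_p_q; have := tri n_p_b n_v_b.symm n_p_v
      have := tri n_p_b n_w_b.symm n_p_w; have := tri n_p_q n_v_q.symm n_p_v
      have := tri n_p_q n_q_w n_p_w; have := tri n_p_v n_v_w n_p_w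
      have := tri n_q_b.symm n_v_q.symm n_v_b.symm; have := tri n_q_b.symm n_q_w n_w_b.symm
      have := tri n_v_b.symm n_v_w n_w_b.symm; have := tri n_v_q.symm n_v_w n_q_w
      have := @inter V _ q w v p
      by_cases q6 : L p v w
      · by_cases q8 : L p b w
        · grind (splits := 40) only
        · grind (splits := 40) only
      · grind (splits := 40) only
  · obtain rfl | n_v_b := eq_or_ne v b
    · obtain rfl | n_w_a := eq_or_ne w a
      · obtain ⟨n_p_w, _, n_p_v⟩ := L_ne h1
        obtain ⟨_, n_w_q, n_p_q⟩ := L_ne h2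
        obtain ⟨_, n_q_v, _⟩ := L_ne h3
        simp only [Cr, Opp, In] at *
        have := tri n_p_q n_q_v n_p_v; have := tri n_p_q n_w_q.symm n_p_w
        have := tri n_p_v n_v_a n_p_w; have := tri n_q_v n_v_a n_w_q.symm
        grind (splits := 40) only
      · obtain ⟨n_p_a, _, n_p_v⟩ := L_ne h1
        obtain ⟨_, n_a_q, n_p_q⟩ := L_ne h2
        obtain ⟨_, n_q_v, _⟩ := L_ne h3
        obtain ⟨_, n_v_w, _, n_p_w, _, n_q_w⟩ := h14.ne
        simp only [Cr, Opp, In] at *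
        have := tri n_p_a n_a_q n_p_q; have := tri n_p_a n_v_a.symm n_p_v
        have := tri n_p_a n_w_a.symm n_p_w; have := tri n_p_q n_q_v n_p_v
        have := tri n_p_q n_q_w n_p_w; have := tri n_p_v n_v_w n_p_w
        have := tri n_a_q n_q_v n_v_a.symm; have := tri n_a_q n_q_w n_w_a.symm
        have := tri n_v_a.symm n_v_w n_w_a.symm; have := tri n_q_v n_v_w n_q_w
        have := @inter V _ p q w v
        by_cases q8 : L p v w
        · grind (splits := 40) only
        · by_cases q10 : L p a w
          · grind (splits := 40) only
          · grind (splits := 40) only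
    · obtain rfl | n_w_a := eq_or_ne w a
      · obtain ⟨n_p_w, n_w_b, n_p_b⟩ := L_ne h1
        obtain ⟨_, n_w_q, n_p_q⟩ := L_ne h2
        obtain ⟨_, n_q_b, _⟩ := L_ne h3
        obtain ⟨_, _, n_p_v, _, n_q_v, _⟩ := h14.ne
        simp only [Cr, Opp, In] at *
        have := tri n_p_b n_q_b.symm n_p_q; have := tri n_p_b n_v_b.symm n_p_v
        have := tri n_p_b n_w_b.symm n_p_w; have := tri n_p_q n_q_v n_p_v
        have := tri n_p_q n_w_q.symm n_p_w; have := tri n_p_v n_v_a n_p_w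
        have := tri n_q_b.symm n_q_v n_v_b.symm; have := tri n_q_b.symm n_w_q.symm n_w_b.symm
        have := tri n_v_b.symm n_v_a n_w_b.symm; have := tri n_q_v n_v_a n_w_q.symm
        have := @inter V _ p q w v
        by_cases q8 : L p v w
        · grind (splits := 40) only
        · by_cases q10 : L p b v
          · grind (splits := 40) only
          · grind (splits := 40) only
      · obtain rfl | n_w_b := eq_or_ne w b
        · obtain ⟨n_p_a, _, n_p_w⟩ := L_ne h1
          obtain ⟨_, n_a_q, n_p_q⟩ := L_ne h2
          obtain ⟨_, n_q_w, _⟩ := L_ne h3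
          obtain ⟨_, _, n_p_v, _, n_q_v, _⟩ := h14.ne
          simp only [Cr, Opp, In] at *
          have := tri n_p_a n_a_q n_p_q; have := tri n_p_a n_v_a.symm n_p_v
          have := tri n_p_a n_w_a.symm n_p_w; have := tri n_p_q n_q_v n_p_v
          have := tri n_p_q n_q_w n_p_w; have := tri n_p_v n_v_b n_p_w
          have := tri n_a_q n_q_v n_v_a.symm; have := tri n_a_q n_q_w n_w_a.symm
          have := tri n_v_a.symm n_v_b n_w_a.symm; have := tri n_q_v n_v_b n_q_w
          have := @inter V _ q w v p
          by_cases q10 : L p v w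
          · by_cases q12 : L p a v
            · grind (splits := 40) only
            · grind (splits := 40) only
          · grind (splits := 40) only
        · obtain ⟨n_p_a, n_a_b, n_p_b⟩ := L_ne h1
          obtain ⟨_, n_a_q, n_p_q⟩ := L_ne h2
          obtain ⟨_, n_q_b, _⟩ := L_ne h3
          obtain ⟨_, n_v_w, n_p_v, n_p_w, n_q_v, n_q_w⟩ := h14.ne
          simp only [Cr, Opp, In] at *
          have := tri n_p_a n_a_b n_p_b; have := tri n_p_a n_a_q n_p_q
          have := tri n_p_a n_v_a.symm n_p_v; have := tri n_p_a n_w_a.symm n_p_w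
          have := tri n_p_b n_q_b.symm n_p_q; have := tri n_p_b n_v_b.symm n_p_v
          have := tri n_p_b n_w_b.symm n_p_w; have := tri n_p_q n_q_v n_p_v
          have := tri n_p_q n_q_w n_p_w; have := tri n_p_v n_v_w n_p_w
          have := tri n_a_b n_q_b.symm n_a_q; have := tri n_a_b n_v_b.symm n_v_a.symm
          have := tri n_a_b n_w_b.symm n_w_a.symm; have := tri n_a_q n_q_v n_v_a.symm
          have := tri n_a_q n_q_w n_w_a.symm; have := tri n_v_a.symm n_v_w n_w_a.symm
          have := tri n_q_b.symm n_q_v n_v_b.symm; have := tri n_q_b.symm n_q_w n_w_b.symm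
          have := tri n_v_b.symm n_v_w n_w_b.symm; have := tri n_q_v n_v_w n_q_w
          have := @trans V _ p w a q v; have := @trans V _ v q a w p
          have := @trans V _ w a b p v; have := @trans V _ w a q b v
          have := @trans V _ w p a v q; have := @trans' V _ w b q v a
          have := @trans' V _ p w b v q; have := @trans' V _ v a b p w
          have := @trans' V _ q a v b p; have := @trans V _ p a b w q
          have := @trans V _ q v b p w; have := @trans' V _ w q p v a
          have := @trans V _ w q b a v; have := @trans V _ v p a w q
          have := @trans' V _ p v b w a; have := @inter V _ p w q a; have := @inter V _ a p q v
          have := @inter V _ q w v p; have := @inter V _ p v q w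
          by_cases q10 : L p v w
          · by_cases q12 : L p q v
            · grind (splits := 40) only
            · by_cases q14 : L a q w
              · by_cases q16 : L a v w
                · by_cases q18 : L b v w
                  · grind (splits := 40) only
                  · by_cases q20 : L p a w
                    · grind (splits := 40) only
                    · grind (splits := 40) only
                · grind (splits := 40) only
              · grind (splits := 40) only
          · by_cases q12 : L p q v
            · by_cases q14 : L p a v
              · by_cases q16 : L p b w
                · grind (splits := 40) only
                · by_cases q18 : L b v w
                  · grind (splits := 40) only
                  · by_cases q20 : L a b w
                    · grind (splits := 40) only
                    · by_cases q22 : L b q v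
                      · grind (splits := 40) only
                      · grind (splits := 40) only
              · grind (splits := 40) only
            · grind (splits := 40) only

theorem In_of_In_left {p a b q x : V} (n_x_b : x ≠ b) (h1 : L p a b) (h2 : L p a q)
    (h3 : L p q b) (h4 : L b a q) (h5 : In x p a q) :
    In x p a b ∨ In x b a q := by
  obtain ⟨n_p_a, n_a_b, n_p_b⟩ := L_ne h1
  obtain ⟨_, n_a_q, n_p_q⟩ := L_ne h2
  obtain ⟨_, n_q_b, _⟩ := L_ne h3
  obtain ⟨n_x_p, n_x_a, n_x_q, _⟩ := h5.ne
  simp only [In] at *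
  have := tri n_p_a n_a_b n_p_b; have := tri n_p_a n_a_q n_p_q
  have := tri n_p_a n_x_a.symm n_x_p.symm; have := tri n_p_b n_q_b.symm n_p_q
  have := tri n_p_b n_x_b.symm n_x_p.symm; have := tri n_p_q n_x_q.symm n_x_p.symm
  have := tri n_a_b n_q_b.symm n_a_q; have := tri n_a_b n_x_b.symm n_x_a.symm
  have := tri n_a_q n_x_q.symm n_x_a.symm; have := tri n_q_b.symm n_x_q.symm n_x_b.symm
  have := @trans V _ p a x q b; have := @trans' V _ q a x b p
  grind (splits := 40) only

theorem In_of_In_right {p a b q x : V} (n_x_a : x ≠ a) (h1 : L p a b) (h2 : L p a q)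
    (h3 : L p q b) (h4 : L b a q) (h5 : In x p q b) :
    In x p a b ∨ In x b a q := by
  obtain ⟨n_p_a, n_a_b, n_p_b⟩ := L_ne h1
  obtain ⟨_, n_a_q, n_p_q⟩ := L_ne h2
  obtain ⟨_, n_q_b, _⟩ := L_ne h3
  obtain ⟨n_x_p, n_x_q, n_x_b, _⟩ := h5.ne
  simp only [In] at *
  have := tri n_p_a n_a_b n_p_b; have := tri n_p_a n_a_q n_p_q
  have := tri n_p_a n_x_a.symm n_x_p.symm; have := tri n_p_b n_q_b.symm n_p_q
  have := tri n_p_b n_x_b.symm n_x_p.symm; have := tri n_p_q n_x_q.symm n_x_p.symm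
  have := tri n_a_b n_q_b.symm n_a_q; have := tri n_a_b n_x_b.symm n_x_a.symm
  have := tri n_a_q n_x_q.symm n_x_a.symm; have := tri n_q_b.symm n_x_q.symm n_x_b.symm
  have := @trans' V _ p b q x a; have := @trans V _ q b x p a
  grind (splits := 40) only

theorem In_trans {p a b c x : V} (n_x_c : x ≠ c) (h1 : In p a b c) (h2 : In x p a b) :
    In x a b c := by
  obtain ⟨n_p_a, n_p_b, n_p_c, n_a_b, n_b_c, n_a_c⟩ := h1.ne
  obtain ⟨n_x_p, n_x_a, n_x_b, _⟩ := h2.ne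
  simp only [In] at *
  have := tri n_p_a n_a_b n_p_b; have := tri n_p_a n_a_c n_p_c
  have := tri n_p_a n_x_a.symm n_x_p.symm; have := tri n_p_b n_b_c n_p_c
  have := tri n_p_b n_x_b.symm n_x_p.symm; have := tri n_a_b n_b_c n_a_c
  have := tri n_a_b n_x_b.symm n_x_a.symm; have := tri n_a_c n_x_c.symm n_x_a.symm
  have := tri n_b_c n_x_c.symm n_x_b.symm; have := @trans' V _ b a p x c
  have := @trans V _ a b c x p; have := @inter V _ a c p b
  grind (splits := 40) only

theorem trans_left {p x y z w : V} (n_z_w : z ≠ w) (h1 : L p z y) (h2 : L p z x) (h3 : L p x y)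
    (h4 : L p x w) (h5 : L p w y) :
    L p z w := by
  obtain ⟨n_p_z, n_z_y, n_p_y⟩ := L_ne h1
  obtain ⟨_, n_z_x, n_p_x⟩ := L_ne h2
  obtain ⟨_, n_x_y, _⟩ := L_ne h3
  obtain ⟨_, n_x_w, n_p_w⟩ := L_ne h4
  obtain ⟨_, n_w_y, _⟩ := L_ne h5
  have := tri n_p_x n_x_y n_p_y; have := tri n_p_x n_z_x.symm n_p_z
  have := tri n_p_x n_x_w n_p_w; have := tri n_p_y n_z_y.symm n_p_z
  have := tri n_p_y n_w_y.symm n_p_w; have := tri n_p_z n_z_w n_p_w; have := @trans' V _ p y x w z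
  grind (splits := 40) only

/-- The slot of an edge `e` of `T`: the edge through which it is reached from `p`. -/
def IsSlot (t : Finset V) (T : Finset (Sym2 V)) (p : V) (e : Sym2 V)
    (s : Sym2 V ⊕ Sym2 V × Bool) : Prop :=
  ∃ x y z, e = s(x, y) ∧ Face t T x y z ∧ L p x y ∧
    ((L p y z ∧ L p z x ∧ s = .inl e) ∨ (L p x z ∧ L p y z ∧ s = .inr (s(x, z), false)) ∨
      (L p z x ∧ L p z y ∧ s = .inr (s(z, y), true)))

theorem eq_of_mk_eq {p x y x' y' : V} (h : L p x y) (h' : L p x' y') (he : s(x, y) = s(x', y')) :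
    x = x' ∧ y = y' := by
  rcases Sym2.eq_iff.1 he with h1 | ⟨rfl, rfl⟩
  exacts [h1, (asymm (rot h) (rot (rot (rot (rot h'))))).elim]

theorem IsSlot.unique {t : Finset V} {T : Finset (Sym2 V)} (hT : Plane t T) {p : V} {e : Sym2 V}
    {s s' : Sym2 V ⊕ Sym2 V × Bool} (h : IsSlot t T p e s) (h' : IsSlot t T p e s') : s = s' := by
  obtain ⟨x, y, z, rfl, hf, hl, h⟩ := h
  obtain ⟨x', y', z', he, hf', hl', h'⟩ := h'
  obtain ⟨rfl, rfl⟩ := eq_of_mk_eq hl hl' he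
  obtain rfl := hf.unique hT hf'
  have as : ∀ {u v}, L p u v → ¬ L p v u := fun k k' => asymm (rot k) (rot (rot (rot (rot k'))))
  rcases h with ⟨h1, h2, rfl⟩ | ⟨h1, h2, rfl⟩ | ⟨h1, h2, rfl⟩ <;>
    rcases h' with ⟨k1, k2, rfl⟩ | ⟨k1, k2, rfl⟩ | ⟨k1, k2, rfl⟩
  exacts [rfl, (as h2 k1).elim, (as h1 k2).elim, (as k2 h1).elim, rfl, (as h1 k1).elim,
    (as k1 h2).elim, (as k1 h1).elim, rfl]

theorem IsSlot.inj {t : Finset V} {T : Finset (Sym2 V)} (hT : Plane t T) {p : V} {e e' : Sym2 V}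
    {s : Sym2 V ⊕ Sym2 V × Bool} (h : IsSlot t T p e s) (h' : IsSlot t T p e' s) : e = e' := by
  obtain ⟨x, y, z, rfl, hf, hl, h⟩ := h
  obtain ⟨x', y', z', rfl, hf', hl', h'⟩ := h'
  rcases h with ⟨h1, h2, h3⟩ | ⟨h1, h2, h3⟩ | ⟨h1, h2, h3⟩ <;>
    rcases h' with ⟨k1, k2, k3⟩ | ⟨k1, k2, k3⟩ | ⟨k1, k2, k3⟩ <;> subst h3 <;>
      simp only [Sum.inl.injEq, Sum.inr.injEq, Prod.mk.injEq, reduceCtorEq, Bool.false_eq_true,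
        and_false, and_true] at k3
  · exact k3
  · obtain ⟨rfl, rfl⟩ := eq_of_mk_eq h1 k1 k3
    rw [hf.rot.rot.unique hT hf'.rot.rot]
  · obtain ⟨rfl, rfl⟩ := eq_of_mk_eq h2 k2 k3
    rw [hf.rot.unique hT hf'.rot]

/-- The number of points of `t` in the wedge with apex `p` spanned by the edge `e`. -/
def wedge (t : Finset V) (p : V) (e : Sym2 V) : ℕ :=
  (t.filter fun w => ∃ x y, e = s(x, y) ∧ L p x y ∧ L p x w ∧ L p w y).card

theorem IsSlot.wedge_lt {t : Finset V} {T : Finset (Sym2 V)} (hT : Plane t T) {p : V}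
    {e e' : Sym2 V} {b : Bool} (h : IsSlot t T p e (.inr (e', b))) :
    wedge t p e < wedge t p e' := by
  obtain ⟨x, y, z, rfl, hf, hl, h⟩ := h
  rcases h with ⟨h1, h2, h3⟩ | ⟨h1, h2, h3⟩ | ⟨h1, h2, h3⟩ <;>
    simp only [Sum.inr.injEq, Prod.mk.injEq, reduceCtorEq] at h3 <;> obtain ⟨rfl, rfl⟩ := h3
  · refine Finset.card_lt_card (Finset.ssubset_iff_of_subset ?_ |>.2 ⟨y, ?_, ?_⟩)
    · intro w hw
      simp only [Finset.mem_filter] at hw ⊢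
      obtain ⟨hw, x', y', he, h3, h4, h5⟩ := hw
      obtain ⟨rfl, rfl⟩ := eq_of_mk_eq hl h3 he
      exact ⟨hw, x, z, rfl, h1, h4, trans h4 hl h1 h5 h2⟩
    · exact Finset.mem_filter.2 ⟨hT.mem' hf.ab, x, z, rfl, h1, hl, h2⟩
    · rintro hy
      obtain ⟨-, x', y', he, h3, h4, h5⟩ := Finset.mem_filter.1 hy
      obtain ⟨rfl, rfl⟩ := eq_of_mk_eq hl h3 he
      simp at h5
  · refine Finset.card_lt_card (Finset.ssubset_iff_of_subset ?_ |>.2 ⟨x, ?_, ?_⟩)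
    · intro w hw
      simp only [Finset.mem_filter] at hw ⊢
      obtain ⟨hw, x', y', he, h3, h4, h5⟩ := hw
      obtain ⟨rfl, rfl⟩ := eq_of_mk_eq hl h3 he
      exact ⟨hw, z, y, rfl, h2,
        trans_left (by rintro rfl; exact asymm (rot h1) (rot (rot (rot (rot h4))))) h2 h1 hl h4 h5, h5⟩
    · exact Finset.mem_filter.2 ⟨hT.mem hf.ab, z, y, rfl, h2, h1, hl⟩
    · rintro hy
      obtain ⟨-, x', y', he, h3, h4, h5⟩ := Finset.mem_filter.1 hy
      obtain ⟨rfl, rfl⟩ := eq_of_mk_eq hl h3 he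
      simp at h4

/-- A choice of slots. -/
def slot (t : Finset V) (T : Finset (Sym2 V)) (p : V) (e : Sym2 V) : Sym2 V ⊕ Sym2 V × Bool :=
  if h : ∃ s, IsSlot t T p e s then h.choose else .inl e

theorem isSlot_slot {t : Finset V} {T : Finset (Sym2 V)} {p : V} {e : Sym2 V}
    (h : ∃ s, IsSlot t T p e s) : IsSlot t T p e (slot t T p e) := by
  rw [slot, dif_pos h]
  exact h.choose_spec

theorem IsSlot.slot_eq {t : Finset V} {T : Finset (Sym2 V)} (hT : Plane t T) {p : V} {e : Sym2 V}
    {s : Sym2 V ⊕ Sym2 V × Bool} (h : IsSlot t T p e s) : slot t T p e = s :=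
  (isSlot_slot ⟨s, h⟩).unique hT h

theorem isSlot_of_slot_inr {t : Finset V} {T : Finset (Sym2 V)} {p : V} {e : Sym2 V}
    {r : Sym2 V × Bool} (h : slot t T p e = .inr r) : IsSlot t T p e (.inr r) := by
  by_cases hs : ∃ s, IsSlot t T p e s
  · exact h ▸ isSlot_slot hs
  · rw [slot, dif_neg hs] at h
    cases h

theorem Tight.exists_slot {t : Finset V} {T D : Finset (Sym2 V)} (hT : Tri t T) {p a b c : V}
    (hp : Inside t p) (hf : Face t T a b c) (hin : In p a b c) (hD : Tight t T p D) {e : Sym2 V}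
    (he : e ∈ D) :
    ∃ s, IsSlot t T p e s ∧ (s = .inl s(a, b) ∨ s = .inl s(b, c) ∨ s = .inl s(c, a) ∨
      ∃ e' ∈ D, ∃ b, s = .inr (e', b)) := by
  obtain ⟨u, v, q, rfl, hfar, hvis⟩ := hD.2 e he
  obtain ⟨r, hr, hl⟩ := hp.side u v (rot hfar.base)
  obtain ⟨z, hz, hfz⟩ := exists_face hT (hD.1 he) hr hl
  have hpz : p ≠ z := fun h => hp.notMem (h ▸ hz)
  have hmem : ∀ {x y}, s(x, y) ∈ T → Cr p q x y → s(x, y) ∈ D := fun {x y} h hc => by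
    by_contra hn
    exact hvis x y (Finset.mem_sdiff.2 ⟨h, hn⟩) hc
  rcases slot_cases hpz hfar.base hfar.left hfar.right hfar.face.left hfz.left with h | h | h
  · have hu : Vis T p u := fun v w hvw => hfz.not_cross_of_In hT h hvw
    have hv : Vis T p v := fun v w hvw => hfz.rot.not_cross_of_In hT ⟨h.2.1, h.2.2, h.1⟩ hvw
    refine ⟨.inl s(u, v), ⟨u, v, z, rfl, hfz, hfar.base, .inl ⟨rot (rot h.2.1), rot (rot h.2.2),
      rfl⟩⟩, ?_⟩
    have huv := (L_ne hfar.base).2.1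
    rcases (vis_iff_of_root hT hp.notMem hf hin (hT.mem hfz.ab)).1 hu with rfl | rfl | rfl <;>
      rcases (vis_iff_of_root hT hp.notMem hf hin (hT.mem' hfz.ab)).1 hv with rfl | rfl | rfl <;>
        simp at huv ⊢
  · refine ⟨.inr (s(u, z), false), ⟨u, v, z, rfl, hfz, hfar.base, ?_⟩,
      .inr (.inr (.inr ⟨_, hmem (Sym2.eq_swap ▸ hfz.ca) h.1, false, rfl⟩))⟩
    obtain ⟨x, y, q', he', hfar', -⟩ := hD.2 _ (hmem (Sym2.eq_swap ▸ hfz.ca) h.1)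
    obtain ⟨rfl, rfl⟩ := eq_of_mk_eq h.2 hfar'.base he'
    obtain rfl := hfar'.face.unique hT.toPlane hfz.rot.rot
    exact .inr (.inl ⟨h.2, hfar'.right, rfl⟩)
  · refine ⟨.inr (s(z, v), true), ⟨u, v, z, rfl, hfz, hfar.base, ?_⟩,
      .inr (.inr (.inr ⟨_, hmem (Sym2.eq_swap ▸ hfz.bc) h.1, true, rfl⟩))⟩
    obtain ⟨x, y, q', he', hfar', -⟩ := hD.2 _ (hmem (Sym2.eq_swap ▸ hfz.bc) h.1)
    obtain ⟨rfl, rfl⟩ := eq_of_mk_eq h.2 hfar'.base he'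
    obtain rfl := hfar'.face.unique hT.toPlane hfz.rot
    exact .inr (.inr ⟨hfar'.left, h.2, rfl⟩)

theorem Far.vis {t : Finset V} {T D : Finset (Sym2 V)} (hT : Tri t T) {p a b q : V}
    (h : Far t T p a b q) (hD : s(a, b) ∈ D) (ha : Vis (T \ D) p a) (hb : Vis (T \ D) p b)
    (he : ∀ x ∈ t, ¬ In x p a b) :
    Vis (T \ D) p q ∧ (∀ x ∈ t, ¬ In x p a q) ∧ ∀ x ∈ t, ¬ In x p q b := by
  have hab := h.face.ab
  refine ⟨fun v w hvw hc => ?_, fun x hx hi => ?_, fun x hx hi => ?_⟩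
  · obtain ⟨hvw', hn⟩ := Finset.mem_sdiff.1 hvw
    have hv := hT.mem hvw'
    have hw := hT.mem' hvw'
    rcases eq_of_cross_far h.base h.left h.right h.face.left (hT.noX h.face.bc hvw')
      (hT.noX h.face.ca hvw') (ha v w hvw) (hb v w hvw) (hT.noX (Sym2.eq_swap ▸ hab) hvw')
      (he v hv) (he w hw) (h.face.empty v hv) (h.face.empty w hw) hc with ⟨rfl, rfl⟩ | ⟨rfl, rfl⟩
    exacts [hn hD, hn (Sym2.eq_swap ▸ hD)]
  · rcases In_of_In_left (fun e => by subst e; exact asymm (rot h.right) (rot (rot hi.2.2)))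
      h.base h.left h.right h.face.left hi with h1 | h1
    exacts [he x hx h1, h.face.empty x hx h1]
  · rcases In_of_In_right (fun e => by
        subst e
        exact asymm (rot h.left) (rot (rot (rot (rot hi.1)))))
      h.base h.left h.right h.face.left hi with h1 | h1
    exacts [he x hx h1, h.face.empty x hx h1]

theorem tight_of_closed {t : Finset V} {T D : Finset (Sym2 V)} (hT : Tri t T) {p : V}
    (hDT : D ⊆ T) (hD : ∀ e ∈ D, (∃ a b q, e = s(a, b) ∧ Far t T p a b q) ∧
      ∃ s, IsSlot t T p e s ∧ ((∃ e', s = .inl e') ∨ ∃ e' ∈ D, ∃ b, s = .inr (e', b))) :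
    Tight t T p D := by
  have key : ∀ e ∈ D, ∃ a b q, e = s(a, b) ∧ Far t T p a b q ∧ Vis (T \ D) p a ∧
      Vis (T \ D) p b ∧ ∀ x ∈ t, ¬ In x p a b := by
    by_contra! hcon
    obtain ⟨e₀, he₀, hbad₀⟩ := hcon
    obtain ⟨e, he, hmax⟩ := (D.filter fun e => ∀ a b q, e = s(a, b) → Far t T p a b q →
      Vis (T \ D) p a → Vis (T \ D) p b → ∃ x ∈ t, In x p a b).exists_max_image (wedge t p)
      ⟨e₀, Finset.mem_filter.2 ⟨he₀, hbad₀⟩⟩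
    obtain ⟨he, hbad⟩ := Finset.mem_filter.1 he
    obtain ⟨⟨a, b, q, rfl, hfar⟩, s, hs, hs'⟩ := hD e he
    have hgood : ∀ {e' β}, e' ∈ D → s = .inr (e', β) → ∃ a b q, e' = s(a, b) ∧
        Far t T p a b q ∧ Vis (T \ D) p a ∧ Vis (T \ D) p b ∧ ∀ x ∈ t, ¬ In x p a b := by
      intro e' β h1 h2
      by_contra! hcon
      subst h2
      exact absurd (hs.wedge_lt hT.toPlane) (not_lt.2 (hmax e' (Finset.mem_filter.2 ⟨h1, hcon⟩)))
    obtain ⟨x, y, z, hxy, hf, hl, hcase⟩ := hs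
    obtain ⟨rfl, rfl⟩ := eq_of_mk_eq hfar.base hl hxy
    suffices Vis (T \ D) p a ∧ Vis (T \ D) p b ∧ ∀ x ∈ t, ¬ In x p a b by
      obtain ⟨h1, h2, h3⟩ := this
      obtain ⟨x, hx, hi⟩ := hbad a b q rfl hfar h1 h2
      exact h3 x hx hi
    rcases hcase with ⟨h1, h2, rfl⟩ | ⟨h1, h2, rfl⟩ | ⟨h1, h2, rfl⟩
    · have hin : In p a b z := ⟨rot hl, rot h1, rot h2⟩
      refine ⟨fun v w hvw => hf.not_cross_of_In hT hin (Finset.mem_sdiff.1 hvw).1,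
        fun v w hvw => hf.rot.not_cross_of_In hT ⟨hin.2.1, hin.2.2, hin.1⟩
          (Finset.mem_sdiff.1 hvw).1, fun x hx hi => hf.empty x hx (In_trans ?_ hin hi)⟩
      rintro rfl
      grind [In, rot, asymm]
    · have hm : s(a, z) ∈ D := by
        rcases hs' with ⟨e', h⟩ | ⟨e', h, β, h'⟩
        · simp at h
        · simp only [Sum.inr.injEq, Prod.mk.injEq] at h'
          exact h'.1 ▸ h
      obtain ⟨a', b', q', he', hfar', hva, hvb, hemp⟩ := hgood hm rfl
      obtain ⟨rfl, rfl⟩ := eq_of_mk_eq h1 hfar'.base he'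
      obtain rfl := hfar'.face.unique hT.toPlane hf.rot.rot
      obtain ⟨k1, k2, k3⟩ := hfar'.vis hT hm hva hvb hemp
      exact ⟨hva, k1, k2⟩
    · have hm : s(z, b) ∈ D := by
        rcases hs' with ⟨e', h⟩ | ⟨e', h, β, h'⟩
        · simp at h
        · simp only [Sum.inr.injEq, Prod.mk.injEq] at h'
          exact h'.1 ▸ h
      obtain ⟨a', b', q', he', hfar', hva, hvb, hemp⟩ := hgood hm rfl
      obtain ⟨rfl, rfl⟩ := eq_of_mk_eq h2 hfar'.base he'
      obtain rfl := hfar'.face.unique hT.toPlane hf.rot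
      obtain ⟨k1, k2, k3⟩ := hfar'.vis hT hm hva hvb hemp
      exact ⟨k1, hvb, k3⟩
  refine ⟨hDT, fun e he => ?_⟩
  obtain ⟨a, b, q, rfl, hfar, h1, h2, h3⟩ := key e he
  exact ⟨a, b, q, rfl, hfar, (hfar.vis hT he h1 h2 h3).1⟩

theorem sum_tights_le {t : Finset V} {T : Finset (Sym2 V)} (hT : Tri t T) {A p : V}
    (hp : Inside t p) (hne : t.Nonempty) :
    ∑ D ∈ tights t A T p, (71 - 10 * (D.card + 3 : ℕ) : ℤ) ≤ 300 := by
  obtain ⟨a, b, c, hf, hin⟩ := exists_root hT hp hne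
  set U := (locked t A T).filter fun e => (∃ a b q, e = s(a, b) ∧ Far t T p a b q) ∧
    ∃ s, IsSlot t T p e s with hU
  have hmem : ∀ {e}, e ∈ U ↔ e ∈ locked t A T ∧ (∃ a b q, e = s(a, b) ∧ Far t T p a b q) ∧
    ∃ s, IsSlot t T p e s := by simp [hU]
  have hab := (L_ne hf.left).1
  have hbc := (L_ne hf.left).2.1
  have hac := (L_ne hf.left).2.2
  refine le_of_eq_of_le (Finset.sum_congr ?_ fun _ _ => rfl) (sum_closedSets_le (slot t T p)
    (wedge t p) (fun e e' b h => (isSlot_of_slot_inr h).wedge_lt hT.toPlane) U ?_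
    (r₁ := s(a, b)) (r₂ := s(b, c)) (r₃ := s(c, a)) ?_ ?_ ?_)
  · ext D
    simp only [tights, Finset.mem_filter, Finset.mem_powerset, mem_closedSets, Finset.mem_insert,
      Finset.mem_singleton]
    constructor
    · rintro ⟨h1, h2⟩
      have hs := fun e he => h2.exists_slot hT hp hf hin (e := e) he
      refine ⟨fun e he => hmem.2 ⟨h1 he, ?_, ?_⟩, fun e he => ?_⟩
      · obtain ⟨a, b, q, h3, h4, -⟩ := h2.2 e he
        exact ⟨a, b, q, h3, h4⟩
      · obtain ⟨s, h3, -⟩ := hs e he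
        exact ⟨s, h3⟩
      · obtain ⟨s, h3, h4⟩ := hs e he
        rw [h3.slot_eq hT.toPlane]
        tauto
    · rintro ⟨h1, h2⟩
      have h3 : D ⊆ locked t A T := fun e he => (hmem.1 (h1 he)).1
      refine ⟨h3, tight_of_closed hT (h3.trans (Finset.filter_subset _ _)) fun e he => ?_⟩
      obtain ⟨-, h4, h5⟩ := hmem.1 (h1 he)
      refine ⟨h4, _, isSlot_slot h5, ?_⟩
      rcases h2 e he with (h | h | h) | h
      exacts [.inl ⟨_, h⟩, .inl ⟨_, h⟩, .inl ⟨_, h⟩, .inr h]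
  · intro e he e' he' h
    have h1 := isSlot_slot (hmem.1 he).2.2
    rw [h] at h1
    exact h1.inj hT.toPlane (isSlot_slot (hmem.1 he').2.2)
  · grind
  · grind
  · grind

theorem Hull.subset {s : Finset V} {A B C : V} (h : Hull s A B C) : {A, B, C} ⊆ s := by
  intro x hx
  simp only [Finset.mem_insert, Finset.mem_singleton] at hx
  rcases hx with rfl | rfl | rfl
  exacts [h.A_mem, h.B_mem, h.C_mem]

theorem Hull.card_sdiff {s : Finset V} {A B C : V} (h : Hull s A B C) {m : ℕ}
    (hs : s.card = m + 3) : (s \ {A, B, C}).card = m := by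
  obtain ⟨h1, h2, h3⟩ := L_ne h.left
  rw [Finset.card_sdiff_of_subset h.subset, hs, Finset.card_insert_of_notMem (by simp [h1, h3]),
    Finset.card_pair h2]
  omega

theorem Plane.sum_degree {s : Finset V} {T : Finset (Sym2 V)} (hT : Plane s T) :
    ∑ p ∈ s, (T.filter fun e => p ∈ e).card = 2 * T.card := by
  simp only [Finset.card_filter]
  rw [Finset.sum_comm, mul_comm, ← smul_eq_mul, ← Finset.sum_const]
  refine Finset.sum_congr rfl fun e he => ?_
  rw [← Finset.card_filter]
  induction e with | _ a b =>
  rw [← Finset.card_pair (hT.ne he)]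
  congr 1
  ext x
  have := hT.mem he
  have := hT.mem' he
  simp only [Finset.mem_filter, Sym2.mem_iff, Finset.mem_insert, Finset.mem_singleton]
  grind

theorem Tri.sum_degree_inside {s : Finset V} {T : Finset (Sym2 V)} {A B C : V} (h : Hull s A B C)
    (hT : Tri s T) : ∑ p ∈ s \ {A, B, C}, (T.filter fun e => p ∈ e).card + 18 ≤ 6 * s.card := by
  obtain ⟨h1, h2, h3⟩ := L_ne h.left
  obtain ⟨e1, e2, e3⟩ := hT.side_mem h
  have h4 := Finset.sum_sdiff h.subset (f := fun p => (T.filter fun e => p ∈ e).card)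
  rw [hT.sum_degree, Finset.sum_insert (by simp [h1, h3]), Finset.sum_insert (by simp [h2]),
    Finset.sum_singleton] at h4
  have key : ∀ {x y z : V}, y ≠ z → s(x, y) ∈ T → s(x, z) ∈ T →
      2 ≤ (T.filter fun e => x ∈ e).card := by
    intro x y z hyz hy hz
    have hne : s(x, y) ≠ s(x, z) := fun h => hyz (Sym2.congr_right.1 h)
    rw [← Finset.card_pair hne]
    refine Finset.card_le_card fun e he => ?_
    simp only [Finset.mem_insert, Finset.mem_singleton] at he
    rcases he with rfl | rfl <;> simp [hy, hz]
  have k1 := key h2 e1 (Sym2.eq_swap ▸ e3)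
  have k2 := key h3.symm e2 (Sym2.eq_swap ▸ e1)
  have k3 := key h1 e3 (Sym2.eq_swap ▸ e2)
  have := hT.card_eq h
  omega

theorem card_tris_le_sum {s : Finset V} {A B C : V} (h : Hull s A B C) {m : ℕ}
    (hs : s.card = m + 3) :
    11 * m * (tris s).card ≤ 300 * ∑ p ∈ s \ {A, B, C}, (tris (s.erase p)).card := by
  obtain ⟨h1, h2, h3⟩ := L_ne h.left
  have hcard := h.card_sdiff hs
  have hlow : ∀ T ∈ tris s, (11 * m : ℤ) ≤ ∑ p ∈ s \ {A, B, C},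
      (71 - 10 * ((T.filter fun e => p ∈ e).card : ℤ)) := by
    intro T hT
    have := (mem_tris.1 hT).sum_degree_inside h
    rw [hs] at this
    zify at this
    rw [Finset.sum_sub_distrib, ← Finset.mul_sum, Finset.sum_const, hcard, nsmul_eq_mul]
    linarith
  have hup : ∀ p ∈ s \ {A, B, C}, ∑ T ∈ tris s, (71 - 10 * ((T.filter fun e => p ∈ e).card : ℕ) : ℤ)
      ≤ 300 * (tris (s.erase p)).card := by
    intro p hp
    simp only [Finset.mem_sdiff, Finset.mem_insert, Finset.mem_singleton, not_or] at hp
    obtain ⟨hps, hA, hB, hC⟩ := hp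
    have hin : In p A B C := by
      have := h.inside p hps
      tauto
    have he := h.erase hA hB hC
    have := sum_tris_insert he hin (Finset.notMem_erase p s) fun m => 71 - 10 * (m : ℤ)
    rw [Finset.insert_erase hps] at this
    rw [this, mul_comm, ← nsmul_eq_mul]
    refine Finset.sum_le_card_nsmul _ _ _ fun T hT => ?_
    exact sum_tights_le (mem_tris.1 hT) (h.inside_erase hps hA hB hC) ⟨A, he.A_mem⟩
  have := Finset.sum_le_sum hlow
  rw [Finset.sum_comm, Finset.sum_const, nsmul_eq_mul] at this
  have := this.trans (Finset.sum_le_sum hup)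
  rw [← Finset.mul_sum] at this
  zify
  linarith

theorem card_tris_le {m : ℕ} {s : Finset V} {A B C : V} (h : Hull s A B C) (hs : s.card = m + 3) :
    (tris s).card * 11 ^ m ≤ 300 ^ m := by
  induction m generalizing s with
  | zero =>
    have h1 : (tris s).card ≤ 1 := by
      refine Finset.card_le_one.2 fun T hT T' hT' => ?_
      have key : ∀ {T}, T ∈ tris s → {s(A, B), s(B, C), s(C, A)} = T := by
        intro T hT
        rw [mem_tris] at hT
        obtain ⟨e1, e2, e3⟩ := hT.side_mem h
        refine Finset.eq_of_subset_of_card_le (fun e he => ?_) ?_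
        · simp only [Finset.mem_insert, Finset.mem_singleton] at he
          rcases he with rfl | rfl | rfl
          exacts [e1, e2, e3]
        · have := hT.card_eq h
          obtain ⟨h1, h2, h3⟩ := L_ne h.left
          rw [Finset.card_eq_three.2 ⟨s(A, B), s(B, C), s(C, A), ?_, ?_, ?_, rfl⟩]
          · omega
          all_goals grind
      rw [← key hT, ← key hT']
    simpa using h1
  | succ m ih =>
    have h1 := card_tris_le_sum h hs
    have h2 : ∀ p ∈ s \ {A, B, C}, (tris (s.erase p)).card * 11 ^ m ≤ 300 ^ m := by
      intro p hp
      simp only [Finset.mem_sdiff, Finset.mem_insert, Finset.mem_singleton, not_or] at hp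
      exact ih (h.erase hp.2.1 hp.2.2.1 hp.2.2.2) (by
        rw [Finset.card_erase_of_mem hp.1, hs]
        omega)
    have h3 := Finset.sum_le_card_nsmul _ _ _ h2
    rw [h.card_sdiff hs, ← Finset.sum_mul, smul_eq_mul] at h3
    refine Nat.le_of_mul_le_mul_left (c := m + 1) ?_ (Nat.succ_pos m)
    calc (m + 1) * ((tris s).card * 11 ^ (m + 1))
        = 11 * (m + 1) * (tris s).card * 11 ^ m := by ring
      _ ≤ 300 * (∑ p ∈ s \ {A, B, C}, (tris (s.erase p)).card) * 11 ^ m :=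
        Nat.mul_le_mul_right _ h1
      _ = 300 * ((∑ p ∈ s \ {A, B, C}, (tris (s.erase p)).card) * 11 ^ m) := by ring
      _ ≤ 300 * ((m + 1) * 300 ^ m) := Nat.mul_le_mul_left _ h3
      _ = (m + 1) * 300 ^ (m + 1) := by ring

end CC

/-- Twice the signed area of the triangle `abc`. -/
def det3 (a b c : Pt) : ℝ := (b.1 - a.1) * (c.2 - a.2) - (b.2 - a.2) * (c.1 - a.1)

/-- No three distinct points of `S` span a triangle of signed area zero. -/
def DetGen (S : Finset Pt) : Prop :=
  ∀ p ∈ S, ∀ q ∈ S, ∀ r ∈ S, p ≠ q → p ≠ r → q ≠ r → det3 p q r ≠ 0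

theorem collinear_of_det3_eq_zero {a b c : Pt} (hab : a ≠ b) (h : det3 a b c = 0) :
    Collinear ℝ ({a, b, c} : Set Pt) := by
  obtain ⟨a1, a2⟩ := a
  obtain ⟨b1, b2⟩ := b
  obtain ⟨c1, c2⟩ := c
  simp only [det3] at h
  rw [collinear_iff_of_mem (p₀ := (a1, a2)) (by simp)]
  refine ⟨(b1 - a1, b2 - a2), ?_⟩
  rintro p (rfl | rfl | rfl)
  · exact ⟨0, by simp⟩
  · exact ⟨1, by simp⟩
  · by_cases h1 : b1 - a1 = 0
    · have h2 : b2 - a2 ≠ 0 := by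
        intro h2
        exact hab (Prod.ext (by simp; linarith) (by simp; linarith))
      refine ⟨(c2 - a2) / (b2 - a2), ?_⟩
      rw [h1] at h
      have h3 : c1 - a1 = 0 := by
        rcases mul_eq_zero.1 (show (b2 - a2) * (c1 - a1) = 0 by linarith) with h | h
        · exact absurd h h2
        · exact h
      refine Prod.ext ?_ ?_ <;> simp
      · rw [h1]; linarith
      · field_simp; ring
    · refine ⟨(c1 - a1) / (b1 - a1), ?_⟩
      refine Prod.ext ?_ ?_ <;> simp <;> field_simp
      · ring
      · linarith

theorem GenPos.detGen {S : Finset Pt} (h : GenPos S) : DetGen S :=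
  fun p hp q hq r hr h1 h2 h3 h0 => h p hp q hq r hr h1 h2 h3 (collinear_of_det3_eq_zero h1 h0)

theorem det3_rot (a b c : Pt) : det3 b c a = det3 a b c := by simp only [det3]; ring

theorem det3_swap (a b c : Pt) : det3 b a c = -det3 a b c := by simp only [det3]; ring

theorem DetGen.insert {S : Finset Pt} (h : DetGen S) {p : Pt}
    (hp : ∀ x ∈ S, ∀ y ∈ S, x ≠ y → det3 x y p ≠ 0) : DetGen (insert p S) := by
  intro a ha b hb c hc hab hac hbc
  rw [Finset.mem_insert] at ha hb hc
  rcases ha with rfl | ha <;> rcases hb with rfl | hb <;> rcases hc with rfl | hc <;>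
    try contradiction
  · rw [← det3_rot]; exact hp _ hb _ hc hbc
  · rw [← det3_rot, ← det3_rot]; exact hp _ hc _ ha hac.symm
  · exact hp _ ha _ hb hab
  · exact h _ ha _ hb _ hc hab hac hbc

theorem exists_det3_ne_zero (S : Finset Pt) {u lo hi : ℝ} (hu : ∀ x ∈ S, x.1 ≠ u) (h : lo < hi) :
    ∃ s, lo < s ∧ s < hi ∧ ∀ x ∈ S, ∀ y ∈ S, x ≠ y → det3 x y (u, s) ≠ 0 := by
  obtain ⟨s, hs, hF⟩ := (Set.Ioo_infinite h).exists_notMem_finset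
    ((S ×ˢ S).image fun z => z.1.2 + (z.2.2 - z.1.2) * (u - z.1.1) / (z.2.1 - z.1.1))
  refine ⟨s, hs.1, hs.2, fun x hx y hy hxy h0 => ?_⟩
  simp only [det3] at h0
  by_cases h1 : y.1 - x.1 = 0
  · rw [h1] at h0
    rcases mul_eq_zero.1 (show (y.2 - x.2) * (u - x.1) = 0 by linarith) with h2 | h2
    · exact hxy (Prod.ext (by linarith) (by linarith))
    · exact hu x hx (by linarith)
  · apply hF
    rw [Finset.mem_image]
    refine ⟨(x, y), Finset.mk_mem_product hx hy, ?_⟩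
    simp only
    field_simp
    linarith

theorem exists_det3_ne_zero' (S : Finset Pt) {v lo hi : ℝ} (hv : ∀ x ∈ S, x.2 ≠ v) (h : lo < hi) :
    ∃ r, lo < r ∧ r < hi ∧ ∀ x ∈ S, ∀ y ∈ S, x ≠ y → det3 x y (r, v) ≠ 0 := by
  obtain ⟨r, h1, h2, h3⟩ := exists_det3_ne_zero (S.image Prod.swap) (u := v) (by
    intro x hx h
    obtain ⟨y, hy, rfl⟩ := Finset.mem_image.1 hx
    exact hv y hy h) h
  refine ⟨r, h1, h2, fun x hx y hy hxy h0 => h3 x.swap (Finset.mem_image_of_mem _ hx) y.swap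
    (Finset.mem_image_of_mem _ hy) (fun h => hxy (Prod.swap_injective h)) ?_⟩
  simp only [det3, Prod.fst_swap, Prod.snd_swap] at h0 ⊢
  linarith

/-- The orientation predicate of a planar point set in general position. -/
abbrev DetGen.cc {S : Finset Pt} (h : DetGen S) : CC {x // x ∈ S} where
  L a b c := 0 < det3 a b c
  rot := by
    intro a b c h
    rwa [det3_rot]
  asymm := by
    intro a b c h
    rw [det3_swap]
    linarith
  total := by
    intro a b c hab hbc hac
    have := h a a.2 b b.2 c c.2 (fun h => hab (Subtype.ext h))
      (fun h => hac (Subtype.ext h)) (fun h => hbc (Subtype.ext h))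
    rw [det3_swap a.1 b.1 c.1]
    rcases lt_or_gt_of_ne this with h | h
    · right; linarith
    · left; exact h
  inter := by
    intro p q r t h1 h2 h3
    simp only [det3] at *
    linarith
  trans := by
    intro t s p q r h1 h2 h3 h4 h5
    have h6 : det3 t s q * det3 t p r = det3 t s p * det3 t q r + det3 t s r * det3 t p q := by
      simp only [det3]; ring
    exact pos_of_mul_pos_right (by rw [h6]; positivity) h2.le
  trans' := by
    intro t s p q r h1 h2 h3 h4 h5
    have h6 : det3 s t q * det3 t p r = det3 s t p * det3 t q r + det3 s t r * det3 t p q := by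
      simp only [det3]; ring
    exact pos_of_mul_pos_right (by rw [h6]; positivity) h2.le

theorem edgesCross_of_det3 {a b c d : Pt} (h1 : det3 a b c * det3 a b d < 0)
    (h2 : det3 c d a * det3 c d b < 0) : EdgesCross s(a, b) s(c, d) := by
  have key : ∀ x y : ℝ, x * y < 0 → x - y ≠ 0 ∧ 0 < x / (x - y) ∧ 0 < -y / (x - y) ∧
      -y / (x - y) + x / (x - y) = 1 := by
    intro x y h
    have h0 : x - y ≠ 0 := by
      intro h0
      rw [sub_eq_zero.1 h0] at h
      nlinarith [mul_self_nonneg y]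
    refine ⟨h0, ?_, ?_, by field_simp; ring⟩
    · rcases mul_neg_iff.1 h with h | h
      · exact div_pos h.1 (by linarith)
      · exact div_pos_of_neg_of_neg h.1 (by linarith)
    · rcases mul_neg_iff.1 h with h | h
      · exact div_pos (by linarith) (by linarith)
      · exact div_pos_of_neg_of_neg (by linarith) (by linarith)
  obtain ⟨ha, ha1, ha2, ha3⟩ := key _ _ h1
  obtain ⟨hc, hc1, hc2, hc3⟩ := key _ _ h2
  refine ⟨a, b, c, d, rfl, rfl, _, ⟨_, _, hc2, hc1, hc3, rfl⟩, ⟨_, _, ha2, ha1, ha3, ?_⟩⟩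
  have e : det3 a b c - det3 a b d = -(det3 c d a - det3 c d b) := by
    simp only [det3]; ring
  rw [e] at ha ⊢
  refine Prod.ext ?_ ?_ <;> simp only [Prod.fst_add, Prod.snd_add, Prod.smul_fst, Prod.smul_snd,
    smul_eq_mul] <;> field_simp <;> simp only [det3] <;> ring

theorem exists_hull (S : Finset Pt) (hS : DetGen S) :
    ∃ A B C : Pt, A ∉ S ∧ B ∉ S ∧ C ∉ S ∧ A ≠ B ∧ B ≠ C ∧ A ≠ C ∧
      DetGen (insert C (insert B (insert A S))) ∧ 0 < det3 A B C ∧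
      ∀ x ∈ S, 0 < det3 A B x ∧ 0 < det3 B C x ∧ 0 < det3 C A x := by
  obtain ⟨M, hM, hb⟩ : ∃ M : ℝ, 0 < M ∧ ∀ x ∈ S, |x.1| ≤ M ∧ |x.2| ≤ M := by
    refine ⟨1 + ∑ x ∈ S, (|x.1| + |x.2|), by positivity, fun x hx => ?_⟩
    have := Finset.single_le_sum (f := fun x : Pt => |x.1| + |x.2|) (fun _ _ => by positivity) hx
    have := abs_nonneg x.1
    have := abs_nonneg x.2
    constructor <;> linarith
  simp only [abs_le] at hb
  obtain ⟨s, hs1, hs2, hs⟩ := exists_det3_ne_zero S (u := -10 * M) (lo := -5 * M) (hi := -4 * M)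
    (fun x hx h => by have := hb x hx; linarith) (by linarith)
  obtain ⟨t, ht1, ht2, ht⟩ := exists_det3_ne_zero (insert (-10 * M, s) S) (u := 10 * M)
    (lo := -5 * M) (hi := -4 * M) (by
      intro x hx h
      rcases Finset.mem_insert.1 hx with rfl | hx
      · simp only at h; linarith
      · have := hb x hx; linarith) (by linarith)
  obtain ⟨r, hr1, hr2, hr⟩ := exists_det3_ne_zero' (insert (10 * M, t) (insert (-10 * M, s) S))
    (v := 30 * M) (lo := -M) (hi := M) (by
      intro x hx h
      rcases Finset.mem_insert.1 hx with rfl | hx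
      · simp only at h; linarith
      rcases Finset.mem_insert.1 hx with rfl | hx
      · simp only at h; linarith
      · have := hb x hx; linarith) (by linarith)
  refine ⟨(-10 * M, s), (10 * M, t), (r, 30 * M), ?_, ?_, ?_, ?_, ?_, ?_,
    ((hS.insert hs).insert ht).insert hr, ?_, fun x hx => ?_⟩
  · intro h; have := hb _ h; simp only at this; linarith
  · intro h; have := hb _ h; simp only at this; linarith
  · intro h; have := hb _ h; simp only at this; linarith
  · intro h; simp only [Prod.mk.injEq] at h; linarith
  · intro h; simp only [Prod.mk.injEq] at h; linarith
  · intro h; simp only [Prod.mk.injEq] at h; linarith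
  · simp only [det3]
    nlinarith [mul_pos hM hM, mul_pos (sub_pos.2 hs2) hM, mul_pos (sub_pos.2 hr1) hM,
      mul_nonneg (show 0 ≤ t - s + M by linarith) (show 0 ≤ r + 10 * M by linarith),
      mul_nonneg (show 0 ≤ M - (t - s) by linarith) (show 0 ≤ r + 10 * M by linarith)]
  · obtain ⟨⟨h1, h2⟩, h3, h4⟩ := hb x hx
    simp only [det3]
    refine ⟨?_, ?_, ?_⟩
    · nlinarith [mul_pos hM hM, mul_nonneg (show 0 ≤ x.2 - s - 3 * M by linarith) hM.le,
        mul_nonneg (show 0 ≤ M - (t - s) by linarith) (show 0 ≤ x.1 + 10 * M by linarith),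
        mul_nonneg (show 0 ≤ M - x.1 by linarith) hM.le]
    · have h5 : (34 * M) * (9 * M) ≤ (30 * M - t) * (10 * M - x.1) := by
        apply mul_le_mul <;> linarith
      have h6 : (10 * M - r) * (x.2 - t) ≤ (11 * M) * (6 * M) := by
        apply mul_le_mul <;> linarith
      nlinarith [mul_pos hM hM]
    · have h5 : (34 * M) * (9 * M) ≤ (30 * M - s) * (10 * M + x.1) := by
        apply mul_le_mul <;> linarith
      have h6 : (10 * M + r) * (x.2 - s) ≤ (11 * M) * (6 * M) := by
        apply mul_le_mul <;> linarith
      nlinarith [mul_pos hM hM]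

/-- The generating function of the plane graphs on `S` by number of edges. -/
def edgeGF (S : Finset Pt) (x : ℝ) : ℝ := ∑ G ∈ planeGraphs S, x ^ G.card

theorem mem_planeGraphs {S : Finset Pt} {G : Finset (Sym2 Pt)} :
    G ∈ planeGraphs S ↔ IsPlaneGraph S G := by
  simp only [planeGraphs, Finset.mem_filter, Finset.mem_powerset, and_iff_right_iff_imp]
  intro h e he
  rw [Finset.mem_sym2_iff]
  exact (h.1 e he).2

theorem edgesCross_of_cr {S : Finset Pt} (hS : DetGen S) {a b c d : {x // x ∈ S}}
    (h : @CC.Cr _ hS.cc a b c d) : EdgesCross s(a.1, b.1) s(c.1, d.1) := by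
  have key : ∀ a b c d : {x // x ∈ S}, @CC.Opp _ hS.cc a b c d →
      det3 a.1 b.1 c.1 * det3 a.1 b.1 d.1 < 0 := by
    rintro a b c d (⟨h1, h2⟩ | ⟨h1, h2⟩)
    · change 0 < det3 a.1 b.1 c.1 at h1
      change 0 < det3 b.1 a.1 d.1 at h2
      rw [det3_swap] at h2
      nlinarith
    · change 0 < det3 b.1 a.1 c.1 at h1
      change 0 < det3 a.1 b.1 d.1 at h2
      rw [det3_swap] at h1
      nlinarith
  exact edgesCross_of_det3 (key _ _ _ _ h.1) (key _ _ _ _ h.2)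

theorem planeGraphs_subset {S S' : Finset Pt} (hS : DetGen S') (hSS : S ⊆ S') :
    planeGraphs S ⊆ (@CC.tris _ hS.cc Finset.univ).biUnion
      fun T => (T.image (Sym2.map Subtype.val)).powerset := by
  let _ := hS.cc
  intro G hG
  rw [mem_planeGraphs] at hG
  obtain ⟨h1, h2⟩ := hG
  have hP : CC.Plane Finset.univ
      ((Finset.univ : Finset (Sym2 {x // x ∈ S'})).filter fun e => e.map Subtype.val ∈ G) := by
    refine ⟨fun _ => Finset.mem_univ _, ?_, ?_⟩
    · rintro a b h rfl
      simp only [Finset.mem_filter, Sym2.map_mk] at h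
      exact (h1 _ h.2).1 (by simp)
    · intro a b c d hab hcd hX
      simp only [Finset.mem_filter, Sym2.map_mk] at hab hcd
      refine h2 _ hab.2 _ hcd.2 ?_ (edgesCross_of_cr hS hX)
      have := hX.ne
      intro h
      rw [Sym2.eq_iff] at h
      rcases h with h | h
      · exact this.2.2.1 (Subtype.ext h.1)
      · exact this.2.2.2.1 (Subtype.ext h.1)
  obtain ⟨T, hT, hHT⟩ := CC.exists_tri hP
  rw [Finset.mem_biUnion]
  refine ⟨T, CC.mem_tris.2 hT, ?_⟩
  rw [Finset.mem_powerset]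
  intro e he
  have hm := (h1 e he).2
  induction e with
  | _ a b =>
    have ha := hSS (hm a (by simp))
    have hb := hSS (hm b (by simp))
    exact Finset.mem_image.2 ⟨s(⟨a, ha⟩, ⟨b, hb⟩), hHT (by simpa using he), by simp⟩

theorem sum_biUnion_le {α β : Type*} [DecidableEq β] (s : Finset α) (t : α → Finset β)
    {f : β → ℝ} (hf : ∀ b, 0 ≤ f b) : ∑ b ∈ s.biUnion t, f b ≤ ∑ a ∈ s, ∑ b ∈ t a, f b := by
  induction s using Finset.induction_on with
  | empty => simp
  | insert a s ha ih =>
    rw [Finset.biUnion_insert, Finset.sum_insert ha]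
    have h1 := Finset.sum_union_inter (s₁ := t a) (s₂ := s.biUnion t) (f := f)
    have h2 : 0 ≤ ∑ b ∈ t a ∩ s.biUnion t, f b := Finset.sum_nonneg fun b _ => hf b
    linarith

theorem edgeGF_le {S : Finset Pt} (hS : GenPos S) {x : ℝ} (hx : 0 ≤ x) :
    edgeGF S x ≤ (1 + x) ^ 3 * (300 / 11 * (1 + x) ^ 3) ^ S.card := by
  obtain ⟨A, B, C, hA, hB, hC, hAB, hBC, hAC, hD, hABC, hin⟩ := exists_hull S hS.detGen
  set S' := insert C (insert B (insert A S)) with hS'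
  let _ := hD.cc
  have hcard : (Finset.univ : Finset {x // x ∈ S'}).card = S.card + 3 := by
    rw [Finset.card_univ, Fintype.card_coe, hS', Finset.card_insert_of_notMem,
      Finset.card_insert_of_notMem, Finset.card_insert_of_notMem hA]
    · simp [hAB.symm, hB]
    · simp [hAC.symm, hBC.symm, hC]
  have hH : CC.Hull (Finset.univ : Finset {x // x ∈ S'}) ⟨A, by simp [hS']⟩ ⟨B, by simp [hS']⟩
      ⟨C, by simp [hS']⟩ := by
    refine ⟨Finset.mem_univ _, Finset.mem_univ _, Finset.mem_univ _, hABC, ?_⟩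
    rintro ⟨y, hy⟩ -
    simp only [hS', Finset.mem_insert] at hy
    simp only [Subtype.mk.injEq]
    rcases hy with hy | hy | hy | hy
    · exact Or.inr (Or.inr (Or.inl hy))
    · exact Or.inr (Or.inl hy)
    · exact Or.inl hy
    · exact Or.inr (Or.inr (Or.inr (hin y hy)))
  have hsub := planeGraphs_subset hD (S := S) (by
    intro y hy; simp [hS', hy])
  have hT : ∀ T ∈ CC.tris (Finset.univ : Finset {x // x ∈ S'}),
      ∑ G ∈ (T.image (Sym2.map Subtype.val)).powerset, x ^ G.card ≤ (1 + x) ^ (3 * S.card + 3) := by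
    intro T hT
    have h1 := CC.Tri.card_eq hH (CC.mem_tris.1 hT)
    have h2 := Finset.sum_pow_mul_eq_add_pow x 1 (T.image (Sym2.map Subtype.val))
    simp only [one_pow, mul_one] at h2
    rw [h2, add_comm x]
    exact pow_le_pow_right₀ (by linarith) (Finset.card_image_le.trans (by omega))
  have hN : ((CC.tris (Finset.univ : Finset {x // x ∈ S'})).card : ℝ) ≤ (300 / 11) ^ S.card := by
    rw [div_pow, le_div_iff₀ (by positivity)]
    exact_mod_cast CC.card_tris_le hH hcard
  calc edgeGF S x ≤ ∑ G ∈ (CC.tris (Finset.univ : Finset {x // x ∈ S'})).biUnion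
        fun T => (T.image (Sym2.map Subtype.val)).powerset, x ^ G.card :=
        Finset.sum_le_sum_of_subset_of_nonneg hsub fun _ _ _ => by positivity
    _ ≤ ∑ T ∈ CC.tris (Finset.univ : Finset {x // x ∈ S'}),
        ∑ G ∈ (T.image (Sym2.map Subtype.val)).powerset, x ^ G.card :=
        sum_biUnion_le _ _ fun _ => by positivity
    _ ≤ ∑ T ∈ CC.tris (Finset.univ : Finset {x // x ∈ S'}), (1 + x) ^ (3 * S.card + 3) :=
        Finset.sum_le_sum hT
    _ ≤ (300 / 11) ^ S.card * (1 + x) ^ (3 * S.card + 3) := by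
        rw [Finset.sum_const, nsmul_eq_mul]
        gcongr
    _ = _ := by rw [mul_pow, pow_add, pow_mul]; ring

theorem EdgesCross.symm {e f : Sym2 Pt} (h : EdgesCross e f) : EdgesCross f e := by
  obtain ⟨a, b, c, d, h1, h2, h3⟩ := h
  exact ⟨c, d, a, b, h2, h1, by rwa [Set.inter_comm]⟩

theorem not_edgesCross_of_det3_ne_zero {p u v : Pt} (h : det3 p u v ≠ 0) :
    ¬ EdgesCross s(p, u) s(p, v) := by
  rintro ⟨a, b, c, d, h1, h2, x, hx, hx'⟩
  have e1 : openSegment ℝ a b = openSegment ℝ p u := by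
    rcases Sym2.eq_iff.1 h1 with ⟨rfl, rfl⟩ | ⟨rfl, rfl⟩
    · rfl
    · exact openSegment_symm _ _ _
  have e2 : openSegment ℝ c d = openSegment ℝ p v := by
    rcases Sym2.eq_iff.1 h2 with ⟨rfl, rfl⟩ | ⟨rfl, rfl⟩
    · rfl
    · exact openSegment_symm _ _ _
  rw [e1] at hx
  rw [e2] at hx'
  obtain ⟨r, s, hr, hs, hrs, rfl⟩ := hx
  obtain ⟨r', s', hr', hs', hrs', h3⟩ := hx'
  have h4 := congrArg Prod.fst h3
  have h5 := congrArg Prod.snd h3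
  simp only [Prod.fst_add, Prod.snd_add, Prod.smul_fst, Prod.smul_snd, smul_eq_mul] at h4 h5
  obtain rfl : r = 1 - s := by linarith
  obtain rfl : r' = 1 - s' := by linarith
  refine h (mul_left_cancel₀ hs.ne' ?_)
  simp only [det3]
  linear_combination (v.1 - p.1) * h5 - (v.2 - p.2) * h4

/-- The edges from `p` to points of `S` that can be added to `G`. -/
def freeStar (S : Finset Pt) (G : Finset (Sym2 Pt)) (p : Pt) : Finset (Sym2 Pt) :=
  ((S.erase p).image fun v => s(p, v)).filter fun e => ∀ f ∈ G, ¬ EdgesCross f e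

theorem filter_planeGraphs_eq {S : Finset Pt} (hS : GenPos S) {p : Pt} (hp : p ∈ S)
    {G₀ : Finset (Sym2 Pt)} (hG₀ : G₀ ∈ planeGraphs (S.erase p)) :
    (planeGraphs S).filter (fun G => G.filter (p ∉ ·) = G₀) =
      (freeStar S G₀ p).powerset.image (G₀ ∪ ·) := by
  rw [mem_planeGraphs] at hG₀
  obtain ⟨hd, hc⟩ := hG₀
  have hp₀ : ∀ e ∈ G₀, p ∉ e := fun e he h => by simpa using (hd e he).2 p h
  ext G
  simp only [Finset.mem_filter, mem_planeGraphs, Finset.mem_image, Finset.mem_powerset]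
  constructor
  · rintro ⟨hG, rfl⟩
    refine ⟨G.filter (p ∈ ·), fun e he => ?_, ?_⟩
    · obtain ⟨he, hpe⟩ := Finset.mem_filter.1 he
      simp only [freeStar, Finset.mem_filter, Finset.mem_image, Finset.mem_erase]
      refine ⟨?_, fun f hf => hG.2 f hf.1 e he ?_⟩
      · obtain ⟨v, rfl⟩ := hpe
        exact ⟨v, ⟨fun h => (hG.1 _ he).1 (by simp [h]), (hG.1 _ he).2 v (by simp)⟩, rfl⟩
      · rintro rfl
        exact hf.2 hpe
    · ext e
      simp only [Finset.mem_union, Finset.mem_filter]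
      tauto
  · rintro ⟨R, hR, rfl⟩
    have hR' : ∀ e ∈ R, (∃ v ∈ S, v ≠ p ∧ e = s(p, v)) ∧ ∀ f ∈ G₀, ¬ EdgesCross f e := by
      intro e he
      have := hR he
      simp only [freeStar, Finset.mem_filter, Finset.mem_image, Finset.mem_erase] at this
      obtain ⟨⟨v, hv, rfl⟩, h⟩ := this
      exact ⟨⟨v, hv.2, hv.1, rfl⟩, h⟩
    refine ⟨⟨fun e he => ?_, fun e he f hf hef => ?_⟩, ?_⟩
    · rcases Finset.mem_union.1 he with he | he
      · exact ⟨(hd e he).1, fun x hx => Finset.mem_of_mem_erase ((hd e he).2 x hx)⟩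
      · obtain ⟨v, hv, hvp, rfl⟩ := (hR' e he).1
        refine ⟨by simpa using hvp.symm, fun x hx => ?_⟩
        rcases Sym2.mem_iff.1 hx with rfl | rfl
        · exact hp
        · exact hv
    · rcases Finset.mem_union.1 he with he | he <;> rcases Finset.mem_union.1 hf with hf | hf
      · exact hc e he f hf hef
      · exact (hR' f hf).2 e he
      · exact fun h => (hR' e he).2 f hf h.symm
      · obtain ⟨v, hv, hvp, rfl⟩ := (hR' e he).1
        obtain ⟨w, hw, hwp, rfl⟩ := (hR' f hf).1
        refine not_edgesCross_of_det3_ne_zero (hS.detGen p hp v hv w hw hvp.symm hwp.symm ?_)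
        rintro rfl
        exact hef rfl
    · ext e
      simp only [Finset.mem_filter, Finset.mem_union]
      constructor
      · rintro ⟨he | he, h⟩
        · exact he
        · obtain ⟨v, hv, hvp, rfl⟩ := (hR' e he).1
          simp at h
      · exact fun he => ⟨Or.inl he, hp₀ e he⟩

theorem mem_of_mem_freeStar {S : Finset Pt} {G : Finset (Sym2 Pt)} {p : Pt} {e : Sym2 Pt}
    (he : e ∈ freeStar S G p) : p ∈ e := by
  simp only [freeStar, Finset.mem_filter, Finset.mem_image] at he
  obtain ⟨⟨v, -, rfl⟩, -⟩ := he
  simp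

/-- A sum over plane graphs on `S` sorted by the graph that remains when `p` is deleted. -/
theorem sum_planeGraphs {S : Finset Pt} (hS : GenPos S) {p : Pt} (hp : p ∈ S) (F : ℕ → ℕ → ℝ) :
    ∑ G ∈ planeGraphs S, F G.card (vingDeg G p) =
      ∑ G ∈ planeGraphs (S.erase p),
        ∑ R ∈ (freeStar S G p).powerset, F (G.card + R.card) R.card := by
  rw [← Finset.sum_fiberwise_of_maps_to (t := planeGraphs (S.erase p))
    (g := fun G => G.filter (p ∉ ·))]
  · refine Finset.sum_congr rfl fun G₀ hG₀ => ?_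
    rw [filter_planeGraphs_eq hS hp hG₀]
    rw [mem_planeGraphs] at hG₀
    have hp₀ : ∀ e ∈ G₀, p ∉ e := fun e he h => by simpa using (hG₀.1 e he).2 p h
    have hdisj : ∀ R ⊆ freeStar S G₀ p, Disjoint G₀ R := fun R hR =>
      Finset.disjoint_left.2 fun e he he' => hp₀ e he (mem_of_mem_freeStar (hR he'))
    rw [Finset.sum_image]
    · refine Finset.sum_congr rfl fun R hR => ?_
      rw [Finset.mem_powerset] at hR
      rw [Finset.card_union_of_disjoint (hdisj R hR)]
      congr 1
      refine congrArg Finset.card (Finset.ext fun e => ?_)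
      simp only [Finset.mem_filter, Finset.mem_union]
      exact ⟨fun h => h.1.resolve_left fun he => hp₀ e he h.2,
        fun h => ⟨Or.inr h, mem_of_mem_freeStar (hR h)⟩⟩
    · intro R hR R' hR' h
      rw [Finset.mem_coe, Finset.mem_powerset] at hR hR'
      have := congrArg (· \ G₀) h
      simpa [Finset.union_sdiff_cancel_left (hdisj R hR),
        Finset.union_sdiff_cancel_left (hdisj R' hR')] using this
  · intro G hG
    rw [mem_planeGraphs] at hG ⊢
    refine ⟨fun e he => ⟨(hG.1 e (Finset.mem_filter.1 he).1).1, fun x hx => ?_⟩,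
      fun e he f hf => hG.2 e (Finset.mem_filter.1 he).1 f (Finset.mem_filter.1 hf).1⟩
    refine Finset.mem_erase.2 ⟨?_, (hG.1 e (Finset.mem_filter.1 he).1).2 x hx⟩
    rintro rfl
    exact (Finset.mem_filter.1 he).2 hx

theorem sum_powerset_card_mul_pow {α : Type*} (W : Finset α) (x : ℝ) :
    (1 + x) * ∑ R ∈ W.powerset, (R.card : ℝ) * x ^ R.card = W.card * x * (1 + x) ^ W.card := by
  induction W using Finset.induction_on with
  | empty => simp
  | insert a W ha ih =>
    have h2 := Finset.sum_pow_mul_eq_add_pow x 1 W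
    simp only [one_pow, mul_one] at h2
    have h3 : ∑ R ∈ W.powerset, ((insert a R).card : ℝ) * x ^ (insert a R).card =
        x * ∑ R ∈ W.powerset, (R.card : ℝ) * x ^ R.card + x * (x + 1) ^ W.card := by
      rw [← h2, Finset.mul_sum, Finset.mul_sum, ← Finset.sum_add_distrib]
      refine Finset.sum_congr rfl fun R hR => ?_
      rw [Finset.card_insert_of_notMem fun h => ha (Finset.mem_powerset.1 hR h)]
      push_cast
      ring
    rw [Finset.sum_powerset_insert ha, h3, Finset.card_insert_of_notMem ha]
    push_cast
    linear_combination (1 + x) * ih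

theorem one_add_pow_mul_le (i k : ℕ) {x : ℝ} (hx : 0 ≤ x) :
    (1 + x) ^ i * (1 + k * x / (1 + x) - i * x / (1 + x)) ≤ (1 + x) ^ k := by
  have hx1 : 0 < 1 + x := by linarith
  rcases le_total i k with h | h
  · obtain ⟨j, rfl⟩ := Nat.exists_eq_add_of_le h
    rw [pow_add]
    gcongr
    have h1 := one_add_mul_le_pow (a := x) (by linarith) j
    have h2 : (j : ℝ) * x / (1 + x) ≤ j * x := div_le_self (by positivity) (by linarith)
    have h3 : ((i + j : ℕ) : ℝ) * x / (1 + x) - i * x / (1 + x) = j * x / (1 + x) := by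
      push_cast; ring
    linarith
  · obtain ⟨j, rfl⟩ := Nat.exists_eq_add_of_le h
    rw [pow_add, mul_assoc]
    apply mul_le_of_le_one_right (by positivity)
    have h0 : x / (1 + x) ≤ 1 := by rw [div_le_one hx1]; linarith
    have h1 := one_add_mul_le_pow (a := -(x / (1 + x))) (by linarith) j
    have h2 : 1 + -(x / (1 + x)) = (1 + x)⁻¹ := by field_simp; ring
    have h3 : 1 + k * x / (1 + x) - ((k + j : ℕ) : ℝ) * x / (1 + x) = 1 + j * -(x / (1 + x)) := by
      push_cast; ring
    rw [h2] at h1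
    rw [h3]
    calc _ ≤ (1 + x) ^ j * (1 + x)⁻¹ ^ j := by gcongr
      _ = 1 := by rw [← mul_pow, mul_inv_cancel₀ hx1.ne', one_pow]

theorem mul_edgeGF_sub_le {S : Finset Pt} (hS : GenPos S) {p : Pt} (hp : p ∈ S) {x : ℝ}
    (hx : 0 ≤ x) (k : ℕ) :
    (1 + k * x / (1 + x)) * edgeGF S x - ∑ G ∈ planeGraphs S, x ^ G.card * vingDeg G p ≤
      (1 + x) ^ k * edgeGF (S.erase p) x := by
  have hx1 : 0 < 1 + x := by linarith
  rw [edgeGF, edgeGF, sum_planeGraphs hS hp fun m _ => x ^ m,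
    sum_planeGraphs hS hp fun m d => x ^ m * d, Finset.mul_sum, Finset.mul_sum,
    ← Finset.sum_sub_distrib]
  refine Finset.sum_le_sum fun G _ => ?_
  have h1 := Finset.sum_pow_mul_eq_add_pow x 1 (freeStar S G p)
  simp only [one_pow, mul_one] at h1
  have h2 := sum_powerset_card_mul_pow (freeStar S G p) x
  have h3 : ∑ R ∈ (freeStar S G p).powerset, x ^ (G.card + R.card) =
      x ^ G.card * (1 + x) ^ (freeStar S G p).card := by
    simp_rw [pow_add]
    rw [← Finset.mul_sum, h1, add_comm x]
  have h4 : ∑ R ∈ (freeStar S G p).powerset, x ^ (G.card + R.card) * R.card =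
      x ^ G.card * ((freeStar S G p).card * x / (1 + x) * (1 + x) ^ (freeStar S G p).card) := by
    rw [div_mul_eq_mul_div, ← h2, mul_div_cancel_left₀ _ hx1.ne', Finset.mul_sum]
    refine Finset.sum_congr rfl fun R _ => ?_
    ring
  rw [h3, h4]
  have := mul_le_mul_of_nonneg_left (one_add_pow_mul_le (freeStar S G p).card k hx)
    (pow_nonneg hx G.card)
  linarith

theorem sum_vingDeg {S : Finset Pt} {G : Finset (Sym2 Pt)} (hG : IsPlaneGraph S G) :
    ∑ p ∈ S, vingDeg G p = 2 * G.card := by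
  have h := Finset.sum_card_bipartiteAbove_eq_sum_card_bipartiteBelow (s := S) (t := G)
    (fun p e => p ∈ e)
  simp only [Finset.bipartiteAbove, Finset.bipartiteBelow] at h
  simp only [vingDeg]
  rw [h, Finset.sum_const_nat (m := 2), mul_comm]
  intro e he
  obtain ⟨h1, h2⟩ := hG.1 e he
  induction e with
  | _ a b =>
    rw [show S.filter (· ∈ s(a, b)) = {a, b} by
      ext x
      simp only [Finset.mem_filter, Sym2.mem_iff, Finset.mem_insert, Finset.mem_singleton,
        and_iff_right_iff_imp]
      exact fun h => h2 x (Sym2.mem_iff.2 h)]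
    exact Finset.card_pair (by simpa using h1)

theorem edgeGF_empty (x : ℝ) : edgeGF ∅ x = 1 := by
  have : planeGraphs ∅ = {∅} := by
    ext G
    rw [mem_planeGraphs, Finset.mem_singleton]
    constructor
    · intro h
      refine Finset.eq_empty_of_forall_notMem fun e he => ?_
      have := (h.1 e he).2
      induction e with | _ a b => simpa using this a (by simp)
    · rintro rfl
      simp [IsPlaneGraph]
  simp [edgeGF, this]

theorem GenPos.erase {S : Finset Pt} (hS : GenPos S) (p : Pt) : GenPos (S.erase p) :=
  fun a ha b hb c hc => hS a (Finset.mem_of_mem_erase ha) b (Finset.mem_of_mem_erase hb) c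
    (Finset.mem_of_mem_erase hc)

/-- The weighted number of edges of the plane graphs on `S`. -/
def edgeSum (S : Finset Pt) (x : ℝ) : ℝ := ∑ G ∈ planeGraphs S, x ^ G.card * G.card

theorem card_mul_edgeGF_sub_le {S : Finset Pt} (hS : GenPos S) {x : ℝ} (hx : 0 ≤ x) (k : ℕ) :
    S.card * (1 + k * x / (1 + x)) * edgeGF S x - 2 * edgeSum S x ≤
      (1 + x) ^ k * ∑ p ∈ S, edgeGF (S.erase p) x := by
  have h := Finset.sum_le_sum fun p hp => mul_edgeGF_sub_le hS (p := p) hp hx k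
  rw [Finset.sum_sub_distrib, Finset.sum_const, nsmul_eq_mul, Finset.sum_comm,
    ← Finset.mul_sum] at h
  have h2 : ∑ G ∈ planeGraphs S, ∑ p ∈ S, x ^ G.card * (vingDeg G p : ℝ) = 2 * edgeSum S x := by
    rw [edgeSum, Finset.mul_sum]
    refine Finset.sum_congr rfl fun G hG => ?_
    rw [← Finset.mul_sum, ← Nat.cast_sum, sum_vingDeg (mem_planeGraphs.1 hG)]
    push_cast
    ring
  linarith

/-- If the average number of edges at weight `x` is at least `t`, then increasing the weight to
`x * exp l` increases the generating function by a factor of at least `exp (l * t)`. -/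
theorem exp_mul_edgeGF_le {S : Finset Pt} {x l t : ℝ} (hx : 0 ≤ x) (hl : 0 ≤ l)
    (ht : t * edgeGF S x ≤ edgeSum S x) :
    Real.exp (l * t) * edgeGF S x ≤ edgeGF S (x * Real.exp l) := by
  have h1 : ∀ m : ℕ, Real.exp (l * t) * (x ^ m + l * (x ^ m * m - t * x ^ m)) ≤
      (x * Real.exp l) ^ m := by
    intro m
    have h2 := Real.add_one_le_exp (l * (m - t))
    have h3 : Real.exp l ^ m = Real.exp (l * t) * Real.exp (l * (m - t)) := by
      rw [← Real.exp_nat_mul, ← Real.exp_add]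
      ring_nf
    rw [mul_pow, h3]
    have := mul_le_mul_of_nonneg_left h2 (mul_nonneg (Real.exp_pos (l * t)).le (pow_nonneg hx m))
    linarith
  have h4 := Finset.sum_le_sum fun G (_ : G ∈ planeGraphs S) => h1 G.card
  rw [← Finset.mul_sum, Finset.sum_add_distrib, ← Finset.mul_sum, Finset.sum_sub_distrib,
    ← Finset.mul_sum] at h4
  refine le_trans ?_ h4
  have h5 : 0 ≤ l * (edgeSum S x - t * edgeGF S x) := mul_nonneg hl (by linarith)
  have h6 : edgeGF S x ≤ edgeGF S x + l * (edgeSum S x - t * edgeGF S x) := by linarith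
  exact mul_le_mul_of_nonneg_left h6 (Real.exp_pos _).le

theorem edgeGF_le_of_edgeGF_le {c₀ x y K K' : ℝ} (a d k : ℕ) (hx : 0 < x) (hxy : x ≤ y)
    (hK : 0 < K) (hd : d ≠ 0) (hc₀ : 1 ≤ c₀)
    (hpos : 0 < 1 + k * x / (1 + x) - 2 * (a / d : ℝ))
    (h₁ : (1 + x) ^ k ≤ K * (1 + k * x / (1 + x) - 2 * (a / d : ℝ)))
    (h₂ : K' ^ d * x ^ a ≤ K ^ d * y ^ a) (hK' : 0 < K')
    (hy : ∀ S, GenPos S → edgeGF S y ≤ c₀ * K' ^ S.card) :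
    ∀ S, GenPos S → edgeGF S x ≤ c₀ * K ^ S.card := by
  intro S hS
  induction hn : S.card generalizing S with
  | zero =>
    rw [Finset.card_eq_zero.1 hn, edgeGF_empty]
    simpa using hc₀
  | succ n ih =>
    have hn0 : (0 : ℝ) < n + 1 := by positivity
    have hd' : (0 : ℝ) < d := by positivity
    rcases le_total (edgeSum S x) ((a / d : ℝ) * S.card * edgeGF S x) with hE | hE
    · have h3 := card_mul_edgeGF_sub_le hS hx.le k
      have h4 : ∑ p ∈ S, edgeGF (S.erase p) x ≤ (n + 1) * (c₀ * K ^ n) := by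
        refine (Finset.sum_le_card_nsmul S _ (c₀ * K ^ n) fun p hp => ih _ (hS.erase p) ?_).trans ?_
        · rw [Finset.card_erase_of_mem hp, hn]; rfl
        · rw [hn, nsmul_eq_mul]; push_cast; rfl
      rw [hn] at h3 hE
      push_cast at h3 hE
      have h5 := mul_le_mul_of_nonneg_left h4 (show 0 ≤ (1 + x) ^ k by positivity)
      have h6 := mul_le_mul_of_nonneg_right h₁
        (show 0 ≤ (n + 1 : ℝ) * (c₀ * K ^ n) by positivity)
      refine le_of_mul_le_mul_left ?_ (mul_pos hn0 hpos)
      rw [pow_succ]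
      linarith
    · set l := Real.log (y / x) with hl
      have hl0 : 0 ≤ l := Real.log_nonneg (by rw [one_le_div hx]; exact hxy)
      have hexp : Real.exp l = y / x := Real.exp_log (div_pos (hx.trans_le hxy) hx)
      have h3 := exp_mul_edgeGF_le hx.le hl0 hE
      rw [hexp, mul_div_cancel₀ _ hx.ne'] at h3
      have h4 : K' ≤ Real.exp (l * (a / d)) * K := by
        refine le_of_pow_le_pow_left₀ hd (by positivity) ?_
        rw [mul_pow, ← Real.exp_nat_mul, show (d : ℝ) * (l * (a / d)) = a * l by field_simp,
          Real.exp_nat_mul, hexp, div_pow, div_mul_eq_mul_div, le_div_iff₀ (by positivity)]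
        linarith
      have h5 : Real.exp (l * (a / d * S.card)) = Real.exp (l * (a / d)) ^ S.card := by
        rw [← Real.exp_nat_mul]; ring_nf
      have h6 : K' ^ S.card ≤ Real.exp (l * (a / d * S.card)) * K ^ S.card := by
        rw [h5, ← mul_pow]
        gcongr
      rw [← hn]
      refine le_of_mul_le_mul_left ?_ (Real.exp_pos (l * (a / d * S.card)))
      calc _ ≤ _ := h3
        _ ≤ _ := hy S hS
        _ ≤ c₀ * (Real.exp (l * (a / d * S.card)) * K ^ S.card) := by gcongr
        _ = _ := by ring

theorem edgeGF_one_le : ∀ S, GenPos S → edgeGF S 1 ≤ 27 * (18753 / 100) ^ S.card := by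
  have h0 : ∀ S, GenPos S → edgeGF S 2 ≤ 27 * (8100 / 11) ^ S.card := by
    intro S hS
    have h := edgeGF_le hS (x := 2) (by norm_num)
    norm_num at h ⊢
    exact h
  have h1 := edgeGF_le_of_edgeGF_le (x := 189 / 100) (K := 16423 / 25) 111 55 6 (by norm_num)
    (by norm_num) (by norm_num) (by norm_num) (by norm_num) (by norm_num) (by norm_num)
    (by norm_num) (by norm_num) h0
  have h2 := edgeGF_le_of_edgeGF_le (x := 89 / 50) (K := 14546 / 25) 168 83 6 (by norm_num)
    (by norm_num) (by norm_num) (by norm_num) (by norm_num) (by norm_num) (by norm_num)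
    (by norm_num) (by norm_num) h1
  have h3 := edgeGF_le_of_edgeGF_le (x := 42 / 25) (K := 51763 / 100) 180 89 6 (by norm_num)
    (by norm_num) (by norm_num) (by norm_num) (by norm_num) (by norm_num) (by norm_num)
    (by norm_num) (by norm_num) h2
  have h4 := edgeGF_le_of_edgeGF_le (x := 317 / 200) (K := 23017 / 50) 133 66 6 (by norm_num)
    (by norm_num) (by norm_num) (by norm_num) (by norm_num) (by norm_num) (by norm_num)
    (by norm_num) (by norm_num) h3
  have h5 := edgeGF_le_of_edgeGF_le (x := 3 / 2) (K := 41229 / 100) 2 1 6 (by norm_num)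
    (by norm_num) (by norm_num) (by norm_num) (by norm_num) (by norm_num) (by norm_num)
    (by norm_num) (by norm_num) h4
  have h6 := edgeGF_le_of_edgeGF_le (x := 283 / 200) (K := 9179 / 25) 159 80 6 (by norm_num)
    (by norm_num) (by norm_num) (by norm_num) (by norm_num) (by norm_num) (by norm_num)
    (by norm_num) (by norm_num) h5
  have h7 := edgeGF_le_of_edgeGF_le (x := 267 / 200) (K := 8186 / 25) 181 92 6 (by norm_num)
    (by norm_num) (by norm_num) (by norm_num) (by norm_num) (by norm_num) (by norm_num)
    (by norm_num) (by norm_num) h6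
  have h8 := edgeGF_le_of_edgeGF_le (x := 63 / 50) (K := 29263 / 100) 35 18 6 (by norm_num)
    (by norm_num) (by norm_num) (by norm_num) (by norm_num) (by norm_num) (by norm_num)
    (by norm_num) (by norm_num) h7
  have h9 := edgeGF_le_of_edgeGF_le (x := 119 / 100) (K := 26191 / 100) 163 84 7 (by norm_num)
    (by norm_num) (by norm_num) (by norm_num) (by norm_num) (by norm_num) (by norm_num)
    (by norm_num) (by norm_num) h8
  have h10 := edgeGF_le_of_edgeGF_le (x := 28 / 25) (K := 5823 / 25) 60 31 7 (by norm_num)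
    (by norm_num) (by norm_num) (by norm_num) (by norm_num) (by norm_num) (by norm_num)
    (by norm_num) (by norm_num) h9
  have h11 := edgeGF_le_of_edgeGF_le (x := 53 / 50) (K := 419 / 2) 77 40 7 (by norm_num)
    (by norm_num) (by norm_num) (by norm_num) (by norm_num) (by norm_num) (by norm_num)
    (by norm_num) (by norm_num) h10
  exact edgeGF_le_of_edgeGF_le (x := 1) (K := 18753 / 100) 187 98 7 (by norm_num)
    (by norm_num) (by norm_num) (by norm_num) (by norm_num) (by norm_num) (by norm_num)
    (by norm_num) (by norm_num) h11

/-- Theorem 2.9. `pg(N) = O*(187.53^N)`: there is a polynomial `P`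
with `pg(N) ≤ P(N) · 187.53 ^ N` for all `N ≥ 1`. -/
theorem stmt7 :
    ∃ P : Polynomial ℝ, ∀ N : ℕ, 1 ≤ N →
      (pgMax N : ℝ) ≤ P.eval (N : ℝ) * 187.53 ^ N := by
  refine ⟨Polynomial.C 27, fun N _ => ?_⟩
  rw [Polynomial.eval_C]
  have h : ∀ n ∈ {n : ℕ | ∃ S : Finset Pt, S.card = N ∧ GenPos S ∧ (planeGraphs S).card = n},
      (n : ℝ) ≤ 27 * 187.53 ^ N := by
    rintro n ⟨S, rfl, hS, rfl⟩
    have := edgeGF_one_le S hS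
    simp only [edgeGF, one_pow, Finset.sum_const, nsmul_eq_mul, mul_one] at this
    norm_num at this ⊢
    exact this
  rw [pgMax]
  rcases Set.eq_empty_or_nonempty
    {n : ℕ | ∃ S : Finset Pt, S.card = N ∧ GenPos S ∧ (planeGraphs S).card = n} with h0 | h0
  · rw [h0, csSup_empty]
    simp only [bot_eq_zero', Nat.cast_zero]
    positivity
  · exact h _ (Nat.sSup_mem h0 ⟨_, fun n hn => Nat.le_floor (h n hn)⟩)
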